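/- arXiv:0710.4375 — 3 statements merged into one kernel-verified Lean document; each statement's English description precedes it below -/
import Mathlib

section
/- Let Δ ⊂ ℝ^n (n ≥ 1) be the convex hull of a finite subset of ℤ^n with nonempty interior, φ_Δ(v) = log(Σ_{α ∈ Δ∩ℤ^n} e^{⟨α,v⟩}), χ : ℝ^n → ℝ smooth with compact support, φ = φ_Δ + χ, and let φ_e be the convex envelope of φ. Then for Lebesgue-almost every v ∈ ℝ^n with φ_e(v) < φ(v), the gradient map ∇φ_e is differentiable at v and det(D(∇φ_e)(v)) = 0; that is, the Monge–Ampère density of the envelope vanishes almost everywhere off the contact set. (This is the toric-model instance of the proposition that (dd^cφ_e)^n = 0 on the complement of D = {φ_e = φ}.) -/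
open scoped RealInnerProductSpace
open MeasureTheory Filter

/-- The convex envelope of a function `φ : ℝⁿ → ℝ`: the pointwise supremum of all
convex minorants of `φ`. -/
noncomputable def convEnv {n : ℕ} (φ : EuclideanSpace ℝ (Fin n) → ℝ)
    (v : EuclideanSpace ℝ (Fin n)) : ℝ :=
  sSup {y : ℝ | ∃ g : EuclideanSpace ℝ (Fin n) → ℝ,
    ConvexOn ℝ Set.univ g ∧ (∀ w, g w ≤ φ w) ∧ y = g v}




lemma aux_subgrad {n : ℕ} {f : EuclideanSpace ℝ (Fin n) → ℝ} (hf : ConvexOn ℝ Set.univ f)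
    (v : EuclideanSpace ℝ (Fin n)) :
    ∃ p : EuclideanSpace ℝ (Fin n), ∀ w, f v + ⟪p, w - v⟫ ≤ f w := by
  have hc : Continuous f := by
    have := hf.continuousOn isOpen_univ
    exact continuousOn_univ.mp this
  have hconv : Convex ℝ {q : EuclideanSpace ℝ (Fin n) × ℝ | q.1 ∈ Set.univ ∧ f q.1 < q.2} :=
    hf.convex_strict_epigraph
  have hopen : IsOpen {q : EuclideanSpace ℝ (Fin n) × ℝ | q.1 ∈ Set.univ ∧ f q.1 < q.2} := by
    simp only [Set.mem_univ, true_and]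
    exact isOpen_lt (hc.comp continuous_fst) continuous_snd
  obtain ⟨L, hL⟩ := geometric_hahn_banach_point_open (x := (v, f v)) hconv hopen (by simp)
  have hdec : ∀ (w : EuclideanSpace ℝ (Fin n)) (t : ℝ), L (w, t) = L (w, 0) + t * L (0, 1) := by
    intro w t
    have : ((w, t) : EuclideanSpace ℝ (Fin n) × ℝ) = (w, 0) + t • (0, 1) := by simp
    rw [this, map_add, map_smul, smul_eq_mul]
  set c := L (0, 1) with hcdef
  have hcpos : 0 < c := by
    have h := hL (v, f v + 1) (by simp)
    rw [hdec v (f v), hdec v (f v + 1)] at h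
    linarith
  let l : EuclideanSpace ℝ (Fin n) →L[ℝ] ℝ := L.comp (ContinuousLinearMap.inl ℝ _ ℝ)
  have hl : ∀ w, l w = L (w, 0) := fun w => by simp [l]
  refine ⟨-(c⁻¹ • (InnerProductSpace.toDual ℝ _).symm l), fun w => ?_⟩
  rw [inner_neg_left, real_inner_smul_left, InnerProductSpace.toDual_symm_apply, map_sub, hl, hl]
  have key : ∀ ε > 0, L (v, 0) + f v * c ≤ L (w, 0) + (f w + ε) * c := by
    intro ε hε
    have h := hL (w, f w + ε) (by simpa using hε)
    rw [hdec v (f v), hdec w (f w + ε)] at h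
    exact h.le
  have key2 : L (v, 0) + f v * c ≤ L (w, 0) + f w * c := by
    refine le_of_forall_pos_le_add fun ε hε => ?_
    have := key (ε / c) (by positivity)
    have h3 : (f w + ε / c) * c = f w * c + ε := by field_simp
    linarith
  have : c⁻¹ * (L (w, 0) - L (v, 0)) ≥ f v - f w := by
    rw [ge_iff_le, inv_mul_eq_div, le_div_iff₀ hcpos]
    linarith
  linarith

lemma aux_quad {n : ℕ} {f : EuclideanSpace ℝ (Fin n) → ℝ} {C : ℝ}
    (hC : ∀ v h, f (v + h) + f (v - h) - 2 * f v ≤ C * ‖h‖ ^ 2)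
    {v p : EuclideanSpace ℝ (Fin n)} (hp : ∀ w, f v + ⟪p, w - v⟫ ≤ f w)
    (w : EuclideanSpace ℝ (Fin n)) : f w ≤ f v + ⟪p, w - v⟫ + C * ‖w - v‖ ^ 2 := by
  have h1 := hC v (w - v)
  have h2 := hp (v - (w - v))
  have e : v - (w - v) - v = -(w - v) := by abel
  rw [e, inner_neg_right] at h2
  rw [add_sub_cancel] at h1
  linarith

lemma aux_grad {n : ℕ} {f : EuclideanSpace ℝ (Fin n) → ℝ} {C : ℝ}
    (hC : ∀ v h, f (v + h) + f (v - h) - 2 * f v ≤ C * ‖h‖ ^ 2)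
    {v p : EuclideanSpace ℝ (Fin n)} (hp : ∀ w, f v + ⟪p, w - v⟫ ≤ f w) :
    gradient f v = p := by
  apply HasGradientAt.gradient
  rw [hasGradientAt_iff_isLittleO]
  have hO : (fun x' => f x' - f v - ⟪p, x' - v⟫) =O[nhds v] fun x' => ‖x' - v‖ ^ 2 := by
    refine Asymptotics.IsBigO.of_bound C (Eventually.of_forall fun w => ?_)
    have h1 := aux_quad hC hp w
    have h2 := hp w
    rw [Real.norm_of_nonneg (by linarith), Real.norm_of_nonneg (by positivity)]
    linarith
  refine hO.trans_isLittleO ?_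
  have := Asymptotics.isLittleO_pow_sub_sub v (m := 2) (by norm_num)
  exact this

lemma aux_lip {n : ℕ} {f : EuclideanSpace ℝ (Fin n) → ℝ} {C : ℝ} (hC0 : 0 ≤ C)
    (hf : ConvexOn ℝ Set.univ f)
    (hC : ∀ v h, f (v + h) + f (v - h) - 2 * f v ≤ C * ‖h‖ ^ 2) :
    LipschitzWith (4 * C).toNNReal (gradient f) := by
  refine LipschitzWith.of_dist_le_mul fun x y => ?_
  rw [Real.coe_toNNReal _ (by positivity), dist_comm, dist_comm x y, dist_eq_norm, dist_eq_norm]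
  obtain ⟨p, hp⟩ := aux_subgrad hf x
  obtain ⟨q, hq⟩ := aux_subgrad hf y
  rw [aux_grad hC hp, aux_grad hC hq]
  by_cases hpq : q - p = 0
  · rw [hpq, norm_zero]; positivity
  by_cases hxy : y - x = 0
  · have : y = x := sub_eq_zero.mp hxy
    subst this
    have := (aux_grad hC hp).symm.trans (aux_grad hC hq)
    exact absurd (by rw [this]; simp) hpq
  have a0 : 0 < ‖q - p‖ := norm_pos_iff.mpr hpq
  have b0 : 0 < ‖y - x‖ := norm_pos_iff.mpr hxy
  set w : EuclideanSpace ℝ (Fin n) := (‖y - x‖ / ‖q - p‖) • (q - p) with hw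
  have hwn : ‖w‖ = ‖y - x‖ := by
    rw [hw, norm_smul, Real.norm_of_nonneg (by positivity)]; field_simp
  have hin : ⟪q - p, w⟫ = ‖y - x‖ * ‖q - p‖ := by
    rw [hw, real_inner_smul_right, real_inner_self_eq_norm_sq]; field_simp
  have h1 := hq (y + w)
  have h2 := aux_quad hC hp (y + w)
  have h3 := hp y
  have e1 : y + w - y = w := by abel
  have e2 : y + w - x = w + (y - x) := by abel
  rw [e1] at h1
  rw [e2, inner_add_right] at h2
  have h4 : ‖w + (y - x)‖ ^ 2 ≤ (2 * ‖y - x‖) ^ 2 := by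
    have := norm_add_le w (y - x)
    gcongr; linarith
  have h5 := mul_le_mul_of_nonneg_left h4 hC0
  rw [inner_sub_left] at hin
  have : ‖q - p‖ * ‖y - x‖ ≤ 4 * C * ‖y - x‖ * ‖y - x‖ := by nlinarith
  exact le_of_mul_le_mul_right this b0

/-! ### the envelope -/

lemma convEnv_bdd {n : ℕ} (φ : EuclideanSpace ℝ (Fin n) → ℝ) (v : EuclideanSpace ℝ (Fin n)) :
    BddAbove {y : ℝ | ∃ g : EuclideanSpace ℝ (Fin n) → ℝ,
      ConvexOn ℝ Set.univ g ∧ (∀ w, g w ≤ φ w) ∧ y = g v} := by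
  refine ⟨φ v, ?_⟩
  rintro y ⟨g, -, h, rfl⟩
  exact h v

lemma le_convEnv {n : ℕ} {φ g : EuclideanSpace ℝ (Fin n) → ℝ} (hg : ConvexOn ℝ Set.univ g)
    (h : ∀ w, g w ≤ φ w) (v : EuclideanSpace ℝ (Fin n)) : g v ≤ convEnv φ v :=
  le_csSup (convEnv_bdd φ v) ⟨g, hg, h, rfl⟩

lemma convEnv_le {n : ℕ} {φ : EuclideanSpace ℝ (Fin n) → ℝ}
    (hne : ∃ g : EuclideanSpace ℝ (Fin n) → ℝ, ConvexOn ℝ Set.univ g ∧ ∀ w, g w ≤ φ w)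
    {v : EuclideanSpace ℝ (Fin n)} {b : ℝ}
    (h : ∀ g : EuclideanSpace ℝ (Fin n) → ℝ, ConvexOn ℝ Set.univ g → (∀ w, g w ≤ φ w) →
      g v ≤ b) : convEnv φ v ≤ b := by
  obtain ⟨g, hg, hgφ⟩ := hne
  refine csSup_le ⟨g v, g, hg, hgφ, rfl⟩ ?_
  rintro y ⟨g, h1, h2, rfl⟩
  exact h g h1 h2

lemma convEnv_convex {n : ℕ} {φ : EuclideanSpace ℝ (Fin n) → ℝ}
    (hne : ∃ g : EuclideanSpace ℝ (Fin n) → ℝ, ConvexOn ℝ Set.univ g ∧ ∀ w, g w ≤ φ w) :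
    ConvexOn ℝ Set.univ (convEnv φ) := by
  refine ⟨convex_univ, fun x _ y _ a b ha hb hab => convEnv_le hne fun g hg hgφ => ?_⟩
  refine (hg.2 (Set.mem_univ x) (Set.mem_univ y) ha hb hab).trans ?_
  have := le_convEnv hg hgφ x
  have := le_convEnv hg hgφ y
  simp only [smul_eq_mul]
  gcongr

lemma convEnv_semi {n : ℕ} {φ : EuclideanSpace ℝ (Fin n) → ℝ} {C : ℝ}
    (hne : ∃ g : EuclideanSpace ℝ (Fin n) → ℝ, ConvexOn ℝ Set.univ g ∧ ∀ w, g w ≤ φ w)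
    (hC : ∀ v h, φ (v + h) + φ (v - h) - 2 * φ v ≤ C * ‖h‖ ^ 2)
    (v h : EuclideanSpace ℝ (Fin n)) :
    convEnv φ (v + h) + convEnv φ (v - h) - 2 * convEnv φ v ≤ C * ‖h‖ ^ 2 := by
  have hcv := convEnv_convex hne
  have hle : ∀ w, convEnv φ w ≤ φ w := fun w => convEnv_le hne fun g _ hg => hg w
  have := le_convEnv (φ := φ)
    (g := fun w => (convEnv φ (w + h) + convEnv φ (w - h) - C * ‖h‖ ^ 2) / 2) ?_ ?_ v
  · linarith
  · refine ⟨convex_univ, fun x _ y _ a b ha hb hab => ?_⟩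
    have h1 := hcv.2 (Set.mem_univ (x + h)) (Set.mem_univ (y + h)) ha hb hab
    have h2 := hcv.2 (Set.mem_univ (x - h)) (Set.mem_univ (y - h)) ha hb hab
    have hh : h = a • h + b • h := by rw [← add_smul, hab, one_smul]
    have e1 : a • (x + h) + b • (y + h) = a • x + b • y + h := by
      nth_rewrite 3 [hh]; simp only [smul_add]; abel
    have e2 : a • (x - h) + b • (y - h) = a • x + b • y - h := by
      nth_rewrite 3 [hh]; simp only [smul_sub]; abel
    rw [e1] at h1
    rw [e2] at h2
    simp only [smul_eq_mul] at *
    have hb' : b = 1 - a := by linarith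
    subst hb'
    linarith
  · intro w
    have := hC w h
    have := hle (w + h)
    have := hle (w - h)
    linarith

lemma convEnv_flat {n : ℕ} {φ : EuclideanSpace ℝ (Fin n) → ℝ} (hφ : Continuous φ)
    (hne : ∃ g : EuclideanSpace ℝ (Fin n) → ℝ, ConvexOn ℝ Set.univ g ∧ ∀ w, g w ≤ φ w)
    {v p : EuclideanSpace ℝ (Fin n)} (hv : convEnv φ v < φ v)
    (hp : ∀ w, convEnv φ v + ⟪p, w - v⟫ ≤ convEnv φ w) :
    ∃ w, w ≠ v ∧ convEnv φ w = convEnv φ v + ⟪p, w - v⟫ := by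
  have hcv := convEnv_convex hne
  have hle : ∀ w, convEnv φ w ≤ φ w := fun w => convEnv_le hne fun g _ hg => hg w
  have hcont : Continuous (convEnv φ) := continuousOn_univ.mp (hcv.continuousOn isOpen_univ)
  by_contra! hcon
  set f := convEnv φ with hf
  have hpos : ∀ w, w ≠ v → 0 < f w - (f v + ⟪p, w - v⟫) := fun w hw =>
    sub_pos.mpr (lt_of_le_of_ne (hp w) (hcon w hw).symm)
  have hlc : Continuous fun w => f v + ⟪p, w - v⟫ := by fun_prop
  have hev : ∀ᶠ w in nhds v, f v + ⟪p, w - v⟫ + (φ v - f v) / 2 < φ w := by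
    have h1 : Continuous fun w => f v + ⟪p, w - v⟫ + (φ v - f v) / 2 := by fun_prop
    refine h1.continuousAt.eventually_lt hφ.continuousAt ?_
    simp only [sub_self, inner_zero_right]
    linarith
  obtain ⟨ρ, hρ, hball⟩ := Metric.eventually_nhds_iff_ball.mp hev
  obtain ⟨ε', hε', hsph⟩ := (isCompact_sphere v (ρ / 2)).exists_forall_le'
    (f := fun w => f w - (f v + ⟪p, w - v⟫)) (a := 0) (hcont.sub hlc).continuousOn (by
      intro w hw
      refine hpos w ?_
      rintro rfl
      simp at hw
      linarith)
  have hδ : 0 < (φ v - f v) / 2 := by linarith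
  set ε := min ε' ((φ v - f v) / 2) with hε
  have hε0 : 0 < ε := lt_min hε' hδ
  have hconv : ConvexOn ℝ Set.univ fun w => f v + ⟪p, w - v⟫ + ε := by
    refine ⟨convex_univ, fun x _ y _ a b ha hb hab => le_of_eq ?_⟩
    simp only [inner_sub_right, inner_add_right, real_inner_smul_right, smul_eq_mul]
    have hb' : b = 1 - a := by linarith
    subst hb'
    ring
  have hkey := le_convEnv (φ := φ) hconv ?_ v
  · simp only [sub_self, inner_zero_right] at hkey
    linarith
  intro w
  by_cases hw : ‖w - v‖ < ρ
  · have := hball w (by rwa [mem_ball_iff_norm])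
    have := min_le_right ε' ((φ v - f v) / 2)
    linarith
  · push Not at hw
    refine le_trans ?_ (hle w)
    have hw0 : 0 < ‖w - v‖ := by linarith
    set t := ρ / 2 / ‖w - v‖ with ht
    have ht0 : 0 < t := by positivity
    have ht1 : t ≤ 1 := by rw [ht, div_le_one hw0]; linarith
    have h1 := hsph ((1 - t) • v + t • w) (by
      have : (1 - t) • v + t • w - v = t • (w - v) := by
        rw [sub_smul, one_smul, smul_sub]; abel
      rw [mem_sphere_iff_norm, this, norm_smul, Real.norm_of_nonneg ht0.le, ht]
      field_simp)
    have h2 := hcv.2 (Set.mem_univ v) (Set.mem_univ w) (sub_nonneg.mpr ht1) ht0.le (by ring)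
    simp only [inner_sub_right, inner_add_right, real_inner_smul_right, smul_eq_mul] at h1 h2 ⊢
    have h3 := min_le_left ε' ((φ v - f v) / 2)
    have h4 := hp w
    rw [inner_sub_right] at h4
    have h5 : ε' ≤ t * (f w - (f v + (⟪p, w⟫ - ⟪p, v⟫))) := by linarith
    have h6 : t * (f w - (f v + (⟪p, w⟫ - ⟪p, v⟫))) ≤ f w - (f v + (⟪p, w⟫ - ⟪p, v⟫)) :=
      mul_le_of_le_one_left (by linarith) ht1
    linarith

lemma aux_det {n : ℕ} {f : EuclideanSpace ℝ (Fin n) → ℝ} {C : ℝ}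
    (hf : ConvexOn ℝ Set.univ f)
    (hC : ∀ v h, f (v + h) + f (v - h) - 2 * f v ≤ C * ‖h‖ ^ 2)
    {v p w : EuclideanSpace ℝ (Fin n)} (hp : ∀ w, f v + ⟪p, w - v⟫ ≤ f w) (hwv : w ≠ v)
    (hw : f w = f v + ⟪p, w - v⟫) (hd : DifferentiableAt ℝ (gradient f) v) :
    (fderiv ℝ (gradient f) v).det = 0 := by
  have hg : ∀ t ∈ Set.Icc (0 : ℝ) 1, gradient f (v + t • (w - v)) = p := by
    intro t ht
    apply aux_grad hC
    have h2 := hf.2 (Set.mem_univ v) (Set.mem_univ w) (sub_nonneg.mpr ht.2) ht.1 (by ring)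
    have e : (1 - t) • v + t • w = v + t • (w - v) := by
      rw [sub_smul, one_smul, smul_sub]; abel
    rw [e, hw] at h2
    intro x
    have h3 := hp x
    have : x - (v + t • (w - v)) = (x - v) - t • (w - v) := by abel
    rw [this, inner_sub_right p (x - v), real_inner_smul_right]
    simp only [smul_eq_mul] at h2
    linarith
  have hline : HasDerivAt (fun t : ℝ => gradient f (v + t • (w - v)))
      (fderiv ℝ (gradient f) v (w - v)) 0 := hd.hasFDerivAt.hasLineDerivAt (w - v)
  have h1 := hline.hasDerivWithinAt (s := Set.Icc (0 : ℝ) 1)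
  have h2 : HasDerivWithinAt (fun t : ℝ => gradient f (v + t • (w - v))) 0
      (Set.Icc (0 : ℝ) 1) 0 :=
    (hasDerivWithinAt_const (0 : ℝ) (Set.Icc (0 : ℝ) 1) p).congr hg (hg 0 (by simp))
  have h3 : fderiv ℝ (gradient f) v (w - v) = 0 :=
    (uniqueDiffOn_Icc (zero_lt_one' ℝ) 0 (by simp)).eq_deriv _ h1 h2
  rw [ContinuousLinearMap.det, LinearMap.det_eq_zero_iff_ker_ne_bot]
  intro hbot
  have : w - v ∈ LinearMap.ker (fderiv ℝ (gradient f) v : EuclideanSpace ℝ (Fin n) →ₗ[ℝ]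
      EuclideanSpace ℝ (Fin n)) := h3
  rw [hbot] at this
  exact hwv (sub_eq_zero.mp (by simpa using this))

/-! ### semiconcavity of the data -/

lemma aux_chi {n : ℕ} {χ : EuclideanSpace ℝ (Fin n) → ℝ}
    (hχ : ContDiff ℝ (⊤ : ℕ∞) χ) (hχc : HasCompactSupport χ) :
    ∃ C : ℝ, 0 ≤ C ∧ ∀ v h, χ (v + h) + χ (v - h) - 2 * χ v ≤ C * ‖h‖ ^ 2 := by
  have hd : ContDiff ℝ 1 (fderiv ℝ χ) := hχ.fderiv_right (by norm_cast)
  obtain ⟨L, hL⟩ := hd.lipschitzWith_of_hasCompactSupport (hχc.fderiv (𝕜 := ℝ)) (by norm_num)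
  refine ⟨2 * L, by positivity, fun v h => ?_⟩
  have key : ∀ k : EuclideanSpace ℝ (Fin n), χ (v + k) - χ v - fderiv ℝ χ v k ≤ L * ‖k‖ ^ 2 := by
    intro k
    have := (convex_closedBall v ‖k‖).norm_image_sub_le_of_norm_fderiv_le' (𝕜 := ℝ) (f := χ)
      (φ := fderiv ℝ χ v) (C := L * ‖k‖) (x := v) (y := v + k)
      (fun x _ => (hχ.differentiable (by simp)).differentiableAt)
      (fun x hx => by
        have := hL.dist_le_mul x v
        rw [dist_eq_norm] at this
        refine this.trans ?_
        have := Metric.mem_closedBall.mp hx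
        gcongr) (by simp) (by simp)
    rw [add_sub_cancel_left] at this
    have := (le_abs_self _).trans this
    linarith
  have h1 := key h
  have h2 := key (-h)
  rw [map_neg, norm_neg, ← sub_eq_add_neg] at h2
  linarith

lemma aux_lse {n : ℕ} (A : Finset (EuclideanSpace ℝ (Fin n))) :
    ∃ C : ℝ, 0 ≤ C ∧ ∀ v h : EuclideanSpace ℝ (Fin n),
      Real.log (∑ α ∈ A, Real.exp ⟪α, v + h⟫) + Real.log (∑ α ∈ A, Real.exp ⟪α, v - h⟫)
        - 2 * Real.log (∑ α ∈ A, Real.exp ⟪α, v⟫) ≤ C * ‖h‖ ^ 2 := by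
  rcases A.eq_empty_or_nonempty with rfl | hA
  · exact ⟨0, le_rfl, fun v h => by simp⟩
  set M := ∑ α ∈ A, ‖α‖ with hM
  have hMα : ∀ α ∈ A, ‖α‖ ≤ M := fun α hα =>
    Finset.single_le_sum (f := fun α => ‖α‖) (fun _ _ => norm_nonneg _) hα
  have hpos : ∀ v, 0 < ∑ α ∈ A, Real.exp ⟪α, v⟫ := fun v =>
    Finset.sum_pos (fun _ _ => Real.exp_pos _) hA
  refine ⟨(2 * M) ^ 2 / 2, by positivity, fun v h => ?_⟩
  set K := (2 * M) ^ 2 / 2 * ‖h‖ ^ 2 with hK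
  have key : (∑ α ∈ A, Real.exp ⟪α, v + h⟫) * (∑ α ∈ A, Real.exp ⟪α, v - h⟫)
      ≤ (∑ α ∈ A, Real.exp ⟪α, v⟫) * (∑ α ∈ A, Real.exp ⟪α, v⟫) * Real.exp K := by
    have e1 : (∑ α ∈ A, Real.exp ⟪α, v + h⟫) * (∑ α ∈ A, Real.exp ⟪α, v - h⟫)
        = ∑ α ∈ A, ∑ β ∈ A, Real.exp ⟪α, v⟫ * Real.exp ⟪β, v⟫ * Real.exp ⟪α - β, h⟫ := by
      rw [Finset.sum_mul_sum]
      refine Finset.sum_congr rfl fun α _ => Finset.sum_congr rfl fun β _ => ?_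
      simp only [← Real.exp_add, inner_add_right, inner_sub_right, inner_sub_left]
      congr 1; ring
    have e2 : (∑ α ∈ A, Real.exp ⟪α, v + h⟫) * (∑ α ∈ A, Real.exp ⟪α, v - h⟫)
        = ∑ α ∈ A, ∑ β ∈ A, Real.exp ⟪α, v⟫ * Real.exp ⟪β, v⟫ * Real.exp (-⟪α - β, h⟫) := by
      rw [e1, Finset.sum_comm]
      refine Finset.sum_congr rfl fun α _ => Finset.sum_congr rfl fun β _ => ?_
      rw [mul_comm (Real.exp ⟪β, v⟫), ← inner_neg_left, neg_sub]
    have e3 : (∑ α ∈ A, Real.exp ⟪α, v + h⟫) * (∑ α ∈ A, Real.exp ⟪α, v - h⟫)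
        = ∑ α ∈ A, ∑ β ∈ A, Real.exp ⟪α, v⟫ * Real.exp ⟪β, v⟫ * Real.cosh ⟪α - β, h⟫ := by
      have : ∀ x y z : ℝ, x = y → x = z → x = (y + z) / 2 := by intros; linarith
      rw [this _ _ _ e1 e2, ← Finset.sum_add_distrib, Finset.sum_div]
      refine Finset.sum_congr rfl fun α _ => ?_
      rw [← Finset.sum_add_distrib, Finset.sum_div]
      refine Finset.sum_congr rfl fun β _ => ?_
      rw [Real.cosh_eq]; ring
    rw [e3, Finset.sum_mul_sum, Finset.sum_mul]
    refine Finset.sum_le_sum fun α hα => ?_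
    rw [Finset.sum_mul]
    refine Finset.sum_le_sum fun β hβ => ?_
    refine mul_le_mul_of_nonneg_left ?_ (by positivity)
    refine (Real.cosh_le_exp_half_sq _).trans (Real.exp_le_exp.mpr ?_)
    have h1 : |⟪α - β, h⟫| ≤ 2 * M * ‖h‖ := by
      refine (abs_real_inner_le_norm _ _).trans ?_
      have := norm_sub_le α β
      have := hMα α hα
      have := hMα β hβ
      gcongr
      linarith
    have h2 : ⟪α - β, h⟫ ^ 2 ≤ (2 * M * ‖h‖) ^ 2 := by
      rw [← sq_abs]; gcongr
    rw [hK]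
    linarith [mul_pow (2 * M) ‖h‖ 2]
  have hl := Real.log_le_log (mul_pos (hpos _) (hpos _)) key
  rw [Real.log_mul (hpos _).ne' (hpos _).ne',
    Real.log_mul (mul_pos (hpos _) (hpos _)).ne' (Real.exp_pos _).ne',
    Real.log_mul (hpos _).ne' (hpos _).ne', Real.log_exp] at hl
  linarith

lemma aux_minorant {n : ℕ} (A : Finset (EuclideanSpace ℝ (Fin n)))
    {χ : EuclideanSpace ℝ (Fin n) → ℝ} (hχ : Continuous χ) (hχc : HasCompactSupport χ) :
    ∃ g : EuclideanSpace ℝ (Fin n) → ℝ, ConvexOn ℝ Set.univ g ∧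
      ∀ w, g w ≤ Real.log (∑ α ∈ A, Real.exp ⟪α, w⟫) + χ w := by
  obtain ⟨B, hB⟩ := hχc.exists_bound_of_continuous hχ
  have hB' : ∀ w, -B ≤ χ w := fun w => (abs_le.mp (hB w)).1
  rcases A.eq_empty_or_nonempty with rfl | ⟨α, hα⟩
  · exact ⟨fun _ => -B, convexOn_const _ convex_univ, fun w => by simpa using hB' w⟩
  refine ⟨fun w => ⟪α, w⟫ + -B, ?_, fun w => add_le_add ?_ (hB' w)⟩
  · refine ⟨convex_univ, fun x _ y _ a b ha hb hab => le_of_eq ?_⟩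
    simp only [inner_add_right, real_inner_smul_right, smul_eq_mul]
    have hb' : b = 1 - a := by linarith
    subst hb'
    ring
  · rw [← Real.log_exp ⟪α, w⟫]
    refine Real.log_le_log (Real.exp_pos _) ?_
    exact Finset.single_le_sum (f := fun α => Real.exp ⟪α, w⟫)
      (fun _ _ => (Real.exp_pos _).le) hα

lemma aux_cont {n : ℕ} (A : Finset (EuclideanSpace ℝ (Fin n))) :
    Continuous fun v : EuclideanSpace ℝ (Fin n) => Real.log (∑ α ∈ A, Real.exp ⟪α, v⟫) := by
  rcases A.eq_empty_or_nonempty with rfl | hA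
  · simpa using continuous_const
  refine Continuous.log (by fun_prop) fun v => ?_
  exact (Finset.sum_pos (fun _ _ => Real.exp_pos _) hA).ne'

/-- toric model of the vanishing `(dd^cφ_e)^n = 0` off the contact set.
With `φ = φ_Δ + χ` as in the toric setup and `φ_e` its convex envelope, for almost every
`v` with `φ_e(v) < φ(v)` the gradient map `∇φ_e` is differentiable at `v` and the
Monge–Ampère density `det(D(∇φ_e)(v))` vanishes. -/
theorem monge_ampere_vanishes_off_contact_toric (n : ℕ) (hn : 1 ≤ n)
    (S : Finset (EuclideanSpace ℝ (Fin n)))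
    (hS : ∀ α ∈ S, ∀ i, ∃ m : ℤ, α i = (m : ℝ))
    (Δ : Set (EuclideanSpace ℝ (Fin n)))
    (hΔ : Δ = convexHull ℝ (S : Set (EuclideanSpace ℝ (Fin n))))
    (hΔint : (interior Δ).Nonempty)
    (A : Finset (EuclideanSpace ℝ (Fin n)))
    (hA : (A : Set (EuclideanSpace ℝ (Fin n))) = Δ ∩ {v | ∀ i, ∃ m : ℤ, v i = (m : ℝ)})
    (φΔ χ φ : EuclideanSpace ℝ (Fin n) → ℝ)
    (hφΔ : ∀ v, φΔ v = Real.log (∑ α ∈ A, Real.exp ⟪α, v⟫))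
    (hχ : ContDiff ℝ (⊤ : ℕ∞) χ) (hχc : HasCompactSupport χ)
    (hφ : φ = φΔ + χ) :
    ∀ᵐ v ∂volume, convEnv φ v < φ v →
      DifferentiableAt ℝ (gradient (convEnv φ)) v ∧
      (fderiv ℝ (gradient (convEnv φ)) v).det = 0 := by
  obtain ⟨C₁, hC₁, h₁⟩ := aux_lse A
  obtain ⟨C₂, hC₂, h₂⟩ := aux_chi hχ hχc
  have hφ' : φ = fun v => Real.log (∑ α ∈ A, Real.exp ⟪α, v⟫) + χ v := by
    rw [hφ]; ext v; simp [hφΔ]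
  have hcont : Continuous φ := by
    rw [hφ']; exact (aux_cont A).add hχ.continuous
  have hne : ∃ g : EuclideanSpace ℝ (Fin n) → ℝ, ConvexOn ℝ Set.univ g ∧ ∀ w, g w ≤ φ w := by
    rw [hφ']; exact aux_minorant A hχ.continuous hχc
  have hC : ∀ v h, φ (v + h) + φ (v - h) - 2 * φ v ≤ (C₁ + C₂) * ‖h‖ ^ 2 := by
    intro v h
    have := h₁ v h
    have := h₂ v h
    simp only [hφ']
    linarith
  have hcv := convEnv_convex hne
  have hCe := convEnv_semi hne hC
  have hlip := aux_lip (add_nonneg hC₁ hC₂) hcv hCe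
  filter_upwards [hlip.ae_differentiableAt (μ := volume)] with v hd hv
  refine ⟨hd, ?_⟩
  obtain ⟨p, hp⟩ := aux_subgrad hcv v
  obtain ⟨w, hwv, hw⟩ := convEnv_flat hcont hne hv hp
  exact aux_det hcv hCe hp hwv hw hd
end

section
/- Let Δ ⊂ ℝ^n (n ≥ 1) be the convex hull of a finite subset of ℤ^n with nonempty interior, φ_Δ(v) = log(Σ_{α ∈ Δ∩ℤ^n} e^{⟨α,v⟩}), χ : ℝ^n → ℝ smooth with compact support, φ = φ_Δ + χ, φ_e the convex envelope of φ, and D = {v : φ_e(v) = φ(v)}. Then ∫_{ℝ^n} MA[φ_e](v) dv = vol_n(Δ) and ∫_{D} det(D²φ(v)) dv = vol_n(Δ), where MA[φ_e](v) = det(D(∇φ_e)(v)) at points of twice differentiability (defined almost everywhere) and D²φ is the Hessian of φ. (This is the toric-model instance of the identity Vol(L) = ∫_X μ_φ = ∫_{D∩X(0)} (dd^cφ)^n/n!, the metrized Fujita-type volume formula.) -/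
open scoped RealInnerProductSpace
open MeasureTheory Filter

section ToricAux

variable {E : Type*} [NormedAddCommGroup E] [InnerProductSpace ℝ E] [FiniteDimensional ℝ E]

/-- Existence of a subgradient for a finite convex function. -/
theorem aux_subgradient {u : E → ℝ} (hu : ConvexOn ℝ Set.univ u) (v : E) :
    ∃ p : E, ∀ z, u v + ⟪p, z - v⟫ ≤ u z := by
  have hc : Continuous u := by
    have := hu.continuousOn isOpen_univ
    exact continuousOn_univ.1 this
  have hopen : IsOpen {q : E × ℝ | u q.1 < q.2} :=
    isOpen_lt (hc.comp continuous_fst) continuous_snd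
  have hconv : Convex ℝ {q : E × ℝ | u q.1 < q.2} := by
    have := hu.convex_strict_epigraph
    simpa using this
  obtain ⟨f, hf⟩ := geometric_hahn_banach_open_point (x := (v, u v)) hconv hopen (by simp)
  have hsplit : ∀ (x : E) (t : ℝ), f (x, t) = f (x, 0) + t * f (0, 1) := by
    intro x t
    have : ((x, t) : E × ℝ) = (x, 0) + t • (0, 1) := by simp
    rw [this, map_add, map_smul, smul_eq_mul]
  have hneg : f ((0 : E), (1 : ℝ)) < 0 := by
    have := hf (v, u v + 1) (by simp)
    rw [hsplit v (u v + 1), hsplit v (u v)] at this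
    linarith
  set c := f ((0 : E), (1 : ℝ)) with hcdef
  let l : E →L[ℝ] ℝ := f.comp (ContinuousLinearMap.inl ℝ E ℝ)
  have hl : ∀ x, f (x, 0) = l x := fun x => by simp [l]
  refine ⟨(InnerProductSpace.toDual ℝ E).symm ((-c)⁻¹ • l), fun z => ?_⟩
  rw [InnerProductSpace.toDual_symm_apply]
  have key : l z + u z * c ≤ l v + u v * c := by
    refine le_of_forall_pos_lt_add fun ε hε => ?_
    have h1 := hf (z, u z + ε / (-c)) (by
      show u z < u z + ε / (-c)
      have : 0 < ε / (-c) := div_pos hε (by linarith)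
      linarith)
    rw [hsplit z, hsplit v, hl, hl] at h1
    have : (u z + ε / (-c)) * c = u z * c - ε := by
      rw [div_neg, add_mul, neg_mul, div_mul_cancel₀ _ hneg.ne]
      ring
    linarith
  have h2 : ((-c)⁻¹ • l) (z - v) = (l z - l v) / (-c) := by
    simp; ring
  rw [h2]
  have h3 : (l z - l v) / (-c) ≤ u z - u v := by
    rw [div_le_iff₀ (by linarith)]
    nlinarith
  linarith

/-- Midpoint semiconcavity with constant `C`. -/
theorem aux_semiconcave {u : E → ℝ} {C : ℝ} (hC : 0 ≤ C) (hu : ConvexOn ℝ Set.univ u)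
    (hs : ∀ v h, u (v + h) + u (v - h) - 2 * u v ≤ C * ‖h‖ ^ 2) :
    (∀ v, HasGradientAt u (gradient u v) v) ∧
    (∀ v z, u v + ⟪gradient u v, z - v⟫ ≤ u z) ∧
    (∃ K, LipschitzWith K (gradient u)) := by
  choose p hp using aux_subgradient hu
  have hup : ∀ v z, u z ≤ u v + ⟪p v, z - v⟫ + C * ‖z - v‖ ^ 2 := by
    intro v z
    have h1 := hs v (z - v)
    have h2 := hp v (v - (z - v))
    have h3 : v - (z - v) - v = -(z - v) := by abel
    rw [h3, inner_neg_right] at h2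
    rw [add_sub_cancel] at h1
    linarith
  have hgrad : ∀ v, HasGradientAt u (p v) v := by
    intro v
    rw [hasGradientAt_iff_isLittleO]
    have : (fun z => u z - u v - ⟪p v, z - v⟫) =O[nhds v] fun z => ‖z - v‖ ^ 2 := by
      refine Asymptotics.IsBigO.of_bound C (Eventually.of_forall fun z => ?_)
      have h1 := hp v z
      have h2 := hup v z
      rw [Real.norm_of_nonneg (by linarith), Real.norm_of_nonneg (by positivity)]
      linarith
    refine this.trans_isLittleO ?_
    have h0 : Tendsto (fun z => z - v) (nhds v) (nhds 0) := by
      have : Continuous fun z : E => z - v := by fun_prop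
      simpa using this.tendsto v
    exact (Asymptotics.isLittleO_norm_pow_id (E' := E) one_lt_two).comp_tendsto h0
  have heq : gradient u = p := gradient_eq hgrad
  rw [heq]
  refine ⟨hgrad, hp, ⟨⟨2 * C, by positivity⟩, ?_⟩⟩
  refine LipschitzWith.of_dist_le_mul fun v w => ?_
  rw [dist_eq_norm, dist_eq_norm]
  show _ ≤ 2 * C * _
  by_cases h0 : p v - p w = 0
  · rw [h0, norm_zero]; positivity
  have hn : 0 < ‖p v - p w‖ := norm_pos_iff.2 h0
  set r := ‖v - w‖ with hr
  by_cases hvw : v = w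
  · subst hvw; simp at h0
  have hr0 : 0 < r := norm_pos_iff.2 (sub_ne_zero.2 hvw)
  set h : E := (r / ‖p v - p w‖) • (p v - p w) with hh
  have hhn : ‖h‖ = r := by
    rw [hh, norm_smul, Real.norm_of_nonneg (by positivity)]
    field_simp
  have h1 := hp v (w + h)
  have h2 := hup w (w + h)
  have h3 := hup v w
  have e1 : w + h - v = (w - v) + h := by abel
  have e2 : w + h - w = h := by abel
  rw [e1, inner_add_right] at h1
  rw [e2] at h2
  have e3 : ⟪p v, h⟫ - ⟪p w, h⟫ = r * ‖p v - p w‖ := by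
    rw [← inner_sub_left, hh, inner_smul_right, real_inner_self_eq_norm_sq]
    field_simp
  rw [norm_sub_rev w v, ← hr] at h3
  rw [hhn] at h2
  have : r * ‖p v - p w‖ ≤ r * (2 * C * r) := by nlinarith
  exact le_of_mul_le_mul_left this hr0

/-- Determinant of a linear map with nonnegative quadratic form. -/
theorem aux_det_nonneg (T : E →L[ℝ] E) (hT : ∀ h, 0 ≤ ⟪T h, h⟫) : 0 ≤ T.det := by
  by_contra hneg
  push Not at hneg
  let g : ℝ → ℝ := fun t => ((1 - t) • T + t • ContinuousLinearMap.id ℝ E).det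
  have hg : Continuous g := by
    refine ContinuousLinearMap.continuous_det.comp ?_
    fun_prop
  have g0 : g 0 < 0 := by simpa [g] using hneg
  have g1 : g 1 = 1 := by
    simp only [g, sub_self, zero_smul, zero_add, one_smul]
    simp [ContinuousLinearMap.det]
  have := intermediate_value_Icc (zero_le_one (α := ℝ)) hg.continuousOn
  obtain ⟨t, ht, ht0⟩ := this ⟨g0.le, by rw [g1]; exact zero_le_one⟩
  have htpos : 0 < t := by
    rcases ht.1.eq_or_lt with h | h
    · rw [← h] at ht0; linarith
    · exact h
  have hker : LinearMap.ker (((1 - t) • T + t • ContinuousLinearMap.id ℝ E : E →L[ℝ] E) : E →ₗ[ℝ] E) = ⊥ := by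
    rw [LinearMap.ker_eq_bot']
    intro h hh
    have h1 : (1 - t) • T h + t • h = 0 := by simpa using hh
    have h2 : ⟪(1 - t) • T h + t • h, h⟫ = 0 := by rw [h1, inner_zero_left]
    rw [inner_add_left, real_inner_smul_left, real_inner_smul_left, real_inner_self_eq_norm_sq] at h2
    have h3 : 0 ≤ (1 - t) * ⟪T h, h⟫ := mul_nonneg (by linarith [ht.2]) (hT h)
    have h4 : ‖h‖ ^ 2 = 0 := by
      have := sq_nonneg ‖h‖
      nlinarith
    simpa using h4
  have hu : IsUnit (LinearMap.det (((1 - t) • T + t • ContinuousLinearMap.id ℝ E : E →L[ℝ] E) : E →ₗ[ℝ] E)) := by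
    rw [LinearMap.isUnit_iff_ker_eq_bot _ |>.symm] at hker
    exact LinearMap.isUnit_det _ hker
  exact hu.ne_zero ht0

/-- Derivative of a gradient of a convex function is nonnegative. -/
theorem aux_det_monotone {H : E → E} (hm : ∀ v w, 0 ≤ ⟪H w - H v, w - v⟫) (x : E) :
    0 ≤ (fderiv ℝ H x).det := by
  apply aux_det_nonneg
  intro h
  by_cases hd : DifferentiableAt ℝ H x
  · have h1 : HasLineDerivAt ℝ H (fderiv ℝ H x h) x h := hd.hasFDerivAt.hasLineDerivAt h
    have h2 := h1.tendsto_slope_zero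
    have h3 : Tendsto (fun t : ℝ => ⟪t⁻¹ • (H (x + t • h) - H x), h⟫) (nhdsWithin 0 {0}ᶜ)
        (nhds ⟪fderiv ℝ H x h, h⟫) := h2.inner tendsto_const_nhds
    refine ge_of_tendsto h3 ?_
    filter_upwards [self_mem_nhdsWithin] with t ht
    have h4 := hm x (x + t • h)
    rw [add_sub_cancel_left, inner_smul_right] at h4
    rw [real_inner_smul_left]
    have h5 : t⁻¹ * ⟪H (x + t • h) - H x, h⟫
        = (t⁻¹) ^ 2 * (t * ⟪H (x + t • h) - H x, h⟫) := by
      have : t ≠ 0 := ht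
      field_simp
    rw [h5]
    positivity
  · rw [fderiv_zero_of_not_differentiableAt hd]; simp

end ToricAux

section ToricAux2

variable {E : Type*} [NormedAddCommGroup E] [InnerProductSpace ℝ E] [FiniteDimensional ℝ E]

/-- A subgradient at a point of differentiability is the gradient. -/
theorem aux_unique {f : E → ℝ} {q p x : E} (hq : HasGradientAt f q x)
    (h : ∀ z, f x + ⟪p, z - x⟫ ≤ f z) : q = p := by
  have h1 : HasFDerivAt (fun z => f z - ⟪p, z⟫)
      (InnerProductSpace.toDual ℝ E q - InnerProductSpace.toDual ℝ E p) x :=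
    (hasGradientAt_iff_hasFDerivAt.1 hq).sub (InnerProductSpace.toDual ℝ E p).hasFDerivAt
  have h2 : IsLocalMin (fun z => f z - ⟪p, z⟫) x := by
    refine Eventually.of_forall fun z => ?_
    have := h z
    rw [inner_sub_right] at this
    show f x - ⟪p, x⟫ ≤ f z - ⟪p, z⟫
    linarith
  have h3 := h2.hasFDerivAt_eq_zero h1
  exact (InnerProductSpace.toDual ℝ E).injective (sub_eq_zero.1 h3)

/-- If a convex `u` is maximal among convex minorants of `φ`, then its Monge-Ampere density
vanishes off the contact set. -/
theorem aux_off_contact (hE : 0 < Module.finrank ℝ E) {u φ : E → ℝ} {H : E → E}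
    (hu : ConvexOn ℝ Set.univ u)
    (hφ : Continuous φ) (huφ : ∀ z, u z ≤ φ z) (hH : ∀ v, HasGradientAt u (H v) v)
    (htan : ∀ v z, u v + ⟪H v, z - v⟫ ≤ u z)
    (hmax : ∀ g : E → ℝ, ConvexOn ℝ Set.univ g → (∀ w, g w ≤ φ w) → ∀ w, g w ≤ u w)
    (v : E) (hv : u v < φ v) : (fderiv ℝ H v).det = 0 := by
  by_contra hdet
  have hd : DifferentiableAt ℝ H v := by
    by_contra hnd
    rw [fderiv_zero_of_not_differentiableAt hnd] at hdet
    apply hdet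
    have : ((0 : E →L[ℝ] E).det) = LinearMap.det (0 : E →ₗ[ℝ] E) := rfl
    rw [this, LinearMap.det_zero, zero_pow hE.ne']
  have hc : Continuous u := continuousOn_univ.1 (hu.continuousOn isOpen_univ)
  set p := H v with hp
  -- convexity along segments from v
  have hseg : ∀ (t : ℝ) (z : E), 0 ≤ t → t ≤ 1 →
      u (v + t • (z - v)) ≤ u v + t * (u z - u v) := by
    intro t z h0 h1
    have := hu.2 (Set.mem_univ v) (Set.mem_univ z) (sub_nonneg.2 h1) h0 (by ring)
    have e : (1 - t) • v + t • z = v + t • (z - v) := by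
      rw [sub_smul, one_smul, smul_sub]; abel
    rw [e] at this
    simp only [smul_eq_mul] at this
    linarith
  have hstrict : ∀ w, w ≠ v → u v + ⟪p, w - v⟫ < u w := by
    intro w hw
    refine lt_of_le_of_ne (htan v w) fun heq => ?_
    have hconst : ∀ t : ℝ, 0 ≤ t → t ≤ 1 → H (v + t • (w - v)) = p := by
      intro t h0 h1
      refine aux_unique (hH _) fun z => ?_
      have h2 := hseg t w h0 h1
      have h3 := htan v z
      have e : z - (v + t • (w - v)) = (z - v) - t • (w - v) := by abel
      rw [e, inner_sub_right, inner_smul_right]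
      rw [← heq] at h2
      have e2 : u v + t * (u v + ⟪p, w - v⟫ - u v) = u v + t * ⟪p, w - v⟫ := by ring
      rw [e2] at h2
      linarith
    have h1 : HasLineDerivAt ℝ H (fderiv ℝ H v (w - v)) v (w - v) :=
      hd.hasFDerivAt.hasLineDerivAt _
    have h2 := h1.tendsto_slope_zero.mono_left
      (nhdsWithin_mono (0 : ℝ) (fun t (ht : t ∈ Set.Ioi (0 : ℝ)) => ne_of_gt ht))
    have h3 : Tendsto (fun t : ℝ => t⁻¹ • (H (v + t • (w - v)) - H v)) (nhdsWithin 0 (Set.Ioi 0))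
        (nhds 0) := by
      refine tendsto_const_nhds.congr' ?_
      filter_upwards [Ioc_mem_nhdsGT (zero_lt_one (α := ℝ))] with t ht
      rw [hconst t ht.1.le ht.2, ← hp, sub_self, smul_zero]
    have h4 := tendsto_nhds_unique h2 h3
    have h5 : LinearMap.ker ((fderiv ℝ H v : E →L[ℝ] E) : E →ₗ[ℝ] E) = ⊥ := by
      by_contra hk
      exact hdet (LinearMap.det_eq_zero_iff_ker_ne_bot.2 hk)
    rw [LinearMap.ker_eq_bot'] at h5
    exact hw (sub_eq_zero.1 (h5 (w - v) h4))
  -- the tangent function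
  have htc : Continuous fun z => u v + ⟪p, z - v⟫ := by fun_prop
  obtain ⟨r, hr, hball⟩ : ∃ r > 0, ∀ z ∈ Metric.closedBall v r,
      u v + ⟪p, z - v⟫ + (φ v - u v) / 2 ≤ φ z := by
    have : ∀ᶠ z in nhds v, u v + ⟪p, z - v⟫ + (φ v - u v) / 2 < φ z := by
      refine (htc.add continuous_const).continuousAt.eventually_lt hφ.continuousAt ?_
      simp; linarith
    obtain ⟨r, hr, h⟩ := Metric.nhds_basis_closedBall.mem_iff.1 this
    exact ⟨r, hr, fun z hz => (h hz).le⟩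
  obtain ⟨m, hm0, hm⟩ := (isCompact_sphere v r).exists_forall_le' (a := (0 : ℝ))
    (f := fun z => u z - (u v + ⟪p, z - v⟫)) (hc.sub htc).continuousOn (by
      intro z hz
      have : z ≠ v := by
        rintro rfl
        simp at hz
        exact hr.ne hz
      have := hstrict z this
      linarith)
  set ε := min m ((φ v - u v) / 2) with hε
  have hε0 : 0 < ε := lt_min hm0 (by linarith)
  have haff : ConvexOn ℝ Set.univ (fun z => u v + ⟪p, z - v⟫ + ε) := by
    refine ⟨convex_univ, fun x _ y _ a b _ _ hab => le_of_eq ?_⟩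
    have hb : b = 1 - a := by linarith
    subst hb
    simp only [inner_sub_right, inner_add_right, inner_smul_right, smul_eq_mul]
    ring
  have hg := hmax _ (hu.sup haff) (by
    intro z
    refine sup_le (huφ z) ?_
    by_cases hz : z ∈ Metric.closedBall v r
    · have := hball z hz
      have : ε ≤ (φ v - u v) / 2 := min_le_right _ _
      show u v + ⟪p, z - v⟫ + ε ≤ φ z
      linarith
    · have hzr : r < ‖z - v‖ := by
        simpa [dist_eq_norm] using hz
      have hz0 : 0 < ‖z - v‖ := hr.trans hzr
      have ht0 : 0 ≤ r / ‖z - v‖ := by positivity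
      have ht1 : r / ‖z - v‖ ≤ 1 := (div_le_one hz0).2 hzr.le
      have h1 := hm (v + (r / ‖z - v‖) • (z - v)) (by
        rw [mem_sphere_iff_norm, add_sub_cancel_left, norm_smul, Real.norm_of_nonneg ht0]
        field_simp)
      have h2 := hseg _ z ht0 ht1
      simp only [add_sub_cancel_left, inner_smul_right] at h1
      have h3 := htan v z
      have h4 : ε ≤ m := min_le_left _ _
      have h5 : r / ‖z - v‖ * (u z - u v - ⟪p, z - v⟫) ≤ 1 * (u z - u v - ⟪p, z - v⟫) :=
        mul_le_mul_of_nonneg_right ht1 (by linarith)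
      have h6 := huφ z
      show u v + ⟪p, z - v⟫ + ε ≤ φ z
      nlinarith) v
  have : u v + ⟪p, v - v⟫ + ε ≤ u v := le_trans le_sup_right hg
  simp at this
  linarith

/-- Partial Legendre transform. -/
noncomputable def auxLeg (φ : E → ℝ) (R : ℝ) (p : E) : ℝ :=
  sSup ((fun v => ⟪p, v⟫ - φ v) '' Metric.closedBall 0 R)

theorem auxLeg_bdd {φ : E → ℝ} (hφ : Continuous φ) (R : ℝ) (p : E) :
    BddAbove ((fun v => ⟪p, v⟫ - φ v) '' Metric.closedBall 0 R) := by
  refine (isCompact_closedBall (0 : E) R).bddAbove_image ?_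
  fun_prop

theorem auxLeg_lip {φ : E → ℝ} (hφ : Continuous φ) (R : ℕ) :
    LipschitzWith R (auxLeg φ R) := by
  refine LipschitzWith.of_le_add_mul _ fun p q => ?_
  refine csSup_le ((Metric.nonempty_closedBall.2 (Nat.cast_nonneg R)).image _) ?_
  rintro _ ⟨v, hv, rfl⟩
  have h1 : ⟪q, v⟫ - φ v ≤ auxLeg φ R q := le_csSup (auxLeg_bdd hφ R q) ⟨v, hv, rfl⟩
  have h2 : ⟪p - q, v⟫ ≤ ‖p - q‖ * ‖v‖ := real_inner_le_norm _ _
  have h3 : ‖v‖ ≤ R := by simpa using hv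
  have h4 : ‖p - q‖ * ‖v‖ ≤ ‖p - q‖ * R := mul_le_mul_of_nonneg_left h3 (norm_nonneg _)
  rw [inner_sub_left] at h2
  rw [dist_eq_norm]
  have h5 : ((R : NNReal) : ℝ) = R := by simp
  rw [h5]
  show ⟪p, v⟫ - φ v ≤ _
  linarith [mul_comm (R : ℝ) ‖p - q‖]

variable [MeasurableSpace E] [BorelSpace E]

/-- Points outside a null set have at most one preimage among contact points. -/
theorem aux_null_set (μ : Measure E) [μ.IsAddHaarMeasure] {φ : E → ℝ} (hφ : Continuous φ)
    {G : E → E} {D : Set E} (hD : ∀ v ∈ D, ∀ z, φ v + ⟪G v, z - v⟫ ≤ φ z) :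
    ∃ N : Set E, MeasurableSet N ∧ μ N = 0 ∧ Set.InjOn G (D \ G ⁻¹' N) := by
  have h0 : ∀ᵐ p ∂μ, ∀ R : ℕ, DifferentiableAt ℝ (auxLeg φ R) p :=
    ae_all_iff.2 fun R => (auxLeg_lip hφ R).ae_differentiableAt
  refine ⟨toMeasurable μ {p | ¬ ∀ R : ℕ, DifferentiableAt ℝ (auxLeg φ R) p},
    measurableSet_toMeasurable _ _, by rw [measure_toMeasurable]; exact h0, ?_⟩
  have key : ∀ v ∈ D, ∀ R : ℕ, ‖v‖ ≤ R → DifferentiableAt ℝ (auxLeg φ R) (G v) →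
      gradient (auxLeg φ R) (G v) = v := by
    intro v hv R hR hd
    refine aux_unique hd.hasGradientAt fun q => ?_
    have h1 : auxLeg φ R (G v) ≤ ⟪G v, v⟫ - φ v := by
      refine csSup_le ((Metric.nonempty_closedBall.2 (Nat.cast_nonneg R)).image _) ?_
      rintro _ ⟨w, hw, rfl⟩
      have := hD v hv w
      rw [inner_sub_right] at this
      show ⟪G v, w⟫ - φ w ≤ _
      linarith
    have h2 : ⟪q, v⟫ - φ v ≤ auxLeg φ R q :=
      le_csSup (auxLeg_bdd hφ R q) ⟨v, by simpa using hR, rfl⟩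
    rw [inner_sub_right, real_inner_comm, real_inner_comm (G v) v]
    linarith
  intro v hv w hw hvw
  obtain ⟨R, hR⟩ := exists_nat_ge (max ‖v‖ ‖w‖)
  have hd : DifferentiableAt ℝ (auxLeg φ R) (G v) := by
    by_contra hnd
    exact hv.2 (subset_toMeasurable _ _ (fun h => hnd (h R)))
  rw [← key v hv.1 R ((le_max_left _ _).trans hR) hd, 
    ← key w hw.1 R ((le_max_right _ _).trans hR) (hvw ▸ hd), hvw]

/-- The Jacobian of a `C¹` map vanishes a.e. on the preimage of a null set. -/
theorem aux_jac_null (μ : Measure E) [μ.IsAddHaarMeasure] {G : E → E} (hG : ContDiff ℝ 1 G)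
    {N : Set E} (hN : MeasurableSet N) (hN0 : μ N = 0) :
    μ {v | G v ∈ N ∧ (fderiv ℝ G v).det ≠ 0} = 0 := by
  refine measure_null_of_locally_null _ fun x hx => ?_
  have hGc := hG.continuous
  have hdc : Continuous fun v => (fderiv ℝ G v).det :=
    ContinuousLinearMap.continuous_det.comp (hG.continuous_fderiv one_ne_zero)
  have hs : HasStrictFDerivAt G (fderiv ℝ G x) x :=
    hG.contDiffAt.hasStrictFDerivAt one_ne_zero
  have hs' : HasStrictFDerivAt G
      (((fderiv ℝ G x).toContinuousLinearEquivOfDetNeZero hx.2 : E ≃L[ℝ] E) : E →L[ℝ] E) x := by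
    simpa using hs
  let e := hs'.toOpenPartialHomeomorph G
  have hes : e.source ∈ nhds x := e.open_source.mem_nhds hs'.mem_toOpenPartialHomeomorph_source
  refine ⟨e.source ∩ {v | G v ∈ N ∧ (fderiv ℝ G v).det ≠ 0}, 
    inter_mem (mem_nhdsWithin_of_mem_nhds hes) self_mem_nhdsWithin, ?_⟩
  have hm : MeasurableSet (e.source ∩ {v | G v ∈ N ∧ (fderiv ℝ G v).det ≠ 0}) := by
    refine e.open_source.measurableSet.inter ?_
    exact (hN.preimage hGc.measurable).inter
      (hdc.measurable (measurableSet_singleton (0 : ℝ)).compl)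
  have hinj : Set.InjOn G (e.source ∩ {v | G v ∈ N ∧ (fderiv ℝ G v).det ≠ 0}) := by
    have : Set.InjOn e e.source := e.injOn
    rw [HasStrictFDerivAt.toOpenPartialHomeomorph_coe] at this
    exact this.mono Set.inter_subset_left
  have harea := lintegral_abs_det_fderiv_eq_addHaar_image μ hm
    (fun y _ => ((hG.differentiable one_ne_zero) y).hasFDerivAt.hasFDerivWithinAt) hinj
  have himg : μ (G '' (e.source ∩ {v | G v ∈ N ∧ (fderiv ℝ G v).det ≠ 0})) = 0 := by
    refine measure_mono_null ?_ hN0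
    rintro _ ⟨y, hy, rfl⟩
    exact hy.2.1
  have hmeas : Measurable fun y => ENNReal.ofReal |(fderiv ℝ G y).det| :=
    ENNReal.measurable_ofReal.comp hdc.abs.measurable
  rw [himg, lintegral_eq_zero_iff hmeas] at harea
  have h2 := (ae_restrict_iff' hm).1 harea
  have h3 : μ {y | ¬ (y ∈ e.source ∩ {v | G v ∈ N ∧ (fderiv ℝ G v).det ≠ 0} →
    ENNReal.ofReal |(fderiv ℝ G y).det| = 0)} = 0 := h2
  refine measure_mono_null ?_ h3
  intro y hy hcon
  have := hcon hy
  rw [ENNReal.ofReal_eq_zero] at this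
  exact hy.2.2 (abs_nonpos_iff.1 this)

/-- Area formula on the contact set. -/
theorem aux_area (μ : Measure E) [μ.IsAddHaarMeasure] {φ : E → ℝ} (hφ : Continuous φ)
    {G : E → E} (hG : ContDiff ℝ 1 G) {D Δ : Set E} (hDm : MeasurableSet D)
    (hD : ∀ v ∈ D, ∀ z, φ v + ⟪G v, z - v⟫ ≤ φ z) (hΔ : Convex ℝ Δ)
    (h1 : interior Δ ⊆ G '' D) (h2 : G '' D ⊆ Δ) :
    ∫⁻ v in D, ENNReal.ofReal |(fderiv ℝ G v).det| ∂μ = μ Δ := by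
  obtain ⟨N, hN, hN0, hinj⟩ := aux_null_set μ hφ hD
  have hGm : Measurable G := hG.continuous.measurable
  have hpre : MeasurableSet (G ⁻¹' N) := hN.preimage hGm
  have hsplit := lintegral_inter_add_sdiff (μ := μ)
    (fun v => ENNReal.ofReal |(fderiv ℝ G v).det|) D hpre
  rw [← hsplit]
  have hz : ∫⁻ v in D ∩ G ⁻¹' N, ENNReal.ofReal |(fderiv ℝ G v).det| ∂μ = 0 := by
    rw [lintegral_eq_zero_iff' ?_]
    · rw [EventuallyEq, ae_restrict_iff' (hDm.inter hpre)]
      have := aux_jac_null μ hG hN hN0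
      have h3 : ∀ᵐ v ∂μ, ¬ (G v ∈ N ∧ (fderiv ℝ G v).det ≠ 0) := by
        rw [ae_iff]; simpa using this
      filter_upwards [h3] with v hv hvD
      have : (fderiv ℝ G v).det = 0 := by
        by_contra hne
        exact hv ⟨hvD.2, hne⟩
      simp [this]
    · have hdc : Continuous fun v => (fderiv ℝ G v).det :=
        ContinuousLinearMap.continuous_det.comp (hG.continuous_fderiv one_ne_zero)
      exact (ENNReal.measurable_ofReal.comp hdc.abs.measurable).aemeasurable
  rw [hz, zero_add, lintegral_abs_det_fderiv_eq_addHaar_image μ (hDm.diff hpre)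
    (fun y _ => ((hG.differentiable one_ne_zero) y).hasFDerivAt.hasFDerivWithinAt) hinj]
  have himg : G '' (D \ G ⁻¹' N) = G '' D \ N := by
    ext y; constructor
    · rintro ⟨x, hx, rfl⟩; exact ⟨⟨x, hx.1, rfl⟩, hx.2⟩
    · rintro ⟨⟨x, hx, rfl⟩, hy⟩; exact ⟨x, ⟨hx, hy⟩, rfl⟩
  rw [himg, measure_sdiff_null hN0]
  apply le_antisymm (measure_mono h2)
  calc μ Δ ≤ μ (interior Δ ∪ frontier Δ) := by
        refine measure_mono ?_
        rw [← closure_eq_interior_union_frontier]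
        exact subset_closure
    _ ≤ μ (interior Δ) + μ (frontier Δ) := measure_union_le _ _
    _ = μ (interior Δ) := by rw [hΔ.addHaar_frontier μ, add_zero]
    _ ≤ μ (G '' D) := measure_mono h1

end ToricAux2

section ToricAux3

variable {E : Type*} [NormedAddCommGroup E] [InnerProductSpace ℝ E] [FiniteDimensional ℝ E]

theorem aux_sum_pos {A : Finset E} (hA : A.Nonempty) (v : E) :
    0 < ∑ α ∈ A, Real.exp ⟪α, v⟫ :=
  Finset.sum_pos (fun _ _ => Real.exp_pos _) hA

theorem aux_lse_ge {A : Finset E} (v : E) {q : E}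
    (hq : q ∈ convexHull ℝ (A : Set E)) : ⟪q, v⟫ ≤ Real.log (∑ α ∈ A, Real.exp ⟪α, v⟫) := by
  have hconv : Convex ℝ {q : E | ⟪q, v⟫ ≤ Real.log (∑ α ∈ A, Real.exp ⟪α, v⟫)} := by
    refine convex_halfSpace_le (f := fun q : E => ⟪q, v⟫) ?_ _
    exact ⟨fun x y => inner_add_left _ _ _, fun c x => by simp [real_inner_smul_left]⟩
  refine convexHull_min ?_ hconv hq
  intro α hα
  show ⟪α, v⟫ ≤ Real.log (∑ α ∈ A, Real.exp ⟪α, v⟫)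
  rw [Real.le_log_iff_exp_le (aux_sum_pos ⟨α, hα⟩ v)]
  exact Finset.single_le_sum (f := fun α : E => Real.exp ⟪α, v⟫)
    (fun _ _ => (Real.exp_pos _).le) hα

theorem aux_lse_le {A : Finset E} (hA : A.Nonempty) (v : E) {c : ℝ}
    (h : ∀ α ∈ A, ⟪α, v⟫ ≤ c) :
    Real.log (∑ α ∈ A, Real.exp ⟪α, v⟫) ≤ Real.log A.card + c := by
  have hcard : (0 : ℝ) < A.card := by exact_mod_cast hA.card_pos
  have h1 : ∑ α ∈ A, Real.exp ⟪α, v⟫ ≤ A.card * Real.exp c := by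
    have := Finset.sum_le_card_nsmul A (fun α => Real.exp ⟪α, v⟫) (Real.exp c)
      (fun α hα => Real.exp_le_exp.2 (h α hα))
    simpa using this
  calc _ ≤ Real.log (A.card * Real.exp c) := Real.log_le_log (aux_sum_pos hA v) h1
    _ = _ := by rw [Real.log_mul hcard.ne' (Real.exp_pos c).ne', Real.log_exp]

theorem aux_lse_contDiff {A : Finset E} (hA : A.Nonempty) :
    ContDiff ℝ (⊤ : ℕ∞) fun v : E => Real.log (∑ α ∈ A, Real.exp ⟪α, v⟫) := by
  refine ContDiff.log ?_ fun v => (aux_sum_pos hA v).ne'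
  refine ContDiff.sum fun α _ => ?_
  exact (contDiff_const.inner ℝ contDiff_id).exp

theorem aux_lse_semiconcave {A : Finset E} (hA : A.Nonempty) :
    ∃ C : ℝ, 0 ≤ C ∧ ∀ v h : E,
      Real.log (∑ α ∈ A, Real.exp ⟪α, v + h⟫) + Real.log (∑ α ∈ A, Real.exp ⟪α, v - h⟫)
        - 2 * Real.log (∑ α ∈ A, Real.exp ⟪α, v⟫) ≤ C * ‖h‖ ^ 2 := by
  obtain ⟨R, hR⟩ : ∃ R : ℝ, ∀ α ∈ A, ‖α‖ ≤ R :=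
    ⟨∑ α ∈ A, ‖α‖, fun α hα => Finset.single_le_sum (f := fun α : E => ‖α‖)
      (fun _ _ => norm_nonneg _) hα⟩
  have hR0 : 0 ≤ R := by
    obtain ⟨α, hα⟩ := hA
    exact (norm_nonneg α).trans (hR α hα)
  refine ⟨2 * R ^ 2, by positivity, fun v h => ?_⟩
  have hp := aux_sum_pos hA (v + h)
  have hm := aux_sum_pos hA (v - h)
  have h0 := aux_sum_pos hA v
  have key : (∑ α ∈ A, Real.exp ⟪α, v + h⟫) * (∑ α ∈ A, Real.exp ⟪α, v - h⟫)
      ≤ Real.exp (2 * R ^ 2 * ‖h‖ ^ 2) *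
        ((∑ α ∈ A, Real.exp ⟪α, v⟫) * (∑ α ∈ A, Real.exp ⟪α, v⟫)) := by
    have e1 := Finset.sum_mul_sum A A (fun α => Real.exp ⟪α, v + h⟫)
      (fun α => Real.exp ⟪α, v - h⟫)
    have e2 := Finset.sum_mul_sum A A (fun α => Real.exp ⟪α, v - h⟫)
      (fun α => Real.exp ⟪α, v + h⟫)
    have e3 := Finset.sum_mul_sum A A (fun α => Real.exp ⟪α, v⟫)
      (fun α => Real.exp ⟪α, v⟫)
    have e4 : ∑ α ∈ A, ∑ β ∈ A, (Real.exp ⟪α, v + h⟫ * Real.exp ⟪β, v - h⟫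
        + Real.exp ⟪α, v - h⟫ * Real.exp ⟪β, v + h⟫) ≤
        ∑ α ∈ A, ∑ β ∈ A, 2 * Real.exp (2 * R ^ 2 * ‖h‖ ^ 2) *
          (Real.exp ⟪α, v⟫ * Real.exp ⟪β, v⟫) := by
      refine Finset.sum_le_sum fun α hα => Finset.sum_le_sum fun β hβ => ?_
      have h1 : Real.exp ⟪α, v + h⟫ * Real.exp ⟪β, v - h⟫
        + Real.exp ⟪α, v - h⟫ * Real.exp ⟪β, v + h⟫ =
          2 * Real.cosh ⟪α - β, h⟫ * (Real.exp ⟪α, v⟫ * Real.exp ⟪β, v⟫) := by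
        rw [Real.cosh_eq, inner_sub_left, inner_add_right, inner_add_right, inner_sub_right,
          inner_sub_right]
        have : ∀ a b : ℝ, 2 * ((a + b) / 2) = a + b := fun a b => by ring
        rw [this, add_mul]
        simp only [← Real.exp_add]
        congr 2 <;> ring
      rw [h1]
      have h2 : Real.cosh ⟪α - β, h⟫ ≤ Real.exp (2 * R ^ 2 * ‖h‖ ^ 2) := by
        refine (Real.cosh_le_exp_half_sq _).trans (Real.exp_le_exp.2 ?_)
        have h3 : |⟪α - β, h⟫| ≤ 2 * R * ‖h‖ := by
          refine (abs_real_inner_le_norm _ _).trans ?_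
          refine mul_le_mul_of_nonneg_right ?_ (norm_nonneg _)
          exact (norm_sub_le _ _).trans (by linarith [hR α hα, hR β hβ])
        have h4 : ⟪α - β, h⟫ ^ 2 ≤ (2 * R * ‖h‖) ^ 2 := by
          rw [← sq_abs]
          exact pow_le_pow_left₀ (abs_nonneg _) h3 2
        nlinarith
      have h5 : 0 < Real.exp ⟪α, v⟫ * Real.exp ⟪β, v⟫ := by positivity
      gcongr
    simp only [Finset.sum_add_distrib, ← Finset.mul_sum] at e4
    simp only [← Finset.mul_sum] at e1 e2 e3
    rw [e3]
    nlinarith [mul_comm (∑ α ∈ A, Real.exp ⟪α, v + h⟫) (∑ α ∈ A, Real.exp ⟪α, v - h⟫)]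
  have hl := Real.log_le_log (mul_pos hp hm) key
  rw [Real.log_mul hp.ne' hm.ne', Real.log_mul (Real.exp_pos _).ne' (mul_pos h0 h0).ne',
    Real.log_mul h0.ne' h0.ne', Real.log_exp] at hl
  linarith

theorem aux_chi_semiconcave {χ : E → ℝ} (hχ : ContDiff ℝ (⊤ : ℕ∞) χ)
    (hχc : HasCompactSupport χ) :
    ∃ C : ℝ, 0 ≤ C ∧ ∀ v h : E, χ (v + h) + χ (v - h) - 2 * χ v ≤ C * ‖h‖ ^ 2 := by
  have h1 : ContDiff ℝ 1 (fderiv ℝ χ) :=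
    hχ.fderiv_right (WithTop.coe_le_coe.2 le_top)
  obtain ⟨K, hK⟩ := ContDiff.lipschitzWith_of_hasCompactSupport (hχc.fderiv ℝ) h1 one_ne_zero
  have hd : Differentiable ℝ χ := hχ.differentiable (by simp)
  have key : ∀ v h : E, ‖χ (v + h) - χ v - fderiv ℝ χ v h‖ ≤ K * ‖h‖ ^ 2 := by
    intro v h
    have := (convex_closedBall v ‖h‖).norm_image_sub_le_of_norm_fderiv_le' (𝕜 := ℝ) (f := χ)
      (φ := fderiv ℝ χ v) (C := K * ‖h‖) (x := v) (y := v + h)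
      (fun x _ => hd x) (fun x hx => ?_) (by simp) (by simp)
    · rw [add_sub_cancel_left] at this
      calc _ ≤ _ := this
        _ = _ := by ring
    · have h2 := hK.dist_le_mul x v
      rw [dist_eq_norm] at h2
      refine h2.trans ?_
      gcongr
      simpa using hx
  refine ⟨2 * K, by positivity, fun v h => ?_⟩
  have a := (abs_le.1 (key v h)).2
  have b := (abs_le.1 (key v (-h))).2
  rw [norm_neg, map_neg, ← sub_eq_add_neg] at b
  linarith

theorem aux_chi_bdd {χ : E → ℝ} (hχ : ContDiff ℝ (⊤ : ℕ∞) χ)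
    (hχc : HasCompactSupport χ) : ∃ M : ℝ, ∀ v, |χ v| ≤ M :=
  hχc.exists_bound_of_continuous hχ.continuous

end ToricAux3
section ToricAux4

variable {n : ℕ} {φ : EuclideanSpace ℝ (Fin n) → ℝ}

theorem aux_env_bdd (φ : EuclideanSpace ℝ (Fin n) → ℝ) (v : EuclideanSpace ℝ (Fin n)) :
    BddAbove {y : ℝ | ∃ g : EuclideanSpace ℝ (Fin n) → ℝ,
      ConvexOn ℝ Set.univ g ∧ (∀ w, g w ≤ φ w) ∧ y = g v} := by
  refine ⟨φ v, ?_⟩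
  rintro _ ⟨g, _, hg, rfl⟩
  exact hg v

theorem aux_env_ge {g : EuclideanSpace ℝ (Fin n) → ℝ} (hg : ConvexOn ℝ Set.univ g)
    (hgφ : ∀ w, g w ≤ φ w) (w : EuclideanSpace ℝ (Fin n)) : g w ≤ convEnv φ w :=
  le_csSup (aux_env_bdd φ w) ⟨g, hg, hgφ, rfl⟩

theorem aux_env_le (hex : ∃ g : EuclideanSpace ℝ (Fin n) → ℝ, ConvexOn ℝ Set.univ g ∧
    ∀ w, g w ≤ φ w) {v : EuclideanSpace ℝ (Fin n)} {c : ℝ}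
    (h : ∀ g : EuclideanSpace ℝ (Fin n) → ℝ, ConvexOn ℝ Set.univ g → (∀ w, g w ≤ φ w) → g v ≤ c) :
    convEnv φ v ≤ c := by
  obtain ⟨g, hg, hg'⟩ := hex
  refine csSup_le ⟨g v, g, hg, hg', rfl⟩ ?_
  rintro _ ⟨g, hg, hg', rfl⟩
  exact h g hg hg'

theorem aux_env_convex (hex : ∃ g : EuclideanSpace ℝ (Fin n) → ℝ, ConvexOn ℝ Set.univ g ∧
    ∀ w, g w ≤ φ w) : ConvexOn ℝ Set.univ (convEnv φ) := by
  refine ⟨convex_univ, fun x _ y _ a b ha hb hab => ?_⟩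
  refine aux_env_le hex fun g hg hg' => ?_
  refine (hg.2 (Set.mem_univ x) (Set.mem_univ y) ha hb hab).trans ?_
  simp only [smul_eq_mul]
  have := aux_env_ge hg hg' x
  have := aux_env_ge hg hg' y
  gcongr

theorem aux_env_semiconcave (hex : ∃ g : EuclideanSpace ℝ (Fin n) → ℝ, ConvexOn ℝ Set.univ g ∧
    ∀ w, g w ≤ φ w) {C : ℝ}
    (hs : ∀ v h, φ (v + h) + φ (v - h) - 2 * φ v ≤ C * ‖h‖ ^ 2)
    (v h : EuclideanSpace ℝ (Fin n)) :
    convEnv φ (v + h) + convEnv φ (v - h) - 2 * convEnv φ v ≤ C * ‖h‖ ^ 2 := by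
  have hc := aux_env_convex hex
  have hle : ∀ w, convEnv φ w ≤ φ w := fun w => aux_env_le hex fun g _ hg' => hg' w
  have hconv : ConvexOn ℝ Set.univ
      (fun w => (convEnv φ (w + h) + convEnv φ (w - h)) / 2 - C * ‖h‖ ^ 2 / 2) := by
    refine ⟨convex_univ, fun x _ y _ a b ha hb hab => ?_⟩
    have h1 := hc.2 (Set.mem_univ (x + h)) (Set.mem_univ (y + h)) ha hb hab
    have h2 := hc.2 (Set.mem_univ (x - h)) (Set.mem_univ (y - h)) ha hb hab
    have e1 : a • (x + h) + b • (y + h) = a • x + b • y + h := by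
      rw [smul_add, smul_add]
      have : h = a • h + b • h := by rw [← add_smul, hab, one_smul]
      nth_rewrite 3 [this]
      abel
    have e2 : a • (x - h) + b • (y - h) = a • x + b • y - h := by
      rw [smul_sub, smul_sub]
      have : h = a • h + b • h := by rw [← add_smul, hab, one_smul]
      nth_rewrite 3 [this]
      abel
    rw [e1] at h1
    rw [e2] at h2
    simp only [smul_eq_mul] at h1 h2 ⊢
    have hb' : b = 1 - a := by linarith
    subst hb'
    linarith
  have := aux_env_ge (φ := φ) hconv (fun w => by linarith [hs w h, hle (w + h), hle (w - h)]) v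
  linarith

end ToricAux4

/-- toric model of the metrized Fujita-type volume formula
`Vol(L) = ∫ μ_φ = ∫_{D∩X(0)} (dd^cφ)^n/n!`. With `φ = φ_Δ + χ` as in the toric setup,
`φ_e` its convex envelope and `D = {φ_e = φ}` the contact set, the total Monge–Ampère mass
of `φ_e` equals `vol_n(Δ)`, and so does `∫_D det(D²φ)`. Here the Monge–Ampère density
`MA[φ_e](v) = det(D(∇φ_e)(v))` is defined almost everywhere (and `fderiv` is the junk
value `0`, of determinant `0` since `n ≥ 1`, where `∇φ_e` is not differentiable). -/
theorem volume_eq_equilibrium_mass_toric (n : ℕ) (hn : 1 ≤ n)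
    (S : Finset (EuclideanSpace ℝ (Fin n)))
    (hS : ∀ α ∈ S, ∀ i, ∃ m : ℤ, α i = (m : ℝ))
    (Δ : Set (EuclideanSpace ℝ (Fin n)))
    (hΔ : Δ = convexHull ℝ (S : Set (EuclideanSpace ℝ (Fin n))))
    (hΔint : (interior Δ).Nonempty)
    (A : Finset (EuclideanSpace ℝ (Fin n)))
    (hA : (A : Set (EuclideanSpace ℝ (Fin n))) = Δ ∩ {v | ∀ i, ∃ m : ℤ, v i = (m : ℝ)})
    (φΔ χ φ : EuclideanSpace ℝ (Fin n) → ℝ)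
    (hφΔ : ∀ v, φΔ v = Real.log (∑ α ∈ A, Real.exp ⟪α, v⟫))
    (hχ : ContDiff ℝ (⊤ : ℕ∞) χ) (hχc : HasCompactSupport χ)
    (hφ : φ = φΔ + χ) :
    (∫ v, (fderiv ℝ (gradient (convEnv φ)) v).det) = (volume Δ).toReal ∧
    (∫ v in {v | convEnv φ v = φ v}, (fderiv ℝ (gradient φ) v).det)
      = (volume Δ).toReal := by
  
  -- basic facts about the polytope
  have hSA : (S : Set (EuclideanSpace ℝ (Fin n))) ⊆ A := by
    intro α hα
    rw [hA, hΔ]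
    exact ⟨subset_convexHull ℝ _ hα, hS α hα⟩
  have hAne : A.Nonempty := by
    obtain ⟨x, hx⟩ := hΔint
    have hx' : x ∈ convexHull ℝ (S : Set (EuclideanSpace ℝ (Fin n))) := hΔ ▸ interior_subset hx
    have hSne : (S : Set (EuclideanSpace ℝ (Fin n))).Nonempty := convexHull_nonempty_iff.1 ⟨x, hx'⟩
    obtain ⟨α, hα⟩ := hSne
    exact ⟨α, hSA hα⟩
  have hΔA : Δ ⊆ convexHull ℝ (A : Set (EuclideanSpace ℝ (Fin n))) := by
    rw [hΔ]; exact convexHull_mono hSA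
  have hAΔ : ∀ α ∈ A, α ∈ Δ := by
    intro α hα
    have : α ∈ (A : Set (EuclideanSpace ℝ (Fin n))) := hα
    rw [hA] at this
    exact this.1
  have hΔconv : Convex ℝ Δ := hΔ ▸ convex_convexHull ℝ _
  have hΔcpt : IsCompact Δ := hΔ ▸ S.finite_toSet.isCompact_convexHull (𝕜 := ℝ)
  have hφΔ' : φΔ = fun v => Real.log (∑ α ∈ A, Real.exp ⟪α, v⟫) := funext hφΔ
  -- regularity of φ
  obtain ⟨M, hM⟩ := aux_chi_bdd hχ hχc
  have hφs : ContDiff ℝ (⊤ : ℕ∞) φ := by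
    rw [hφ, hφΔ']; exact (aux_lse_contDiff hAne).add hχ
  have hφcont : Continuous φ := hφs.continuous
  have hφd : Differentiable ℝ φ := hφs.differentiable (by simp)
  have hφv : ∀ v, φ v = φΔ v + χ v := fun v => by rw [hφ]; rfl
  have hφge : ∀ q ∈ Δ, ∀ v, ⟪q, v⟫ - M ≤ φ v := by
    intro q hq v
    have h1 := aux_lse_ge v (hΔA hq)
    rw [← hφΔ v] at h1
    have h2 := (abs_le.1 (hM v)).1
    rw [hφv]; linarith
  obtain ⟨C, hC, hsemi⟩ : ∃ C : ℝ, 0 ≤ C ∧ ∀ v h, φ (v + h) + φ (v - h) - 2 * φ v ≤ C * ‖h‖ ^ 2 := by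
    obtain ⟨C1, hC1, h1⟩ := aux_lse_semiconcave hAne
    obtain ⟨C2, hC2, h2⟩ := aux_chi_semiconcave hχ hχc
    refine ⟨C1 + C2, by positivity, fun v h => ?_⟩
    simp only [hφv, hφΔ]
    have := h1 v h
    have := h2 v h
    rw [add_mul]
    linarith
  have haff : ∀ (p : EuclideanSpace ℝ (Fin n)) (c : ℝ),
      ConvexOn ℝ Set.univ (fun z : EuclideanSpace ℝ (Fin n) => ⟪p, z⟫ + c) := by
    intro p c
    refine ⟨convex_univ, fun x _ y _ a b _ _ hab => le_of_eq ?_⟩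
    have hb : b = 1 - a := by linarith
    subst hb
    simp only [inner_add_right, inner_smul_right, smul_eq_mul]
    ring
  have hex : ∃ g : EuclideanSpace ℝ (Fin n) → ℝ, ConvexOn ℝ Set.univ g ∧ ∀ w, g w ≤ φ w := by
    obtain ⟨q, hq⟩ := hΔint
    exact ⟨_, haff q (-M), fun w => hφge q (interior_subset hq) w⟩
  have huconv := aux_env_convex hex
  have hule : ∀ w, convEnv φ w ≤ φ w := fun w => aux_env_le hex fun g _ hg' => hg' w
  have hucont : Continuous (convEnv φ) := continuousOn_univ.1 (huconv.continuousOn isOpen_univ)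
  obtain ⟨hHgrad, htan, K, hLip⟩ := aux_semiconcave hC huconv (aux_env_semiconcave hex hsemi)
  set H := gradient (convEnv φ) with hHdef
  set G := gradient φ with hGdef
  have hGgrad : ∀ v, HasGradientAt φ (G v) v := fun v => (hφd v).hasGradientAt
  have hG1 : ContDiff ℝ 1 G := by
    have h1 : ContDiff ℝ 1 (fderiv ℝ φ) := hφs.fderiv_right (WithTop.coe_le_coe.2 le_top)
    exact (InnerProductSpace.toDual ℝ (EuclideanSpace ℝ (Fin n))).symm.contDiff.comp h1
  set D := {v | convEnv φ v = φ v} with hDdef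
  have hDm : MeasurableSet D := (isClosed_eq hucont hφcont).measurableSet
  have hGH : ∀ v ∈ D, G v = H v := by
    intro v hv
    refine aux_unique (hGgrad v) fun z => ?_
    have hv' : convEnv φ v = φ v := hv
    rw [← hv']
    exact (htan v z).trans (hule z)
  have hD : ∀ v ∈ D, ∀ z, φ v + ⟪G v, z - v⟫ ≤ φ z := by
    intro v hv z
    have hv' : convEnv φ v = φ v := hv
    rw [hGH v hv, ← hv']
    exact (htan v z).trans (hule z)
  have himg1 : interior Δ ⊆ G '' D := by
    intro p hp
    obtain ⟨r, hr, hball⟩ := Metric.nhds_basis_closedBall.mem_iff.1 (mem_interior_iff_mem_nhds.1 hp)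
    have hcoer : ∀ v, r * ‖v‖ - M ≤ φ v - ⟪p, v⟫ := by
      intro v
      by_cases hv : v = 0
      · subst hv
        have := hφge p (interior_subset hp) 0
        simp at this ⊢
        linarith
      · have hvn : 0 < ‖v‖ := norm_pos_iff.2 hv
        have h1 := hφge (p + (r / ‖v‖) • v) (hball (by
          rw [Metric.mem_closedBall, dist_eq_norm, add_sub_cancel_left, norm_smul,
            Real.norm_of_nonneg (by positivity)]
          exact le_of_eq (by field_simp))) v
        rw [inner_add_left, real_inner_smul_left, real_inner_self_eq_norm_sq] at h1
        have e : r / ‖v‖ * ‖v‖ ^ 2 = r * ‖v‖ := by field_simp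
        rw [e] at h1
        linarith
    have hlim : Tendsto (fun v => φ v - ⟪p, v⟫) (cocompact _) atTop := by
      refine tendsto_atTop_mono hcoer ?_
      exact tendsto_atTop_add_const_right _ (-M)
        ((tendsto_norm_cocompact_atTop (E := EuclideanSpace ℝ (Fin n))).const_mul_atTop hr)
    obtain ⟨v, hv⟩ := Continuous.exists_forall_le (hφcont.sub (by fun_prop)) hlim
    have hsub : ∀ z, φ v + ⟪p, z - v⟫ ≤ φ z := by
      intro z
      have : φ v - ⟪p, v⟫ ≤ φ z - ⟪p, z⟫ := hv z
      rw [inner_sub_right]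
      linarith
    refine ⟨v, ?_, aux_unique (hGgrad v) hsub⟩
    refine le_antisymm (hule v) ?_
    have := aux_env_ge (φ := φ) (haff p (φ v - ⟪p, v⟫)) (fun w => by
      have := hsub w
      rw [inner_sub_right] at this
      linarith) v
    linarith
  have himg2 : G '' D ⊆ Δ := by
    rintro _ ⟨v, hv, rfl⟩
    by_contra hnot
    obtain ⟨f, s, hf1, hf2⟩ := geometric_hahn_banach_closed_point hΔconv hΔcpt.isClosed hnot
    set y := (InnerProductSpace.toDual ℝ (EuclideanSpace ℝ (Fin n))).symm f with hy
    have hfy : ∀ x, f x = ⟪x, y⟫ := by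
      intro x
      rw [real_inner_comm, hy, InnerProductSpace.toDual_symm_apply]
    have hbound : ∀ t : ℝ, 0 ≤ t →
        t * (f (G v) - s) ≤ Real.log A.card + M - φ v + ⟪G v, v⟫ := by
      intro t ht
      have h1 := hD v hv (t • y)
      rw [inner_sub_right, inner_smul_right, ← hfy] at h1
      have h2 : φΔ (t • y) ≤ Real.log A.card + t * s := by
        rw [hφΔ]
        refine aux_lse_le hAne _ fun α hα => ?_
        rw [inner_smul_right, ← hfy]
        exact mul_le_mul_of_nonneg_left (hf1 α (hAΔ α hα)).le ht
      have h3 := (abs_le.1 (hM (t • y))).2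
      rw [hφv (t • y)] at h1
      rw [mul_sub]
      linarith
    have hpos : 0 < f (G v) - s := by linarith
    set B := Real.log A.card + M - φ v + ⟪G v, v⟫ with hB
    have h1 := hbound ((|B| + 1) / (f (G v) - s)) (by positivity)
    rw [div_mul_cancel₀ _ hpos.ne'] at h1
    linarith [le_abs_self B]
  have harea := aux_area volume hφcont hG1 hDm hD hΔconv himg1 himg2
  -- derivative of H
  have hmono : ∀ v w, 0 ≤ ⟪H w - H v, w - v⟫ := by
    intro v w
    have h1 := htan v w
    have h2 := htan w v
    have e : v - w = -(w - v) := by abel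
    rw [e, inner_neg_right] at h2
    rw [inner_sub_left]
    linarith
  have hHdet : ∀ v, 0 ≤ (fderiv ℝ H v).det := aux_det_monotone hmono
  have hHdiff : ∀ᵐ v, DifferentiableAt ℝ H v := hLip.ae_differentiableAt
  have heq : ∀ᵐ v, v ∈ D → fderiv ℝ H v = fderiv ℝ G v := by
    have hms : MeasurableSet {v | DifferentiableAt ℝ H v} := measurableSet_of_differentiableAt ℝ H
    have happ : ApproximatesLinearOn (fun v => H v - G v)
        (0 : EuclideanSpace ℝ (Fin n) →L[ℝ] EuclideanSpace ℝ (Fin n))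
        (D ∩ {v | DifferentiableAt ℝ H v}) 0 := by
      intro x hx y hy
      simp [hGH x hx.1, hGH y hy.1]
    have h1 := happ.norm_fderiv_sub_le volume (hDm.inter hms)
      (fun v => fderiv ℝ H v - fderiv ℝ G v) (fun x hx =>
        (DifferentiableAt.hasFDerivAt hx.2).hasFDerivWithinAt.sub
          ((hG1.differentiable one_ne_zero) x).hasFDerivAt.hasFDerivWithinAt)
    rw [ae_restrict_iff' (hDm.inter hms)] at h1
    filter_upwards [h1, hHdiff] with v hv hvd hvD
    have := hv ⟨hvD, hvd⟩
    rw [sub_zero] at this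
    have h0 : ‖fderiv ℝ H v - fderiv ℝ G v‖₊ = 0 := le_antisymm this zero_le
    rw [nnnorm_eq_zero] at h0
    exact sub_eq_zero.1 h0
  have hGint : (∫ v in D, (fderiv ℝ G v).det) = (volume Δ).toReal := by
    have hdc : Continuous fun v => (fderiv ℝ G v).det :=
      ContinuousLinearMap.continuous_det.comp (hG1.continuous_fderiv one_ne_zero)
    have hnn : ∀ᵐ v ∂(volume.restrict D), 0 ≤ (fderiv ℝ G v).det := by
      rw [ae_restrict_iff' hDm]
      filter_upwards [heq] with v hv hvD
      rw [← hv hvD]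
      exact hHdet v
    rw [integral_eq_lintegral_of_nonneg_ae hnn hdc.aestronglyMeasurable, ← harea]
    congr 1
    refine lintegral_congr_ae ?_
    filter_upwards [hnn] with v hv
    rw [abs_of_nonneg hv]
  refine ⟨?_, hGint⟩
  rw [← hGint]
  have hzero : ∀ v, v ∉ D → (fderiv ℝ H v).det = 0 := by
    intro v hv
    refine aux_off_contact (by rw [finrank_euclideanSpace_fin]; exact hn) huconv hφcont hule hHgrad
      htan (fun g hg hg' w => aux_env_ge hg hg' w) v (lt_of_le_of_ne (hule v) hv)
  rw [← setIntegral_eq_integral_of_forall_compl_eq_zero hzero]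
  refine setIntegral_congr_ae hDm ?_
  filter_upwards [heq] with v hv hvD
  rw [hv hvD]
end

section
/- Let Δ ⊂ ℝ^n (n ≥ 1) be the convex hull of a finite subset of ℤ^n with nonempty interior, φ_Δ(v) = log(Σ_{α ∈ Δ∩ℤ^n} e^{⟨α,v⟩}), χ : ℝ^n → ℝ smooth with compact support, φ = φ_Δ + χ, φ_e the convex envelope of φ, D = {v : φ_e(v) = φ(v)}, and let B_k be the associated toric Bergman function. Then for Lebesgue-almost every v ∈ ℝ^n, lim_{k→∞} k^{−n} B_k(v) = 1_D(v) · det(D²φ(v)) / det(D²φ_Δ(v)), where 1_D is the indicator of D and D² denotes the Hessian matrix (det(D²φ_Δ(v)) > 0 for every v since Δ has nonempty interior). (This is the toric-model instance of the theorem that k^{−n}B_k converges almost everywhere to 1_{D∩X(0)} det(dd^cφ).) -/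
open scoped RealInnerProductSpace
open MeasureTheory Filter

set_option linter.unusedSectionVars false
set_option linter.unusedSimpArgs false
set_option linter.deprecated false

section lse
variable {E : Type*} [NormedAddCommGroup E] [InnerProductSpace ℝ E] [FiniteDimensional ℝ E]

lemma det_pos_of_inner_pos (T : E →L[ℝ] E) (hT : ∀ u, u ≠ 0 → 0 < ⟪T u, u⟫) : 0 < T.det := by
  let P : ℝ → (E →L[ℝ] E) := fun t => t • T + (1 - t) • ContinuousLinearMap.id ℝ E
  have hPc : Continuous fun t => (P t).det := by
    apply ContinuousLinearMap.continuous_det.comp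
    fun_prop
  have hne : ∀ t ∈ Set.Icc (0:ℝ) 1, (P t).det ≠ 0 := by
    intro t ht h0
    obtain ⟨u, hu, hu0⟩ := (Submodule.ne_bot_iff _).1
      (LinearMap.bot_lt_ker_of_det_eq_zero (f := ((P t : E →L[ℝ] E) : E →ₗ[ℝ] E)) h0).ne'
    have h1 : P t u = 0 := hu
    have h2 : ⟪P t u, u⟫ = t * ⟪T u, u⟫ + (1 - t) * ⟪u, u⟫ := by
      simp [P, inner_add_left, inner_smul_left]
    rw [h1, inner_zero_left] at h2
    have h3 := hT u hu0
    have h4 : 0 < ⟪u, u⟫ := real_inner_self_pos.2 hu0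
    rcases eq_or_lt_of_le ht.1 with h | h
    · subst h; simp at h2; exact hu0 (by simpa using h2.symm)
    · have := mul_pos h h3
      have := mul_nonneg (sub_nonneg.2 ht.2) h4.le
      linarith
  have h0 : (P 0).det = 1 := by
    simp [P, ContinuousLinearMap.det]
  have h1 : P 1 = T := by simp [P]
  by_contra hneg
  push Not at hneg
  have := intermediate_value_Icc' (zero_le_one) hPc.continuousOn
  have hmem : (0:ℝ) ∈ Set.Icc ((P 1).det) ((P 0).det) := by
    rw [h0, h1]; exact ⟨hneg, zero_le_one⟩
  obtain ⟨t, ht, h⟩ := this hmem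
  exact hne t ht h

noncomputable def lseZ (A : Finset E) (v : E) : ℝ := ∑ α ∈ A, Real.exp ⟪α, v⟫
noncomputable def lseM (A : Finset E) (v : E) : E :=
  (lseZ A v)⁻¹ • ∑ α ∈ A, Real.exp ⟪α, v⟫ • α
noncomputable def lseH (A : Finset E) (v : E) : E →L[ℝ] E :=
  (lseZ A v)⁻¹ • ∑ α ∈ A, Real.exp ⟪α, v⟫ • (innerSL ℝ α).smulRight (α - lseM A v)

lemma lseZ_pos {A : Finset E} (hA : A.Nonempty) (v : E) : 0 < lseZ A v :=
  Finset.sum_pos (fun _ _ => Real.exp_pos _) hA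

lemma hasFDerivAt_exp_inner (α v : E) :
    HasFDerivAt (fun v => Real.exp ⟪α, v⟫) (Real.exp ⟪α, v⟫ • innerSL ℝ α) v := by
  have : HasFDerivAt (fun v => ⟪α, v⟫) (innerSL ℝ α) v := (innerSL ℝ α).hasFDerivAt
  exact this.exp

lemma hasFDerivAt_lseZ (A : Finset E) (v : E) :
    HasFDerivAt (lseZ A) (∑ α ∈ A, Real.exp ⟪α, v⟫ • innerSL ℝ α) v := by
  unfold lseZ
  exact HasFDerivAt.fun_sum fun α _ => hasFDerivAt_exp_inner α v

lemma hasGradientAt_lse {A : Finset E} (hA : A.Nonempty) (v : E) :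
    HasGradientAt (fun v => Real.log (lseZ A v)) (lseM A v) v := by
  rw [hasGradientAt_iff_hasFDerivAt]
  have := (hasFDerivAt_lseZ A v).log (lseZ_pos hA v).ne'
  refine this.congr_fderiv ?_
  ext u
  simp [lseM, inner_smul_left, sum_inner]

lemma hasFDerivAt_lseM {A : Finset E} (hA : A.Nonempty) (v : E) :
    HasFDerivAt (lseM A) (lseH A v) v := by
  have h1 : HasFDerivAt (fun v => (lseZ A v)⁻¹) _ v :=
    (hasDerivAt_inv (lseZ_pos hA v).ne').comp_hasFDerivAt v (hasFDerivAt_lseZ A v)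
  have h2 : HasFDerivAt (fun v => ∑ α ∈ A, Real.exp ⟪α, v⟫ • α) _ v :=
    HasFDerivAt.fun_sum fun α _ => (hasFDerivAt_exp_inner α v).smul_const α
  have := h1.smul h2
  refine this.congr_fderiv ?_
  have hZ := (lseZ_pos hA v).ne'
  ext1 u
  simp only [lseH, lseM, ContinuousLinearMap.smul_apply, ContinuousLinearMap.sum_apply, ContinuousLinearMap.add_apply,
    ContinuousLinearMap.smulRight_apply, innerSL_apply_apply, smul_sub, Finset.sum_sub_distrib, smul_eq_mul, ← Finset.sum_smul, smul_smul, ContinuousLinearMap.neg_apply]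
  rw [sub_eq_add_neg]
  congr 1
  rw [← neg_smul]
  congr 1
  simp only [Finset.mul_sum, ← Finset.sum_neg_distrib]
  exact Finset.sum_congr rfl fun _ _ => by ring

lemma sum_sub_lseM {A : Finset E} (hA : A.Nonempty) (v : E) :
    ∑ α ∈ A, Real.exp ⟪α, v⟫ • (α - lseM A v) = 0 := by
  have hZ := (lseZ_pos hA v).ne'
  simp only [smul_sub, Finset.sum_sub_distrib, ← Finset.sum_smul]
  change _ - lseZ A v • _ = 0
  rw [lseM, smul_smul, mul_inv_cancel₀ hZ, one_smul, sub_self]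

lemma inner_lseH {A : Finset E} (hA : A.Nonempty) (v u : E) :
    ⟪lseH A v u, u⟫ = (lseZ A v)⁻¹ * ∑ α ∈ A, Real.exp ⟪α, v⟫ * ⟪α - lseM A v, u⟫ ^ 2 := by
  have h0 := congrArg (fun x => ⟪x, u⟫) (sum_sub_lseM hA v)
  simp only [sum_inner, inner_smul_left, inner_zero_left] at h0
  simp only [lseH, ContinuousLinearMap.smul_apply, ContinuousLinearMap.sum_apply,
    ContinuousLinearMap.smulRight_apply, innerSL_apply_apply, inner_smul_left, sum_inner]
  simp only [conj_trivial] at h0 ⊢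
  congr 1
  rw [← sub_eq_zero, ← Finset.sum_sub_distrib, ← mul_zero ⟪lseM A v, u⟫, ← h0, Finset.mul_sum]
  refine Finset.sum_congr rfl fun α _ => ?_
  rw [show ⟪α, u⟫ = ⟪α - lseM A v, u⟫ + ⟪lseM A v, u⟫ by rw [inner_sub_left]; ring]
  ring

lemma inner_lseH_pos {A : Finset E} (hA : A.Nonempty) 
    (hspan : ∀ u : E, u ≠ 0 → ∀ c : ℝ, ∃ α ∈ A, ⟪α, u⟫ ≠ c) (v u : E) (hu : u ≠ 0) :
    0 < ⟪lseH A v u, u⟫ := by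
  rw [inner_lseH hA]
  refine mul_pos (inv_pos.2 (lseZ_pos hA v)) ?_
  obtain ⟨α, hα, h⟩ := hspan u hu ⟪lseM A v, u⟫
  refine Finset.sum_pos' (fun i _ => by positivity) ⟨α, hα, ?_⟩
  have : ⟪α - lseM A v, u⟫ ≠ 0 := by rw [inner_sub_left]; exact sub_ne_zero.2 h
  positivity

lemma norm_lseM_le {A : Finset E} (hA : A.Nonempty) {R : ℝ} (hR : ∀ α ∈ A, ‖α‖ ≤ R) (v : E) :
    ‖lseM A v‖ ≤ R := by
  have hZ := lseZ_pos hA v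
  rw [lseM, norm_smul, norm_inv, Real.norm_of_nonneg hZ.le, inv_mul_le_iff₀ hZ, lseZ, Finset.sum_mul]
  refine (norm_sum_le _ _).trans (Finset.sum_le_sum fun α hα => ?_)
  rw [norm_smul, Real.norm_of_nonneg (Real.exp_pos _).le]
  gcongr
  exact hR α hα

lemma norm_lseH_le {A : Finset E} (hA : A.Nonempty) {R : ℝ} (hR : ∀ α ∈ A, ‖α‖ ≤ R) (v : E) :
    ‖lseH A v‖ ≤ R * (R + R) := by
  have hZ := lseZ_pos hA v
  rw [lseH, norm_smul, norm_inv, Real.norm_of_nonneg hZ.le, inv_mul_le_iff₀ hZ, lseZ, Finset.sum_mul]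
  refine (norm_sum_le _ _).trans (Finset.sum_le_sum fun α hα => ?_)
  rw [norm_smul, Real.norm_of_nonneg (Real.exp_pos _).le]
  have hα' := hR α hα
  have : 0 ≤ R := (norm_nonneg _).trans hα'
  gcongr
  rw [ContinuousLinearMap.norm_smulRight_apply, innerSL_apply_norm]
  gcongr
  exact (norm_sub_le _ _).trans (add_le_add hα' (norm_lseM_le hA hR v))

lemma contDiff_lse {A : Finset E} (hA : A.Nonempty) {m : WithTop ℕ∞} :
    ContDiff ℝ m (fun v => Real.log (lseZ A v)) := by
  refine ContDiff.log ?_ fun v => (lseZ_pos hA v).ne'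
  unfold lseZ
  refine ContDiff.sum fun α _ => ?_
  exact (contDiff_const.inner ℝ contDiff_id).exp

lemma contDiff_gradient {f : E → ℝ} (hf : ContDiff ℝ 2 f) : ContDiff ℝ 1 (gradient f) := by
  have : ContDiff ℝ 1 (fderiv ℝ f) := hf.fderiv_right (by norm_num)
  exact (InnerProductSpace.toDual ℝ E).symm.contDiff.comp this

lemma det_bounded (R : ℝ) : ∃ C : ℝ, 0 < C ∧ ∀ T : E →L[ℝ] E, ‖T‖ ≤ R → T.det ≤ C := by
  have hc : IsCompact (Metric.closedBall (0 : E →L[ℝ] E) R) := isCompact_closedBall _ _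
  obtain ⟨C, hC⟩ := hc.bddAbove_image (ContinuousLinearMap.continuous_det (𝕜 := ℝ) (E := E)).continuousOn
  refine ⟨max C 1, by positivity, fun T hT => le_max_of_le_left (hC ⟨T, by simpa using hT, rfl⟩)⟩

lemma lse_det_facts {A : Finset E} (hA : A.Nonempty) 
    (hspan : ∀ u : E, u ≠ 0 → ∀ c : ℝ, ∃ α ∈ A, ⟪α, u⟫ ≠ c) (f : E → ℝ) 
    (hf : ∀ v, f v = Real.log (∑ α ∈ A, Real.exp ⟪α, v⟫)) :
    Continuous (fun w => (fderiv ℝ (gradient f) w).det) ∧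
    (∀ w, 0 < (fderiv ℝ (gradient f) w).det) ∧
    ∃ C : ℝ, 0 < C ∧ ∀ w, (fderiv ℝ (gradient f) w).det ≤ C := by
  have hf' : f = fun v => Real.log (lseZ A v) := funext hf
  have hg : gradient f = lseM A := by
    rw [hf']; exact funext fun v => (hasGradientAt_lse hA v).gradient
  have hH : ∀ w, fderiv ℝ (gradient f) w = lseH A w := by
    intro w; rw [hg]; exact (hasFDerivAt_lseM hA w).fderiv
  refine ⟨?_, ?_, ?_⟩
  · have h1 : ContDiff ℝ 1 (gradient f) := contDiff_gradient (by rw [hf']; exact contDiff_lse hA)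
    exact ContinuousLinearMap.continuous_det.comp (h1.continuous_fderiv (by norm_num))
  · intro w; rw [hH]; exact det_pos_of_inner_pos _ (inner_lseH_pos hA hspan w)
  · obtain ⟨R, hR⟩ : ∃ R, ∀ α ∈ A, ‖α‖ ≤ R := by
      obtain ⟨R, hR⟩ := (A.finite_toSet.image norm).bddAbove
      exact ⟨R, fun α hα => hR ⟨α, hα, rfl⟩⟩
    obtain ⟨C, hC0, hC⟩ := det_bounded (E := E) (R * (R + R))
    exact ⟨C, hC0, fun w => by rw [hH]; exact hC _ (norm_lseH_le hA hR w)⟩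

end lse

section gauss
variable {E : Type*} [NormedAddCommGroup E] [InnerProductSpace ℝ E] [FiniteDimensional ℝ E]
  [MeasurableSpace E] [BorelSpace E]

lemma exists_sqrt_op (H : E →L[ℝ] E) (hsym : ∀ x y, ⟪H x, y⟫ = ⟪x, H y⟫)
    (hpos : ∀ u, u ≠ 0 → 0 < ⟪H u, u⟫) :
    ∃ L : E →L[ℝ] E, (∀ x y, ⟪L x, y⟫ = ⟪x, L y⟫) ∧ (∀ u, ⟪H u, u⟫ = ‖L u‖ ^ 2) ∧
      L.det ^ 2 = H.det ∧ L.det ≠ 0 := by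
  have hs : (H : E →ₗ[ℝ] E).IsSymmetric := hsym
  let b := hs.eigenvectorBasis rfl
  let l := hs.eigenvalues rfl
  have hHb : ∀ i, H (b i) = l i • b i := fun i => by
    have := hs.apply_eigenvectorBasis rfl i
    exact this
  have hl : ∀ i, 0 < l i := by
    intro i
    have := hpos (b i) (b.orthonormal.ne_zero i)
    rw [hHb, inner_smul_left, real_inner_self_eq_norm_sq, b.orthonormal.1 i] at this
    simpa using this
  let L : E →L[ℝ] E := ∑ i, Real.sqrt (l i) • (innerSL ℝ (b i)).smulRight (b i)
  have hL : ∀ x, L x = ∑ i, (Real.sqrt (l i) * ⟪b i, x⟫) • b i := by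
    intro x; simp [L, smul_smul]
  have hLsym : ∀ x y, ⟪L x, y⟫ = ⟪x, L y⟫ := by
    intro x y
    simp only [hL, sum_inner, inner_sum, inner_smul_left, inner_smul_right, conj_trivial]
    refine Finset.sum_congr rfl fun i _ => ?_
    rw [real_inner_comm x (b i)]; ring
  have hLb : ∀ i, L (b i) = Real.sqrt (l i) • b i := by
    intro i
    rw [hL, Finset.sum_eq_single i]
    · simp [b.orthonormal.1 i]
    · intro j _ hj
      rw [b.orthonormal.2 hj]; simp
    · simp
  have hLL : (L : E →ₗ[ℝ] E) ∘ₗ (L : E →ₗ[ℝ] E) = (H : E →ₗ[ℝ] E) := by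
    refine b.toBasis.ext fun i => ?_
    simp only [OrthonormalBasis.coe_toBasis, LinearMap.comp_apply, ContinuousLinearMap.coe_coe, hHb, hLb, map_smul, smul_smul]
    rw [Real.mul_self_sqrt (hl i).le]
  have hdet : L.det ^ 2 = H.det := by
    rw [sq]
    change LinearMap.det _ * LinearMap.det _ = LinearMap.det _
    rw [← LinearMap.det_comp, hLL]
  refine ⟨L, hLsym, ?_, hdet, ?_⟩
  · intro u
    have : L (L u) = H u := LinearMap.congr_fun hLL u
    rw [← this, hLsym, real_inner_self_eq_norm_sq]
  · intro h0
    have := det_pos_of_inner_pos H hpos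
    rw [← hdet, h0] at this
    simp at this

lemma lintegral_comp_clm (L : E →L[ℝ] E) (hL : L.det ≠ 0) (f : E → ENNReal) (hf : Measurable f) :
    ENNReal.ofReal |L.det| * ∫⁻ u, f (L u) = ∫⁻ u, f u := by
  have h := Measure.map_linearMap_addHaar_eq_smul_addHaar (volume : Measure E) (f := (L : E →ₗ[ℝ] E)) hL
  have h2 : ∫⁻ u, f (L u) = ∫⁻ u, f u ∂(Measure.map (L : E →ₗ[ℝ] E) volume) :=
    (lintegral_map hf L.continuous.measurable).symm
  rw [h2, h, lintegral_smul_measure, smul_eq_mul, ← mul_assoc, ← ENNReal.ofReal_mul (abs_nonneg _),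
    ← abs_mul]
  change ENNReal.ofReal |L.det * L.det⁻¹| * _ = _
  rw [mul_inv_cancel₀ hL]; simp

noncomputable def gaussK (E : Type*) [NormedAddCommGroup E] [InnerProductSpace ℝ E] [FiniteDimensional ℝ E]
  [MeasurableSpace E] [BorelSpace E] : ENNReal := ∫⁻ u : E, ENNReal.ofReal (Real.exp (-(1/2) * ‖u‖ ^ 2))

lemma integrable_gauss {b : ℝ} (hb : 0 < b) : Integrable (fun u : E => Real.exp (-b * ‖u‖ ^ 2)) := by
  by_contra h
  have h1 := GaussianFourier.integral_rexp_neg_mul_sq_norm (V := E) hb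
  rw [integral_undef h] at h1
  have : 0 < (Real.pi / b) ^ (Module.finrank ℝ E / 2 : ℝ) := by positivity
  linarith

lemma gaussK_ne_top : gaussK E ≠ ⊤ := by
  have := (integrable_gauss (E := E) (b := 1/2) (by norm_num)).lintegral_lt_top
  exact this.ne

lemma gaussK_ne_zero : gaussK E ≠ 0 := by
  unfold gaussK
  rw [← ofReal_integral_eq_lintegral_ofReal (integrable_gauss (by norm_num)) (ae_of_all _ fun _ => (Real.exp_pos _).le),
    GaussianFourier.integral_rexp_neg_mul_sq_norm (by norm_num)]
  simp only [ne_eq, ENNReal.ofReal_eq_zero, not_le]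
  positivity

lemma gauss_shift (y : E) : ∫⁻ u : E, ENNReal.ofReal (Real.exp (⟪y, u⟫ - (1/2) * ‖u‖ ^ 2)) =
    ENNReal.ofReal (Real.exp (1/2 * ‖y‖ ^ 2)) * gaussK E := by
  unfold gaussK
  rw [← lintegral_add_right_eq_self _ y, ← lintegral_const_mul _ (by fun_prop)]
  refine lintegral_congr fun u => ?_
  rw [← ENNReal.ofReal_mul (Real.exp_pos _).le, ← Real.exp_add]
  congr 2
  rw [inner_add_right, real_inner_self_eq_norm_sq, norm_add_sq_real, real_inner_comm u y]
  ring

/-- The limiting Gaussian integral. -/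
noncomputable def gaussI (H : E →L[ℝ] E) (d : ℝ) (q : E) : ENNReal :=
  ∫⁻ u : E, ENNReal.ofReal (Real.exp (⟪q, u⟫ - (1/2) * ⟪H u, u⟫) * d)

lemma gaussI_facts (H : E →L[ℝ] E) (hsym : ∀ x y, ⟪H x, y⟫ = ⟪x, H y⟫)
    (hpos : ∀ u, u ≠ 0 → 0 < ⟪H u, u⟫) (d : ℝ) (hd : 0 < d) :
    (∀ q, gaussI H d q ≠ 0) ∧ 
    ∫ q, ((gaussI H d q)⁻¹).toReal = H.det / d := by
  obtain ⟨L, hLs, hLH, hdet, hdet0⟩ := exists_sqrt_op H hsym hpos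
  have hD : 0 < |L.det| := abs_pos.2 hdet0
  have hD' : ENNReal.ofReal |L.det| ≠ 0 := by simpa using hdet0
  have hI : ∀ y, ENNReal.ofReal |L.det| * gaussI H d (L y) =
      ENNReal.ofReal d * (ENNReal.ofReal (Real.exp (1/2 * ‖y‖ ^ 2)) * gaussK E) := by
    intro y
    rw [← gauss_shift, ← lintegral_const_mul _ (by fun_prop), ← lintegral_comp_clm L hdet0 _ (by fun_prop)]
    unfold gaussI
    congr 1
    refine lintegral_congr fun u => ?_
    rw [← ENNReal.ofReal_mul hd.le, hLH, hLs, mul_comm]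
  have hsurj : Function.Surjective L := by
    have : Function.Injective (L : E →ₗ[ℝ] E) := by
      exact (LinearEquiv.ofIsUnitDet (f := (L : E →ₗ[ℝ] E)) (v := Module.finBasis ℝ E) (v' := Module.finBasis ℝ E)
        (by rw [LinearMap.det_toMatrix]; exact isUnit_iff_ne_zero.2 hdet0)).injective
    exact LinearMap.surjective_of_injective this
  have hne0 : ∀ q, gaussI H d q ≠ 0 := by
    intro q h
    obtain ⟨y, rfl⟩ := hsurj q
    have := hI y
    rw [h, mul_zero] at this
    have h2 := mul_eq_zero.1 this.symm
    simp [hd.not_ge, gaussK_ne_zero, Real.exp_pos, (Real.exp_pos _).not_ge] at h2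
  refine ⟨hne0, ?_⟩
  have hmeas : Measurable (gaussI H d) := by
    unfold gaussI
    refine Measurable.lintegral_prod_right' (f := fun z : E × E => ENNReal.ofReal (Real.exp (⟪z.1, z.2⟫ - (1/2) * ⟪H z.2, z.2⟫) * d)) ?_
    fun_prop
  have hG : (fun q => ((gaussI H d q)⁻¹).toReal) = fun q => ((gaussI H d)⁻¹ q).toReal := rfl
  rw [hG, integral_toReal hmeas.inv.aemeasurable (ae_of_all _ fun q => by simpa [pos_iff_ne_zero] using hne0 q),
    ← lintegral_comp_clm L hdet0 _ hmeas.inv]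
  have h3 : ∀ y, (gaussI H d (L y))⁻¹ = 
      (ENNReal.ofReal |L.det| * (ENNReal.ofReal d * gaussK E)⁻¹) * ENNReal.ofReal (Real.exp (-(1/2) * ‖y‖ ^ 2)) := by
    intro y
    have h4 := hI y
    have h5 : gaussI H d (L y) = (ENNReal.ofReal |L.det|)⁻¹ * (ENNReal.ofReal (Real.exp (1/2 * ‖y‖ ^ 2)) *
        (ENNReal.ofReal d * gaussK E)) := by
      rw [show ENNReal.ofReal (Real.exp (1/2 * ‖y‖ ^ 2)) *
        (ENNReal.ofReal d * gaussK E) = ENNReal.ofReal d * (ENNReal.ofReal (Real.exp (1/2 * ‖y‖ ^ 2)) * gaussK E) by ring,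
        ← h4, ← mul_assoc, ENNReal.inv_mul_cancel hD' ENNReal.ofReal_ne_top, one_mul]
    have he : ENNReal.ofReal (Real.exp (1/2 * ‖y‖ ^ 2)) ≠ 0 := by simp [Real.exp_pos]
    rw [h5, ENNReal.mul_inv (Or.inr (ENNReal.mul_ne_top ENNReal.ofReal_ne_top (ENNReal.mul_ne_top ENNReal.ofReal_ne_top gaussK_ne_top))) 
      (Or.inl (ENNReal.inv_ne_top.2 hD')),
      inv_inv, ENNReal.mul_inv (Or.inl he) (Or.inl ENNReal.ofReal_ne_top), ← ENNReal.ofReal_inv_of_pos (Real.exp_pos _), ← Real.exp_neg]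
    rw [mul_assoc, mul_comm (ENNReal.ofReal (Real.exp _))]
    ring_nf
  simp only [h3, Pi.inv_apply]
  rw [lintegral_const_mul _ (by fun_prop)]
  change (_ * (_ * gaussK E)).toReal = _
  have hK1 := gaussK_ne_top (E := E)
  have hK2 : (gaussK E).toReal ≠ 0 := ENNReal.toReal_ne_zero.2 ⟨gaussK_ne_zero, hK1⟩
  simp only [ENNReal.toReal_mul, ENNReal.toReal_inv, ENNReal.toReal_ofReal hd.le, ENNReal.toReal_ofReal hD.le]
  rw [← hdet, ← sq_abs]
  field_simp

lemma gaussI_eq_top (H : E →L[ℝ] E) (hsym : ∀ x y, ⟪H x, y⟫ = ⟪x, H y⟫)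
    (u₀ : E) (hu : u₀ ≠ 0) (hHu : H u₀ = 0) (d : ℝ) (hd : 0 < d) (q : E) :
    gaussI H d q = ⊤ := by
  wlog hq : 0 ≤ ⟪q, u₀⟫ generalizing u₀
  · exact this (-u₀) (by simpa) (by simp [hHu]) (by rw [inner_neg_right]; linarith)
  by_contra htop
  set f : E → ENNReal := fun u => ENNReal.ofReal (Real.exp (⟪q, u⟫ - (1/2) * ⟪H u, u⟫) * d) with hf
  have hfm : Measurable f := by fun_prop
  have hfpos : ∀ u, f u ≠ 0 := by
    intro u; simp only [hf, ne_eq, ENNReal.ofReal_eq_zero, not_le]; positivity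
  have hmono : ∀ u, f u ≤ f (u + u₀) := by
    intro u
    apply ENNReal.ofReal_le_ofReal
    gcongr
    · rw [inner_add_right]; linarith
    · rw [map_add, hHu, add_zero, inner_add_right, hsym u u₀, hHu]; simp
  let T : Set E := {u | 0 ≤ ⟪u₀, u⟫}
  let T' : Set E := {u | ⟪u₀, u₀⟫ ≤ ⟪u₀, u⟫}
  have hTm : MeasurableSet T := measurableSet_le measurable_const (by fun_prop)
  have hTm' : MeasurableSet T' := measurableSet_le measurable_const (by fun_prop)
  have huu : 0 < ⟪u₀, u₀⟫ := real_inner_self_pos.2 hu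
  have hsub : T' ⊆ T := fun u hu => le_trans huu.le hu
  have h1 : ∫⁻ u in T, f u ≤ ∫⁻ u in T', f u := by
    rw [← lintegral_indicator hTm, ← lintegral_indicator hTm', ← lintegral_add_right_eq_self (T'.indicator f) u₀]
    refine lintegral_mono fun u => ?_
    by_cases h : u ∈ T
    · have h' : u + u₀ ∈ T' := by
        simp only [T, T', Set.mem_setOf_eq, inner_add_right] at h ⊢; linarith
      rw [Set.indicator_of_mem h']
      exact (Set.indicator_le_self' (by simp) u |>.trans (hmono u))
    · rw [Set.indicator_of_notMem h]; exact zero_le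
  have h2 := lintegral_inter_add_diff f (μ := volume) T hTm'
  rw [Set.inter_eq_right.2 hsub] at h2
  have hfin : ∫⁻ u in T', f u ≠ ⊤ := ne_top_of_le_ne_top htop (setLIntegral_le_lintegral _ _)
  have h3 : ∫⁻ u in T \ T', f u = 0 := by
    rw [← h2] at h1
    by_contra hne
    exact absurd h1 (not_le.2 (ENNReal.lt_add_right hfin hne))
  rw [lintegral_eq_zero_iff hfm] at h3
  have h4 : volume (T \ T') = 0 := by
    rw [← Measure.restrict_eq_zero, ← ae_eq_bot, ← eventually_false_iff_eq_bot]
    filter_upwards [h3] with u hu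
    exact hfpos u hu
  have hO : IsOpen {u : E | 0 < ⟪u₀, u⟫ ∧ ⟪u₀, u⟫ < ⟪u₀, u₀⟫} :=
    (isOpen_lt (f := fun _ : E => (0:ℝ)) (g := fun u : E => ⟪u₀, u⟫) continuous_const (by fun_prop)).inter
      (isOpen_lt (f := fun u : E => ⟪u₀, u⟫) (g := fun _ : E => ⟪u₀, u₀⟫) (by fun_prop) continuous_const)
  have h5 := hO.measure_pos volume ⟨(1/2 : ℝ) • u₀, by
    simp only [Set.mem_setOf_eq, inner_smul_right]; constructor <;> linarith⟩
  refine absurd (measure_mono_null ?_ h4) h5.ne'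
  rintro u ⟨h, h'⟩
  exact ⟨h.le, not_le.2 h'⟩

end gauss

section riemann

noncomputable def grid {n : ℕ} (k : ℕ) (x : EuclideanSpace ℝ (Fin n)) : EuclideanSpace ℝ (Fin n) :=
  WithLp.toLp 2 (fun i => (⌊(k:ℝ) * x i⌋ : ℝ) / k)

variable {n : ℕ}

lemma norm_grid_sub_sq (k : ℕ) (hk : 1 ≤ k) (x : EuclideanSpace ℝ (Fin n)) :
    ‖grid k x - x‖ ^ 2 ≤ n / (k:ℝ) ^ 2 := by
  have hk0 : (0:ℝ) < k := by exact_mod_cast hk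
  rw [EuclideanSpace.norm_sq_eq]
  have : ∀ i, ‖(grid k x - x) i‖ ^ 2 ≤ 1 / (k:ℝ) ^ 2 := by
    intro i
    have h1 : (grid k x - x) i = ((⌊(k:ℝ) * x i⌋ : ℝ) - k * x i) / k := by
      simp only [grid, PiLp.sub_apply]; field_simp
    rw [h1, Real.norm_eq_abs, sq_abs, div_pow]
    have h2 := Int.floor_le ((k:ℝ) * x i)
    have h3 := Int.lt_floor_add_one ((k:ℝ) * x i)
    gcongr
    nlinarith
  calc _ ≤ ∑ i : Fin n, 1 / (k:ℝ) ^ 2 := Finset.sum_le_sum fun i _ => this i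
    _ = _ := by simp; field_simp

lemma measurable_comp_grid (k : ℕ) {β : Type*} [MeasurableSpace β] (h : EuclideanSpace ℝ (Fin n) → β) :
    Measurable (fun x => h (grid k x)) := by
  let z : EuclideanSpace ℝ (Fin n) → (Fin n → ℤ) := fun x i => ⌊(k:ℝ) * x i⌋
  have hz : Measurable z := by
    refine measurable_pi_lambda _ fun i => ?_
    exact Int.measurable_floor.comp (by fun_prop)
  let g : (Fin n → ℤ) → β := fun m => h (WithLp.toLp 2 (fun i => (m i : ℝ) / k))
  have hg : Measurable g := measurable_of_countable g
  exact hg.comp hz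

lemma volume_cell (k : ℕ) (hk : 1 ≤ k) (p : EuclideanSpace ℝ (Fin n))
    (hp : ∀ i, ∃ m : ℤ, p i = (m : ℝ) / (k : ℝ)) :
    volume.real {x : EuclideanSpace ℝ (Fin n) | grid k x = p} = ((k:ℝ) ^ n)⁻¹ := by
  have hk0 : (0:ℝ) < k := by exact_mod_cast hk
  have h1 : {x : EuclideanSpace ℝ (Fin n) | grid k x = p} =
      WithLp.ofLp ⁻¹' (Set.pi Set.univ fun i => Set.Ico (p i) (p i + 1 / k)) := by
    ext x
    simp only [Set.mem_setOf_eq, Set.mem_preimage, Set.mem_pi, Set.mem_univ, true_imp_iff, Set.mem_Ico]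
    rw [PiLp.ext_iff]
    refine forall_congr' fun i => ?_
    obtain ⟨m, hm⟩ := hp i
    simp only [grid, hm]
    rw [div_left_inj' hk0.ne', Int.cast_inj, Int.floor_eq_iff, div_le_iff₀ hk0, ← add_div, lt_div_iff₀ hk0,
      mul_comm]
  have hm : MeasurableSet (Set.pi Set.univ fun i : Fin n => Set.Ico (p i) (p i + 1 / (k:ℝ))) :=
    MeasurableSet.univ_pi fun _ => measurableSet_Ico
  rw [h1, Measure.real, (PiLp.volume_preserving_ofLp (Fin n)).measure_preimage hm.nullMeasurableSet, Real.volume_pi_Ico]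
  simp

lemma sum_eq_integral (k : ℕ) (hk : 1 ≤ k) (Δ : Set (EuclideanSpace ℝ (Fin n)))
    (Λ : Finset (EuclideanSpace ℝ (Fin n)))
    (hΛ : (Λ : Set (EuclideanSpace ℝ (Fin n))) = Δ ∩ {p | ∀ i, ∃ m : ℤ, p i = (m : ℝ) / (k : ℝ)})
    (h : EuclideanSpace ℝ (Fin n) → ℝ) (p₀ : EuclideanSpace ℝ (Fin n)) :
    (∑ p ∈ Λ, h p) / (k:ℝ) ^ n =
      ∫ q, (Real.sqrt k ^ n)⁻¹ * Δ.indicator h (grid k (p₀ + (Real.sqrt k)⁻¹ • q)) := by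
  have hk0 : (0:ℝ) < k := by exact_mod_cast hk
  have hs : 0 < Real.sqrt k := Real.sqrt_pos.2 hk0
  rw [integral_const_mul, Measure.integral_comp_smul volume (fun x => Δ.indicator h (grid k (p₀ + x))) (Real.sqrt k)⁻¹,
    integral_add_left_eq_self (fun x => Δ.indicator h (grid k x)) p₀]
  simp only [finrank_euclideanSpace, Fintype.card_fin, smul_eq_mul]
  rw [abs_of_pos (by positivity), inv_pow, inv_inv, inv_mul_cancel_left₀ (by positivity)]
  have hmemΛ : ∀ p, p ∈ Λ ↔ p ∈ Δ ∧ ∀ i, ∃ m : ℤ, p i = (m : ℝ) / (k : ℝ) := by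
    intro p; rw [← Finset.mem_coe, hΛ]; rfl
  have hfun : ∀ x, Δ.indicator h (grid k x) = ∑ p ∈ Λ, {x | grid k x = p}.indicator (fun _ => h p) x := by
    intro x
    by_cases hx : grid k x ∈ Δ
    · have hx' : grid k x ∈ Λ := (hmemΛ _).2 ⟨hx, fun i => ⟨⌊(k:ℝ) * x i⌋, rfl⟩⟩
      rw [Set.indicator_of_mem hx, Finset.sum_eq_single_of_mem _ hx']
      · simp
      · intro b _ hb
        rw [Set.indicator_of_notMem]; exact fun h => hb h.symm
    · rw [Set.indicator_of_notMem hx, Finset.sum_eq_zero]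
      intro p hp
      rw [Set.indicator_of_notMem]
      rintro rfl
      exact hx ((hmemΛ _).1 hp).1
  have hcm : ∀ p, MeasurableSet {x : EuclideanSpace ℝ (Fin n) | grid k x = p} := by
    intro p
    have := measurable_comp_grid (n := n) k (fun x => x)
    exact this (measurableSet_singleton p)
  simp only [hfun]
  rw [integral_finsetSum]
  · rw [Finset.sum_div]
    refine Finset.sum_congr rfl fun p hp => ?_
    rw [integral_indicator_const _ (hcm p), volume_cell k hk p ((hmemΛ p).1 hp).2, smul_eq_mul, div_eq_inv_mul]
  · intro p hp
    refine IntegrableOn.integrable_indicator ?_ (hcm p)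
    refine integrableOn_const ?_
    intro htop
    have := volume_cell k hk p ((hmemΛ p).1 hp).2
    rw [Measure.real, htop] at this
    have h2 : 0 < ((k:ℝ) ^ n)⁻¹ := by positivity
    simp at this
    rw [eq_comm] at this
    simp at this
    omega

lemma grid_scaled_norm (k : ℕ) (hk : 1 ≤ k) (p₀ q : EuclideanSpace ℝ (Fin n)) :
    ‖Real.sqrt k • (grid k (p₀ + (Real.sqrt k)⁻¹ • q) - p₀) - q‖ ^ 2 ≤ n / k := by
  have hk0 : (0:ℝ) < k := by exact_mod_cast hk
  have hs : 0 < Real.sqrt k := Real.sqrt_pos.2 hk0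
  have h1 : Real.sqrt k • (grid k (p₀ + (Real.sqrt k)⁻¹ • q) - p₀) - q =
      Real.sqrt k • (grid k (p₀ + (Real.sqrt k)⁻¹ • q) - (p₀ + (Real.sqrt k)⁻¹ • q)) := by
    simp only [smul_sub, smul_add, smul_smul, mul_inv_cancel₀ hs.ne', one_smul]; abel
  rw [h1, norm_smul, mul_pow, Real.norm_of_nonneg hs.le, Real.sq_sqrt hk0.le]
  have := norm_grid_sub_sq k hk (p₀ + (Real.sqrt k)⁻¹ • q)
  calc _ ≤ (k:ℝ) * (n / (k:ℝ) ^ 2) := by gcongr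
    _ = _ := by field_simp

lemma tendsto_grid_scaled (p₀ q : EuclideanSpace ℝ (Fin n)) :
    Tendsto (fun k : ℕ => Real.sqrt k • (grid k (p₀ + (Real.sqrt k)⁻¹ • q) - p₀)) atTop (nhds q) := by
  rw [tendsto_iff_norm_sub_tendsto_zero]
  have h1 : Tendsto (fun k : ℕ => Real.sqrt ((n:ℝ) / k)) atTop (nhds 0) := by
    have := (tendsto_const_div_atTop_nhds_zero_nat (n:ℝ)).sqrt
    simpa using this
  refine squeeze_zero' (Eventually.of_forall fun _ => norm_nonneg _) ?_ h1
  filter_upwards [eventually_ge_atTop 1] with k hk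
  exact Real.le_sqrt_of_sq_le (grid_scaled_norm k hk p₀ q)

lemma tendsto_grid (p₀ q : EuclideanSpace ℝ (Fin n)) :
    Tendsto (fun k : ℕ => grid k (p₀ + (Real.sqrt k)⁻¹ • q)) atTop (nhds p₀) := by
  have h1 := tendsto_grid_scaled p₀ q
  have h2 : Tendsto (fun k : ℕ => (Real.sqrt k)⁻¹) atTop (nhds 0) :=
    (Real.tendsto_sqrt_atTop.comp tendsto_natCast_atTop_atTop).inv_tendsto_atTop
  have h3 := (tendsto_const_nhds (x := p₀)).add (h2.smul h1)
  rw [zero_smul, add_zero] at h3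
  refine h3.congr' ?_
  filter_upwards [eventually_ge_atTop 1] with k hk
  have hk0 : (0:ℝ) < k := by exact_mod_cast hk
  have hs : 0 < Real.sqrt k := Real.sqrt_pos.2 hk0
  rw [smul_smul, inv_mul_cancel₀ hs.ne', one_smul]; abel

lemma riemann_tendsto (Δ : Set (EuclideanSpace ℝ (Fin n)))
    (Λ : ℕ → Finset (EuclideanSpace ℝ (Fin n)))
    (hΛ : ∀ k : ℕ, 1 ≤ k → ((Λ k : Set (EuclideanSpace ℝ (Fin n)))
      = Δ ∩ {p | ∀ i, ∃ m : ℤ, p i = (m : ℝ) / (k : ℝ)}))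
    (h : ℕ → EuclideanSpace ℝ (Fin n) → ℝ) (p₀ : EuclideanSpace ℝ (Fin n))
    (G : EuclideanSpace ℝ (Fin n) → ℝ) (C c : ℝ) (hc : 0 < c) (hC : 0 < C)
    (hpos : ∀ k p, 0 ≤ h k p)
    (hbd : ∀ k : ℕ, 1 ≤ k → ∀ p ∈ Δ, (Real.sqrt k ^ n)⁻¹ * h k p ≤ C * Real.exp (-c * ‖Real.sqrt k • (p - p₀)‖ ^ 2))
    (hlim : ∀ q, Tendsto (fun k : ℕ => (Real.sqrt k ^ n)⁻¹ *
      Δ.indicator (h k) (grid k (p₀ + (Real.sqrt k)⁻¹ • q))) atTop (nhds (G q))) :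
    Tendsto (fun k : ℕ => (∑ p ∈ Λ k, h k p) / (k:ℝ) ^ n) atTop (nhds (∫ q, G q)) := by
  have key : Tendsto (fun k : ℕ => ∫ q, (Real.sqrt k ^ n)⁻¹ *
      Δ.indicator (h k) (grid k (p₀ + (Real.sqrt k)⁻¹ • q))) atTop (nhds (∫ q, G q)) := by
    refine tendsto_integral_filter_of_dominated_convergence
      (fun q => C * Real.exp (c * n) * Real.exp (-(c / 2) * ‖q‖ ^ 2)) ?_ ?_ ?_ ?_
    · refine Eventually.of_forall fun k => ?_
      refine (Measurable.const_mul ?_ _).aestronglyMeasurable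
      exact (measurable_comp_grid k (Δ.indicator (h k))).comp (by fun_prop)
    · filter_upwards [eventually_ge_atTop 1] with k hk
      refine ae_of_all _ fun q => ?_
      set p := grid k (p₀ + (Real.sqrt k)⁻¹ • q) with hp
      rw [Real.norm_of_nonneg (mul_nonneg (by positivity) (Set.indicator_nonneg (fun _ _ => hpos k _) _))]
      by_cases hpΔ : p ∈ Δ
      · rw [Set.indicator_of_mem hpΔ]
        refine (hbd k hk p hpΔ).trans ?_
        rw [mul_assoc, ← Real.exp_add]
        gcongr
        have h1 := grid_scaled_norm k hk p₀ q
        rw [← hp] at h1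
        set y := Real.sqrt k • (p - p₀)
        have hk0 : (1:ℝ) ≤ k := by exact_mod_cast hk
        have h2 : (n:ℝ) / k ≤ n := div_le_self (by positivity) hk0
        have h3 : ‖q‖ ≤ ‖y - q‖ + ‖y‖ := by
          have := norm_sub_le y (y - q)
          simp at this; linarith
        have h4 : ‖q‖ ^ 2 ≤ 2 * ‖y - q‖ ^ 2 + 2 * ‖y‖ ^ 2 := by
          nlinarith [norm_nonneg q, norm_nonneg y, norm_nonneg (y - q), sq_nonneg (‖y - q‖ - ‖y‖)]
        nlinarith
      · rw [Set.indicator_of_notMem hpΔ, mul_zero]; positivity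
    · exact (integrable_gauss (by positivity)).const_mul _
    · exact ae_of_all _ hlim
  refine key.congr' ?_
  filter_upwards [eventually_ge_atTop 1] with k hk
  exact (sum_eq_integral k hk Δ (Λ k) (hΛ k hk) (h k) p₀).symm

end riemann

section local_analysis
variable {E : Type*} [NormedAddCommGroup E] [InnerProductSpace ℝ E] [FiniteDimensional ℝ E]
  [MeasurableSpace E] [BorelSpace E]

noncomputable def psi (φ : E → ℝ) (v w : E) : ℝ := φ w - φ v - ⟪gradient φ v, w - v⟫

noncomputable def JJ (φ d : E → ℝ) (v : E) (k : ℕ) (p : E) : ENNReal :=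
  ∫⁻ w, ENNReal.ofReal (Real.exp ((k:ℝ) * (⟪p, w - v⟫ - (φ w - φ v))) * d w)

lemma term_eq (φ d : E → ℝ) (hφ : Continuous φ) (hd : Continuous d) (hd0 : ∀ w, 0 < d w)
    (v : E) (k : ℕ) (p : E) :
    Real.exp ((k:ℝ) * (⟪p, v⟫ - φ v)) / (∫ w, Real.exp ((k : ℝ) * (⟪p, w⟫ - φ w)) * d w) =
      ((JJ φ d v k p)⁻¹).toReal := by
  have h1 : ∀ w, Real.exp ((k : ℝ) * (⟪p, w⟫ - φ w)) * d w = Real.exp ((k:ℝ) * (⟪p, v⟫ - φ v)) *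
      (Real.exp ((k:ℝ) * (⟪p, w - v⟫ - (φ w - φ v))) * d w) := by
    intro w
    rw [← mul_assoc, ← Real.exp_add]
    congr 2
    rw [inner_sub_right]; ring
  simp only [h1]
  rw [integral_const_mul, integral_eq_lintegral_of_nonneg_ae, ENNReal.toReal_inv, JJ]
  · have := (Real.exp_pos ((k:ℝ) * (⟪p, v⟫ - φ v))).ne'
    rw [div_mul_eq_div_div, div_self this, one_div]
  · exact ae_of_all _ fun w => mul_nonneg (Real.exp_pos _).le (hd0 w).le
  · exact Continuous.aestronglyMeasurable (by fun_prop)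

lemma JJ_scale (φ d : E → ℝ) (hφ : Continuous φ) (hd : Continuous d)
    (v : E) (k : ℕ) (hk : 1 ≤ k) (p : E) :
    ENNReal.ofReal (Real.sqrt k ^ (Module.finrank ℝ E)) * JJ φ d v k p =
      ∫⁻ u, ENNReal.ofReal (Real.exp (⟪Real.sqrt k • (p - gradient φ v), u⟫ -
        k * psi φ v (v + (Real.sqrt k)⁻¹ • u)) * d (v + (Real.sqrt k)⁻¹ • u)) := by
  have hk0 : (0:ℝ) < k := by exact_mod_cast hk
  have hs : 0 < Real.sqrt k := Real.sqrt_pos.2 hk0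
  let L : E →L[ℝ] E := (Real.sqrt k)⁻¹ • ContinuousLinearMap.id ℝ E
  have hL : L.det = (Real.sqrt k ^ (Module.finrank ℝ E))⁻¹ := by
    simp [L, ContinuousLinearMap.det]
  have hL0 : 0 < L.det := by rw [hL]; positivity
  unfold JJ
  rw [← lintegral_add_left_eq_self _ v, ← lintegral_comp_clm L hL0.ne' _ (by fun_prop), abs_of_pos hL0, hL, ← mul_assoc,
    ← ENNReal.ofReal_mul (by positivity), mul_inv_cancel₀ (by positivity), ENNReal.ofReal_one, one_mul]
  refine lintegral_congr fun u => ?_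
  have : L u = (Real.sqrt k)⁻¹ • u := by simp [L]
  rw [this]
  congr 3
  simp only [psi, add_sub_cancel_left, inner_smul_left, inner_smul_right, inner_sub_left, conj_trivial]
  have : (k:ℝ) = Real.sqrt k * Real.sqrt k := (Real.mul_self_sqrt hk0.le).symm
  generalize Real.sqrt k = s at *
  rw [this]
  field_simp
  ring

lemma taylor2 (φ : E → ℝ) (hφ : ContDiff ℝ 2 φ) (v : E) (ε : ℝ) (hε : 0 < ε) :
    ∃ δ > 0, ∀ u, ‖u‖ ≤ δ → |psi φ v (v + u) - 1/2 * ⟪fderiv ℝ (gradient φ) v u, u⟫| ≤ ε * ‖u‖ ^ 2 := by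
  set H := fderiv ℝ (gradient φ) v with hH
  have hg : DifferentiableAt ℝ (gradient φ) v := (contDiff_gradient hφ).differentiable (by norm_num) v
  have h1 := hg.hasFDerivAt.isLittleO.def hε
  rw [Metric.eventually_nhds_iff_ball] at h1
  obtain ⟨δ, hδ, h2⟩ := h1
  refine ⟨δ / 2, by positivity, fun u hu => ?_⟩
  have hgrad : ∀ w, HasFDerivAt φ (innerSL ℝ (gradient φ w)) w := fun w => by
    have := (hφ.differentiable (by norm_num) w).hasGradientAt
    rw [hasGradientAt_iff_hasFDerivAt] at this
    exact this
  let f : ℝ → ℝ := fun t => psi φ v (v + t • u) - t ^ 2 / 2 * ⟪H u, u⟫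
  have hf : ∀ t, HasDerivAt f (⟪gradient φ (v + t • u) - gradient φ v - t • H u, u⟫) t := by
    intro t
    have hl : HasDerivAt (fun t : ℝ => v + t • u) u t := by
      simpa using ((hasDerivAt_id t).smul_const u).const_add v
    have ha : HasDerivAt (fun t : ℝ => φ (v + t • u)) ⟪gradient φ (v + t • u), u⟫ t := by
      exact (hgrad (v + t • u)).comp_hasDerivAt t hl
    have hb : HasDerivAt (fun t : ℝ => t * ⟪gradient φ v, u⟫) ⟪gradient φ v, u⟫ t := by
      simpa using (hasDerivAt_id t).mul_const ⟪gradient φ v, u⟫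
    have hc : HasDerivAt (fun t : ℝ => t ^ 2 / 2 * ⟪H u, u⟫) (t * ⟪H u, u⟫) t := by
      have := ((hasDerivAt_pow 2 t).div_const 2).mul_const ⟪H u, u⟫
      refine this.congr_deriv ?_
      norm_num
    have := ((ha.sub_const (φ v)).sub hb).sub hc
    have hfe : f = ((fun x : ℝ => φ (v + x • u) - φ v) - fun t => t * ⟪gradient φ v, u⟫) - fun t => t ^ 2 / 2 * ⟪H u, u⟫ := by
      funext s
      simp only [f, psi, Pi.sub_apply, add_sub_cancel_left, inner_smul_right]
    rw [hfe]
    refine this.congr_deriv ?_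
    simp only [inner_sub_left, inner_smul_left, conj_trivial]
  have hbound : ∀ t ∈ Set.Icc (0:ℝ) 1, ‖⟪gradient φ (v + t • u) - gradient φ v - t • H u, u⟫‖ ≤ ε * ‖u‖ ^ 2 := by
    intro t ht
    have hmem : v + t • u ∈ Metric.ball v δ := by
      simp only [Metric.mem_ball, dist_self_add_left, norm_smul, Real.norm_of_nonneg ht.1]
      have := mul_le_mul ht.2 hu (norm_nonneg _) zero_le_one
      linarith
    have h3 := h2 _ hmem
    simp only [add_sub_cancel_left, map_smul, norm_smul, Real.norm_of_nonneg ht.1] at h3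
    refine (norm_inner_le_norm _ _).trans ?_
    calc _ ≤ ε * (t * ‖u‖) * ‖u‖ := by gcongr
      _ ≤ ε * (1 * ‖u‖) * ‖u‖ := by gcongr; exact ht.2
      _ = _ := by ring
  have := norm_image_sub_le_of_norm_deriv_le_segment_01' (f := f) (fun t _ => (hf t).hasDerivWithinAt)
    (fun t ht => hbound t ⟨ht.1, ht.2.le⟩)
  simpa [f, psi] using this

lemma tendsto_sqrt_inv : Tendsto (fun k : ℕ => (Real.sqrt k)⁻¹) atTop (nhds 0) :=
    (Real.tendsto_sqrt_atTop.comp tendsto_natCast_atTop_atTop).inv_tendsto_atTop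

lemma tendsto_scaled_psi (φ : E → ℝ) (hφ : ContDiff ℝ 2 φ) (v u : E) :
    Tendsto (fun k : ℕ => (k:ℝ) * psi φ v (v + (Real.sqrt k)⁻¹ • u)) atTop
      (nhds (1/2 * ⟪fderiv ℝ (gradient φ) v u, u⟫)) := by
  rw [Metric.tendsto_atTop']
  intro ε hε
  obtain ⟨δ, hδ, h⟩ := taylor2 φ hφ v (ε / (‖u‖ ^ 2 + 1)) (by positivity)
  have h1 : Tendsto (fun k : ℕ => ‖(Real.sqrt k)⁻¹ • u‖) atTop (nhds 0) := by
    have := (tendsto_sqrt_inv.smul_const u).norm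
    simpa using this
  have h2 := (h1.eventually (gt_mem_nhds hδ)).and (eventually_ge_atTop 1)
  obtain ⟨N, hN⟩ := eventually_atTop.1 h2
  refine ⟨N, fun k hk => ?_⟩
  obtain ⟨h3, h4⟩ := hN k hk.le
  have hk0 : (0:ℝ) < k := by exact_mod_cast h4
  have hs : 0 < Real.sqrt k := Real.sqrt_pos.2 hk0
  have hss : Real.sqrt k ^ 2 = k := Real.sq_sqrt hk0.le
  have h5 := h _ h3.le
  rw [Real.dist_eq]
  simp only [map_smul, inner_smul_left, inner_smul_right, conj_trivial, norm_smul, mul_pow, norm_inv, Real.norm_of_nonneg hs.le, inv_pow, hss] at h5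
  have h6 : (k:ℝ) * psi φ v (v + (Real.sqrt k)⁻¹ • u) - 1/2 * ⟪fderiv ℝ (gradient φ) v u, u⟫ = 
    k * (psi φ v (v + (Real.sqrt k)⁻¹ • u) - 1 / 2 * ((Real.sqrt k)⁻¹ * ((Real.sqrt k)⁻¹ * ⟪fderiv ℝ (gradient φ) v u, u⟫))) := by
    have : (Real.sqrt k)⁻¹ * (Real.sqrt k)⁻¹ = (k:ℝ)⁻¹ := by
      rw [← mul_inv, ← sq, hss]
    rw [mul_sub, ← mul_assoc (Real.sqrt k)⁻¹, this]
    field_simp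
  rw [h6, abs_mul, abs_of_pos hk0]
  calc _ ≤ (k:ℝ) * (ε / (‖u‖ ^ 2 + 1) * ((k:ℝ)⁻¹ * ‖u‖ ^ 2)) := by gcongr
    _ = ε * (‖u‖ ^ 2 / (‖u‖ ^ 2 + 1)) := by field_simp
    _ < ε * 1 := by
      gcongr
      rw [div_lt_one (by positivity)]; linarith
    _ = ε := mul_one _

/-- pointwise convergence of scaled integrands -/
lemma tendsto_integrand (φ d : E → ℝ) (hφ : ContDiff ℝ 2 φ) (hd : Continuous d) (v u : E)
    (p : ℕ → E) (q : E) (hp : Tendsto (fun k : ℕ => Real.sqrt k • (p k - gradient φ v)) atTop (nhds q)) :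
    Tendsto (fun k : ℕ => ENNReal.ofReal (Real.exp (⟪Real.sqrt k • (p k - gradient φ v), u⟫ -
        k * psi φ v (v + (Real.sqrt k)⁻¹ • u)) * d (v + (Real.sqrt k)⁻¹ • u))) atTop
      (nhds (ENNReal.ofReal (Real.exp (⟪q, u⟫ - (1/2) * ⟪fderiv ℝ (gradient φ) v u, u⟫) * d v))) := by
  refine ENNReal.tendsto_ofReal ?_
  refine Tendsto.mul ?_ ?_
  · refine (Real.continuous_exp.tendsto _).comp ?_
    exact (hp.inner tendsto_const_nhds).sub (tendsto_scaled_psi φ hφ v u)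
  · have : Tendsto (fun k : ℕ => v + (Real.sqrt k)⁻¹ • u) atTop (nhds v) := by
      simpa using (tendsto_const_nhds (x := v)).add (tendsto_sqrt_inv.smul_const u)
    exact (hd.tendsto v).comp this

lemma continuous_psi (φ : E → ℝ) (hφ : Continuous φ) (v : E) : Continuous (psi φ v) := by
  unfold psi; fun_prop

lemma fatou_top (φ d : E → ℝ) (hφ : ContDiff ℝ 2 φ) (hd : Continuous d) (v : E)
    (p : ℕ → E) (q : E) (hp : Tendsto (fun k : ℕ => Real.sqrt k • (p k - gradient φ v)) atTop (nhds q))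
    (htop : gaussI (fderiv ℝ (gradient φ) v) (d v) q = ⊤) :
    Tendsto (fun k : ℕ => ENNReal.ofReal (Real.sqrt k ^ (Module.finrank ℝ E)) * JJ φ d v k (p k)) atTop (nhds ⊤) := by
  have hc := continuous_psi φ hφ.continuous v
  have h1 : ⊤ ≤ liminf (fun k : ℕ => ENNReal.ofReal (Real.sqrt k ^ (Module.finrank ℝ E)) * JJ φ d v k (p k)) atTop := by
    rw [← htop, gaussI]
    have h2 := lintegral_liminf_le (μ := (volume : Measure E)) (u := atTop) (f := fun (k:ℕ) (u : E) => ENNReal.ofReal (Real.exp (⟪Real.sqrt k • (p k - gradient φ v), u⟫ -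
        k * psi φ v (v + (Real.sqrt k)⁻¹ • u)) * d (v + (Real.sqrt k)⁻¹ • u))) (fun k => by fun_prop)
    simp only [fun u => (tendsto_integrand φ d hφ hd v u p q hp).liminf_eq] at h2
    refine h2.trans_eq (liminf_congr ?_)
    filter_upwards [eventually_ge_atTop 1] with k hk
    exact (JJ_scale φ d hφ.continuous hd v k hk (p k)).symm
  exact tendsto_of_le_liminf_of_limsup_le h1 le_top

lemma psi_le_quad (φ : E → ℝ) (hφ : ContDiff ℝ 2 φ) (v : E) (R : ℝ) :
    ∃ M : ℝ, 1 ≤ M ∧ ∀ u, ‖u‖ ≤ R → psi φ v (v + u) ≤ M * ‖u‖ ^ 2 := by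
  obtain ⟨δ, hδ, h⟩ := taylor2 φ hφ v 1 one_pos
  set H := fderiv ℝ (gradient φ) v
  have hc := continuous_psi φ hφ.continuous v
  obtain ⟨B, hB⟩ := (isCompact_closedBall (0:E) R).bddAbove_image (f := fun u => psi φ v (v + u)) (by fun_prop)
  refine ⟨max 1 (max (1 + ‖H‖) (|B| / δ ^ 2)), le_max_left _ _, fun u hu => ?_⟩
  by_cases hu' : ‖u‖ ≤ δ
  · have h1 := (abs_le.1 (h u hu')).2
    have h2 : ⟪H u, u⟫ ≤ ‖H‖ * ‖u‖ ^ 2 := by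
      refine (real_inner_le_norm _ _).trans ?_
      rw [sq, ← mul_assoc]; gcongr; exact H.le_opNorm u
    have h3 : (1 + ‖H‖) * ‖u‖ ^ 2 ≤ max 1 (max (1 + ‖H‖) (|B| / δ ^ 2)) * ‖u‖ ^ 2 := by
      gcongr; exact (le_max_left _ _).trans (le_max_right _ _)
    have : 0 ≤ ‖H‖ * ‖u‖ ^ 2 := by positivity
    linarith
  · push Not at hu'
    have h1 : psi φ v (v + u) ≤ B := hB ⟨u, by simpa using hu, rfl⟩
    calc _ ≤ |B| := h1.trans (le_abs_self _)
      _ = |B| / δ ^ 2 * δ ^ 2 := by field_simp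
      _ ≤ |B| / δ ^ 2 * ‖u‖ ^ 2 := by gcongr
      _ ≤ _ := by gcongr; exact (le_max_right _ _).trans (le_max_right _ _)

lemma gaussian_bound (φ d : E → ℝ) (hφ : ContDiff ℝ 2 φ) (hd : Continuous d) (hd0 : ∀ w, 0 < d w) (v : E)
    (Δ : Set E) (hΔ : Bornology.IsBounded Δ) :
    ∃ C c : ℝ, 0 < C ∧ 0 < c ∧ ∀ k : ℕ, 1 ≤ k → ∀ p ∈ Δ,
      (Real.sqrt k ^ (Module.finrank ℝ E))⁻¹ * ((JJ φ d v k p)⁻¹).toReal ≤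
        C * Real.exp (-c * ‖Real.sqrt k • (p - gradient φ v)‖ ^ 2) := by
  obtain ⟨r, hr⟩ := hΔ.subset_closedBall (gradient φ v)
  obtain ⟨M, hM1, hM⟩ := psi_le_quad φ hφ v (|r| + 1)
  obtain ⟨w₁, hw₁, hmin⟩ := (isCompact_closedBall v (|r| + 1)).exists_isMinOn ⟨v, by simp; positivity⟩ hd.continuousOn
  have hd1 := hd0 w₁
  have hM0 : 0 < M := by linarith
  set V := volume.real (Metric.closedBall (0:E) 1) with hV
  have hV0 : 0 < V := by
    have := Metric.measure_closedBall_pos (volume : Measure E) 0 one_pos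
    exact ENNReal.toReal_pos this.ne' measure_closedBall_lt_top.ne
  refine ⟨(Real.exp (-M) * d w₁ * V)⁻¹, 1 / (4 * M), by positivity, by positivity, fun k hk p hp => ?_⟩
  have hk0 : (0:ℝ) < k := by exact_mod_cast hk
  have hk1 : (1:ℝ) ≤ k := by exact_mod_cast hk
  have hs : 0 < Real.sqrt k := Real.sqrt_pos.2 hk0
  have hs1 : 1 ≤ Real.sqrt k := Real.one_le_sqrt.2 hk1
  set q := Real.sqrt k • (p - gradient φ v) with hq
  have hqn : ‖q‖ ≤ Real.sqrt k * |r| := by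
    rw [hq, norm_smul, Real.norm_of_nonneg hs.le]
    gcongr
    have := hr hp
    rw [Metric.mem_closedBall, dist_eq_norm] at this
    exact this.trans (le_abs_self r)
  have key : ENNReal.ofReal (Real.exp (1 / (4 * M) * ‖q‖ ^ 2) * (Real.exp (-M) * d w₁ * V)) ≤
      ENNReal.ofReal (Real.sqrt k ^ (Module.finrank ℝ E)) * JJ φ d v k p := by
    rw [JJ_scale φ d hφ.continuous hd v k hk p, ← hq]
    clear_value q
    set u₁ := (1 / (2 * M)) • q with hu₁
    have hvol : ENNReal.ofReal V = volume (Metric.closedBall u₁ 1) := by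
      rw [hV, ← Measure.addHaar_real_closedBall_center volume u₁]
      exact ENNReal.ofReal_toReal measure_closedBall_lt_top.ne
    rw [show Real.exp (1 / (4 * M) * ‖q‖ ^ 2) * (Real.exp (-M) * d w₁ * V) = 
      (Real.exp (1 / (4 * M) * ‖q‖ ^ 2 - M) * d w₁) * V by rw [Real.exp_sub, Real.exp_neg]; ring,
      ENNReal.ofReal_mul (by positivity), hvol, ← setLIntegral_const]
    refine (setLIntegral_mono' measurableSet_closedBall fun u hu => ?_).trans (setLIntegral_le_lintegral _ _)
    have hy : ‖u - u₁‖ ≤ 1 := by rwa [Metric.mem_closedBall, dist_eq_norm] at hu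
    have hu1n : ‖u₁‖ ≤ ‖q‖ := by
      rw [hu₁, norm_smul, Real.norm_of_nonneg (by positivity)]
      refine mul_le_of_le_one_left (norm_nonneg _) ?_
      rw [div_le_one (by positivity)]; linarith
    have hun : ‖u‖ ≤ Real.sqrt k * (|r| + 1) := by
      have := norm_add_le (u - u₁) u₁
      rw [sub_add_cancel] at this
      linarith
    have hsm : ‖(Real.sqrt k)⁻¹ • u‖ ≤ |r| + 1 := by
      rw [norm_smul, norm_inv, Real.norm_of_nonneg hs.le, inv_mul_le_iff₀ hs]; exact hun
    have hdd : d w₁ ≤ d (v + (Real.sqrt k)⁻¹ • u) := hmin (by simpa using hsm)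
    have hpsi := hM _ hsm
    refine ENNReal.ofReal_le_ofReal ?_
    refine mul_le_mul (Real.exp_le_exp.2 ?_) hdd hd1.le (Real.exp_pos _).le
    have h1 : (k:ℝ) * psi φ v (v + (Real.sqrt k)⁻¹ • u) ≤ M * ‖u‖ ^ 2 := by
      calc _ ≤ (k:ℝ) * (M * ‖(Real.sqrt k)⁻¹ • u‖ ^ 2) := by gcongr
        _ = M * ‖u‖ ^ 2 := by
          rw [norm_smul, mul_pow, norm_inv, inv_pow, Real.norm_of_nonneg hs.le, Real.sq_sqrt hk0.le]
          field_simp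
    have h2 : ⟪q, u⟫ - M * ‖u‖ ^ 2 = 1 / (4 * M) * ‖q‖ ^ 2 - M * ‖u - u₁‖ ^ 2 := by
      rw [norm_sub_sq_real, hu₁, inner_smul_right, norm_smul, mul_pow, Real.norm_of_nonneg (by positivity : 0 ≤ 1 / (2 * M)),
        real_inner_comm]
      field_simp
      ring
    have h3 : M * ‖u - u₁‖ ^ 2 ≤ M := by
      have : ‖u - u₁‖ ^ 2 ≤ 1 := by
        have := norm_nonneg (u - u₁); nlinarith
      nlinarith
    linarith
  have hX : (Real.sqrt k ^ (Module.finrank ℝ E))⁻¹ * ((JJ φ d v k p)⁻¹).toReal =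
      ((ENNReal.ofReal (Real.sqrt k ^ (Module.finrank ℝ E)) * JJ φ d v k p)⁻¹).toReal := by
    rw [ENNReal.toReal_inv, ENNReal.toReal_inv, ENNReal.toReal_mul, ENNReal.toReal_ofReal (by positivity), mul_inv]
  rw [hX]
  have h2 := ENNReal.inv_le_inv.2 key
  have hpos : 0 < Real.exp (1 / (4 * M) * ‖q‖ ^ 2) * (Real.exp (-M) * d w₁ * V) := by positivity
  rw [← ENNReal.ofReal_inv_of_pos hpos] at h2
  refine (ENNReal.toReal_mono ENNReal.ofReal_ne_top h2).trans_eq ?_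
  rw [ENNReal.toReal_ofReal (by positivity), mul_inv, mul_comm, neg_mul, Real.exp_neg (1 / (4 * M) * ‖q‖ ^ 2)]

lemma neg_top (φ d : E → ℝ) (hφ : Continuous φ) (hd : Continuous d) (hd0 : ∀ w, 0 < d w) (v w₀ : E)
    (hw : psi φ v w₀ < 0)
    (p : ℕ → E) (hp : Tendsto p atTop (nhds (gradient φ v))) :
    Tendsto (fun k : ℕ => ENNReal.ofReal (Real.sqrt k ^ (Module.finrank ℝ E)) * JJ φ d v k (p k)) atTop (nhds ⊤) := by
  let F : E × E → ℝ := fun z => ⟪z.1, z.2 - v⟫ - (φ z.2 - φ v)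
  have hF : Continuous F := by fun_prop
  have hF0 : 0 < F (gradient φ v, w₀) := by simp only [F]; unfold psi at hw; linarith
  obtain ⟨c, hc0, hc⟩ := exists_between hF0
  have h1 : ∀ᶠ z in nhds (gradient φ v, w₀), c < F z := hF.continuousAt.eventually (lt_mem_nhds hc)
  rw [nhds_prod_eq] at h1
  obtain ⟨P, hP, Q, hQ, hPQ⟩ := eventually_prod_iff.1 h1
  have h2 : ∀ᶠ w in nhds w₀, d w₀ / 2 < d w := hd.continuousAt.eventually (lt_mem_nhds (by linarith [hd0 w₀]))
  obtain ⟨ρ, hρ, hball⟩ := Metric.eventually_nhds_iff_ball.1 (hQ.and h2)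
  set a := ENNReal.ofReal (d w₀ / 2) * volume (Metric.ball w₀ ρ) with ha
  have ha0 : a ≠ 0 := mul_ne_zero (by simpa using hd0 w₀) (Metric.measure_ball_pos _ _ hρ).ne'
  have hlow : ∀ᶠ k : ℕ in atTop, ENNReal.ofReal (Real.exp (k * c)) * a ≤ 
      ENNReal.ofReal (Real.sqrt k ^ (Module.finrank ℝ E)) * JJ φ d v k (p k) := by
    filter_upwards [eventually_ge_atTop 1, hp.eventually hP] with k hk hPk
    have hk1 : (1:ℝ) ≤ k := by exact_mod_cast hk
    have hs1 : 1 ≤ Real.sqrt k := Real.one_le_sqrt.2 hk1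
    have h3 : (1:ENNReal) ≤ ENNReal.ofReal (Real.sqrt k ^ (Module.finrank ℝ E)) := by
      rw [ENNReal.one_le_ofReal]; exact one_le_pow₀ hs1
    refine le_trans ?_ (le_mul_of_one_le_left (zero_le) h3)
    rw [ha, ← mul_assoc, ← ENNReal.ofReal_mul (Real.exp_pos _).le, ← setLIntegral_const]
    refine (setLIntegral_mono' measurableSet_ball fun w hw => ?_).trans (setLIntegral_le_lintegral _ _)
    obtain ⟨h4, h5⟩ := hball w hw
    have h6 := hPQ hPk h4
    refine ENNReal.ofReal_le_ofReal ?_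
    have := (hd0 w₀)
    gcongr
  refine tendsto_nhds_top_mono ?_ hlow
  have h7 : Tendsto (fun k : ℕ => ENNReal.ofReal (Real.exp (k * c))) atTop (nhds ⊤) := by
    refine ENNReal.tendsto_ofReal_atTop.comp (Real.tendsto_exp_atTop.comp ?_)
    exact tendsto_natCast_atTop_atTop.atTop_mul_const hc0
  have := ENNReal.Tendsto.mul_const (b := a) h7 (Or.inl ENNReal.top_ne_zero)
  rwa [ENNReal.top_mul ha0] at this

end local_analysis

section growth
variable {E : Type*} [NormedAddCommGroup E] [InnerProductSpace ℝ E] [FiniteDimensional ℝ E]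
  [MeasurableSpace E] [BorelSpace E]

lemma integrable_exp_neg_norm : Integrable (fun u : E => Real.exp (-‖u‖)) := by
  set m := Module.finrank ℝ E + 1 with hm
  have h1 := integrable_one_add_norm (E := E) (μ := volume) (r := (m:ℝ)) (by rw [hm]; push_cast; linarith)
  have h2 := h1.const_mul (Real.exp 1 * (m.factorial : ℝ))
  refine h2.mono' (by fun_prop) (ae_of_all _ fun u => ?_)
  rw [Real.norm_of_nonneg (Real.exp_pos _).le, Real.rpow_neg (by positivity), Real.rpow_natCast]
  have h3 := Real.pow_div_factorial_le_exp (1 + ‖u‖) (by positivity) m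
  rw [div_le_iff₀ (by positivity)] at h3
  rw [Real.exp_neg, inv_le_iff_one_le_mul₀ (Real.exp_pos _)]
  have h4 : 0 < (1 + ‖u‖) ^ m := by positivity
  rw [Real.exp_add] at h3
  rw [mul_assoc, mul_comm, mul_assoc, ]
  field_simp
  linarith

lemma growth (φ : E → ℝ) (hφ : ContDiff ℝ 2 φ) (v : E)
    (hpd : ∀ u ≠ 0, 0 < ⟪fderiv ℝ (gradient φ) v u, u⟫)
    (hpos : ∀ w, w ≠ v → 0 < psi φ v w) (r C : ℝ) (hr : 0 < r)
    (hco : ∀ u, r * ‖u‖ - C ≤ psi φ v (v + u)) :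
    ∃ c δ : ℝ, 0 < c ∧ 0 < δ ∧ (∀ u, ‖u‖ ≤ δ → c * ‖u‖ ^ 2 ≤ psi φ v (v + u)) ∧
      (∀ u, δ ≤ ‖u‖ → c * ‖u‖ ≤ psi φ v (v + u)) := by
  set H := fderiv ℝ (gradient φ) v
  obtain ⟨m, hm0, hm⟩ := (isCompact_sphere (0:E) 1).exists_forall_le' (f := fun u => ⟪H u, u⟫) (a := 0)
    (by fun_prop) (fun u hu => hpd u (by rintro rfl; simp at hu))
  have hm' : ∀ u, m * ‖u‖ ^ 2 ≤ ⟪H u, u⟫ := by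
    intro u
    by_cases hu : u = 0
    · simp [hu]
    have hn : 0 < ‖u‖ := norm_pos_iff.2 hu
    have := hm (‖u‖⁻¹ • u) (by simp [norm_smul, hn.ne'])
    simp only [map_smul, inner_smul_left, inner_smul_right, conj_trivial] at this
    rw [← mul_assoc, ← mul_inv, ← sq, ← div_eq_inv_mul, le_div_iff₀ (by positivity)] at this
    exact this
  obtain ⟨δ, hδ, ht⟩ := taylor2 φ hφ v (m / 4) (by positivity)
  set R := max δ (2 * C / r) with hR
  have hR0 : 0 < R := lt_max_of_lt_left hδ
  have hcont := continuous_psi φ hφ.continuous v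
  obtain ⟨m2, hm20, hm2⟩ := ((isCompact_closedBall (0:E) R).inter_right 
    (isClosed_le (continuous_const (y := δ)) continuous_norm)).exists_forall_le' (f := fun u => psi φ v (v + u)) (a := 0)
    (by fun_prop) (fun u hu => hpos _ (by
      intro h
      have : u = 0 := by simpa using h
      subst this
      have := hu.2
      simp at this; linarith))
  refine ⟨min (m/4) (min (r / 2) (m2 / R)), δ, by positivity, hδ, fun u hu => ?_, fun u hu => ?_⟩
  · have h1 := (abs_le.1 (ht u hu)).1
    have h2 := hm' u
    have h3 : min (m/4) (min (r / 2) (m2 / R)) * ‖u‖ ^ 2 ≤ m / 4 * ‖u‖ ^ 2 := by gcongr; exact min_le_left _ _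
    linarith
  · by_cases hu2 : ‖u‖ ≤ R
    · have h1 : m2 ≤ psi φ v (v + u) := hm2 u ⟨by simpa using hu2, hu⟩
      calc _ ≤ m2 / R * R := by
            gcongr
            exact (min_le_right _ _).trans (min_le_right _ _)
        _ = m2 := by field_simp
        _ ≤ _ := h1
    · push Not at hu2
      have h1 : 2 * C / r ≤ ‖u‖ := (le_max_right _ _).trans hu2.le
      rw [div_le_iff₀ hr] at h1
      have h2 := hco u
      have h3 : min (m/4) (min (r / 2) (m2 / R)) * ‖u‖ ≤ r / 2 * ‖u‖ := by
        gcongr; exact (min_le_right _ _).trans (min_le_left _ _)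
      linarith

lemma dct_case (φ d : E → ℝ) (hφ : ContDiff ℝ 2 φ) (hd : Continuous d) (hd0 : ∀ w, 0 < d w) (Dm : ℝ)
    (hDm : ∀ w, d w ≤ Dm) (v : E) (c δ : ℝ) (hc : 0 < c)
    (hg1 : ∀ u, ‖u‖ ≤ δ → c * ‖u‖ ^ 2 ≤ psi φ v (v + u))
    (hg2 : ∀ u, δ ≤ ‖u‖ → c * ‖u‖ ≤ psi φ v (v + u))
    (p : ℕ → E) (q : E) (hp : Tendsto (fun k : ℕ => Real.sqrt k • (p k - gradient φ v)) atTop (nhds q)) :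
    Tendsto (fun k : ℕ => ENNReal.ofReal (Real.sqrt k ^ (Module.finrank ℝ E)) * JJ φ d v k (p k)) atTop
      (nhds (gaussI (fderiv ℝ (gradient φ) v) (d v) q)) := by
  have hcont := continuous_psi φ hφ.continuous v
  set Q := ‖q‖ + 1 with hQ
  have hQ0 : 0 < Q := by positivity
  have hDm0 : 0 < Dm := (hd0 v).trans_le (hDm v)
  have hev1 : ∀ᶠ k : ℕ in atTop, ‖Real.sqrt k • (p k - gradient φ v)‖ ≤ Q := by
    filter_upwards [hp.norm.eventually (gt_mem_nhds (show ‖q‖ < Q by linarith))] with k hk using hk.le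
  have hev2 : ∀ᶠ k : ℕ in atTop, (Q + 1) / c ≤ Real.sqrt k :=
    (Real.tendsto_sqrt_atTop.comp tendsto_natCast_atTop_atTop).eventually_ge_atTop _
  set C := (Q + 1) ^ 2 / (4 * c) with hC
  have hC0 : 0 ≤ C := by positivity
  have key := tendsto_lintegral_filter_of_dominated_convergence (μ := (volume : Measure E)) (l := (atTop : Filter ℕ))
    (F := fun (k:ℕ) (u : E) => ENNReal.ofReal (Real.exp (⟪Real.sqrt k • (p k - gradient φ v), u⟫ -
        k * psi φ v (v + (Real.sqrt k)⁻¹ • u)) * d (v + (Real.sqrt k)⁻¹ • u)))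
    (f := fun u => ENNReal.ofReal (Real.exp (⟪q, u⟫ - (1/2) * ⟪fderiv ℝ (gradient φ) v u, u⟫) * d v))
    (fun u => ENNReal.ofReal (Real.exp C * Dm * Real.exp (-‖u‖))) (Eventually.of_forall fun k => by fun_prop)
    ?_ ?_ (ae_of_all _ fun u => tendsto_integrand φ d hφ hd v u p q hp)
  · refine key.congr' ?_
    filter_upwards [eventually_ge_atTop 1] with k hk
    exact (JJ_scale φ d hφ.continuous hd v k hk (p k)).symm
  · filter_upwards [hev1, hev2, eventually_ge_atTop 1] with k h1 h2 hk
    have hk0 : (0:ℝ) < k := by exact_mod_cast hk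
    have hs : 0 < Real.sqrt k := Real.sqrt_pos.2 hk0
    have hss : Real.sqrt k ^ 2 = k := Real.sq_sqrt hk0.le
    refine ae_of_all _ fun u => ENNReal.ofReal_le_ofReal ?_
    have e1 : ⟪Real.sqrt k • (p k - gradient φ v), u⟫ ≤ Q * ‖u‖ :=
      (real_inner_le_norm _ _).trans (by gcongr)
    have hn : ‖(Real.sqrt k)⁻¹ • u‖ = (Real.sqrt k)⁻¹ * ‖u‖ := by
      rw [norm_smul, norm_inv, Real.norm_of_nonneg hs.le]
    have e2 : ⟪Real.sqrt k • (p k - gradient φ v), u⟫ - k * psi φ v (v + (Real.sqrt k)⁻¹ • u) ≤ C + -‖u‖ := by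
      rcases le_total ‖(Real.sqrt k)⁻¹ • u‖ δ with h | h
      · have h3 := mul_le_mul_of_nonneg_left (hg1 _ h) hk0.le
        rw [hn, mul_pow, inv_pow, hss] at h3
        have h4 : (k:ℝ) * (c * ((k:ℝ)⁻¹ * ‖u‖ ^ 2)) = c * ‖u‖ ^ 2 := by field_simp
        have h5 : C - (Q + 1) * ‖u‖ + c * ‖u‖ ^ 2 = (Q + 1 - 2 * c * ‖u‖) ^ 2 / (4 * c) := by
          rw [hC]; field_simp; ring
        have h6 : 0 ≤ (Q + 1 - 2 * c * ‖u‖) ^ 2 / (4 * c) := by positivity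
        linarith
      · have h3 := mul_le_mul_of_nonneg_left (hg2 _ h) hk0.le
        rw [hn] at h3
        have h4 : (k:ℝ) * (c * ((Real.sqrt k)⁻¹ * ‖u‖)) = (c * Real.sqrt k) * ‖u‖ := by
          nth_rewrite 1 [← hss]; field_simp
        have h5 : Q + 1 ≤ c * Real.sqrt k := by
          rw [div_le_iff₀ hc] at h2; linarith
        have h6 := mul_le_mul_of_nonneg_right h5 (norm_nonneg u)
        linarith
    calc _ ≤ Real.exp (C + -‖u‖) * Dm := by
          refine mul_le_mul (Real.exp_le_exp.2 e2) (hDm _) (hd0 _).le (Real.exp_pos _).le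
      _ = _ := by rw [Real.exp_add]; ring
  · exact (integrable_exp_neg_norm.const_mul (Real.exp C * Dm)).lintegral_lt_top.ne

end growth

section contact

lemma convexOn_affine {E : Type*} [NormedAddCommGroup E] [InnerProductSpace ℝ E] (a : E) (b : ℝ) :
    ConvexOn ℝ Set.univ (fun w : E => ⟪a, w⟫ + b) := by
  refine ⟨convex_univ, fun x _ y _ s t hs ht hst => le_of_eq ?_⟩
  simp only [inner_add_right, inner_smul_right, smul_eq_mul]
  linear_combination (b) * (-hst)

lemma contact_iff {n : ℕ} (φ : EuclideanSpace ℝ (Fin n) → ℝ) (hφ : ContDiff ℝ 2 φ)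
    (a : EuclideanSpace ℝ (Fin n)) (b : ℝ) (hab : ∀ w, ⟪a, w⟫ + b ≤ φ w) (v : EuclideanSpace ℝ (Fin n)) :
    convEnv φ v = φ v ↔ ∀ w, 0 ≤ psi φ v w := by
  constructor
  · intro h
    by_contra hcon
    push Not at hcon
    obtain ⟨w₀, hw₀⟩ := hcon
    set d := w₀ - v with hd
    obtain ⟨M, hM1, hM⟩ := psi_le_quad φ hφ v ‖d‖
    set δ := -psi φ v w₀ with hδ
    have hδ0 : 0 < δ := by linarith
    set ε := min 1 (δ / (2 * (M * ‖d‖ ^ 2 + 1))) with hε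
    have hε0 : 0 < ε := by positivity
    have hε1 : ε ≤ 1 := min_le_left _ _
    have hε2 : M * ‖d‖ ^ 2 * ε ≤ δ / 2 := by
      have h1 : ε ≤ δ / (2 * (M * ‖d‖ ^ 2 + 1)) := min_le_right _ _
      rw [le_div_iff₀ (by positivity)] at h1
      nlinarith
    have h1 := hM (-(ε • d)) (by rw [norm_neg, norm_smul, Real.norm_of_nonneg hε0.le]; exact mul_le_of_le_one_left (norm_nonneg _) hε1)
    rw [norm_neg, norm_smul, Real.norm_of_nonneg hε0.le] at h1
    have hlt : convEnv φ v ≤ φ v - ε * δ / 4 := by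
      refine csSup_le ⟨_, _, convexOn_affine a b, hab, rfl⟩ ?_
      rintro y ⟨g, hg, hgφ, rfl⟩
      have h2 := hg.2 (Set.mem_univ (v + -(ε • d))) (Set.mem_univ w₀)
        (show 0 ≤ 1 / (1 + ε) by positivity) (show 0 ≤ ε / (1 + ε) by positivity) (by field_simp)
      have h3 : (1 / (1 + ε)) • (v + -(ε • d)) + (ε / (1 + ε)) • w₀ = v := by
        have : w₀ = v + d := by rw [hd]; abel
        rw [this]
        have h4 : (1 / (1 + ε)) • (v + -(ε • d)) + (ε / (1 + ε)) • (v + d) = (1 / (1 + ε) + ε / (1 + ε)) • v := by module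
        rw [h4, show 1 / (1 + ε) + ε / (1 + ε) = 1 by field_simp, one_smul]
      rw [h3] at h2
      simp only [smul_eq_mul] at h2
      have h5 := hgφ (v + -(ε • d))
      have h6 := hgφ w₀
      have h7 : φ (v + -(ε • d)) = psi φ v (v + -(ε • d)) + φ v - ε * ⟪gradient φ v, d⟫ := by
        simp [psi, inner_neg_right, inner_smul_right]; ring
      have h8 : φ w₀ = - δ + φ v + ⟪gradient φ v, d⟫ := by
        rw [hδ]; simp only [psi, ← hd]; ring
      have h9 : (1 + ε) * g v ≤ g (v + -(ε • d)) + ε * g w₀ := by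
        calc _ ≤ (1 + ε) * (1 / (1 + ε) * g (v + -(ε • d)) + ε / (1 + ε) * g w₀) := by gcongr
          _ = _ := by field_simp
      have h10 : ε * g w₀ ≤ ε * φ w₀ := by gcongr
      have h11 : (1 + ε) * g v ≤ (1 + ε) * φ v - ε * δ / 2 := by
        rw [h8] at h10
        have : M * (ε * ‖d‖) ^ 2 = M * ‖d‖ ^ 2 * ε * ε := by ring
        have := mul_le_mul_of_nonneg_right hε2 hε0.le
        nlinarith
      have : (1 + ε) * g v ≤ (1 + ε) * (φ v - ε * δ / 4) := by nlinarith [mul_pos hε0 hδ0]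
      exact le_of_mul_le_mul_left this (by positivity)
    have := mul_pos hε0 hδ0
    linarith
  · intro h
    refine le_antisymm (csSup_le ⟨_, _, convexOn_affine a b, hab, rfl⟩ ?_) (le_csSup ⟨φ v, ?_⟩ ?_)
    · rintro y ⟨g, hg, hgφ, rfl⟩; exact hgφ v
    · rintro y ⟨g, hg, hgφ, rfl⟩; exact hgφ v
    · refine ⟨_, convexOn_affine (gradient φ v) (φ v - ⟪gradient φ v, v⟫), fun w => ?_, by ring⟩
      have := h w
      simp only [psi, inner_sub_right] at this
      linarith

end contact

section generic
variable {E : Type*} [NormedAddCommGroup E] [InnerProductSpace ℝ E] [FiniteDimensional ℝ E]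
  [MeasurableSpace E] [BorelSpace E]

noncomputable def fR (φ : E → ℝ) (R : ℕ) (p : E) : ℝ :=
  sSup ((fun w => ⟪p, w⟫ - φ w) '' Metric.closedBall 0 R)

lemma le_fR (φ : E → ℝ) (hφ : Continuous φ) (R : ℕ) (p w : E) (hw : ‖w‖ ≤ R) : ⟪p, w⟫ - φ w ≤ fR φ R p := by
  refine le_csSup ((isCompact_closedBall (0:E) R).bddAbove_image (by fun_prop)) ⟨w, by simpa using hw, rfl⟩

lemma fR_le (φ : E → ℝ) (R : ℕ) (p : E) (c : ℝ) (h : ∀ w, ‖w‖ ≤ R → ⟪p, w⟫ - φ w ≤ c) : fR φ R p ≤ c := by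
  refine csSup_le ⟨_, 0, by simp, rfl⟩ ?_
  rintro _ ⟨w, hw, rfl⟩
  exact h w (by simpa using hw)

lemma lipschitz_fR (φ : E → ℝ) (hφ : Continuous φ) (R : ℕ) : LipschitzWith (R : NNReal) (fR φ R) := by
  refine LipschitzWith.of_le_add_mul _ fun x y => fR_le _ _ _ _ fun w hw => ?_
  have h1 := le_fR φ hφ R y w hw
  have h2 : ⟪x - y, w⟫ ≤ R * dist x y := by
    refine (real_inner_le_norm _ _).trans ?_
    rw [dist_eq_norm, mul_comm]; gcongr
  rw [inner_sub_left] at h2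
  simp only [NNReal.coe_natCast]
  linarith

lemma fderiv_fR (φ : E → ℝ) (hφ : Continuous φ) (R : ℕ) (p v : E) (hv : ‖v‖ ≤ R)
    (hdiff : DifferentiableAt ℝ (fR φ R) p) (hmax : ∀ w, ⟪p, w⟫ - φ w ≤ ⟪p, v⟫ - φ v) :
    fderiv ℝ (fR φ R) p = innerSL ℝ v := by
  have h1 : IsLocalMin (fun x => fR φ R x - innerSL ℝ v x) p := by
    refine Eventually.of_forall fun x => ?_
    have h2 := le_fR φ hφ R x v hv
    have h3 := fR_le φ R p _ fun w _ => hmax w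
    simp only [innerSL_apply_apply]
    have h4 := real_inner_comm v p
    have h5 := real_inner_comm v x
    linarith
  have h2 := h1.fderiv_eq_zero
  rw [fderiv_fun_sub hdiff (innerSL ℝ v).differentiableAt, ContinuousLinearMap.fderiv] at h2
  exact sub_eq_zero.1 h2

lemma unique_max (φ : E → ℝ) (hφ : Continuous φ) (p v w : E)
    (hdiff : ∀ R : ℕ, DifferentiableAt ℝ (fR φ R) p) (hv : ∀ x, ⟪p, x⟫ - φ x ≤ ⟪p, v⟫ - φ v)
    (hw : ∀ x, ⟪p, x⟫ - φ x ≤ ⟪p, w⟫ - φ w) : v = w := by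
  obtain ⟨R, hR⟩ := exists_nat_ge (max ‖v‖ ‖w‖)
  have h1 := fderiv_fR φ hφ R p v ((le_max_left _ _).trans hR) (hdiff R) hv
  have h2 := fderiv_fR φ hφ R p w ((le_max_right _ _).trans hR) (hdiff R) hw
  exact (innerSL_inj (𝕜 := ℝ)).1 (h1.symm.trans h2)

lemma null_preimage (g : E → E) (hg : ContDiff ℝ 1 g) (N : Set E) (hN : volume N = 0) :
    volume {v | (fderiv ℝ g v).det ≠ 0 ∧ g v ∈ N} = 0 := by
  refine measure_null_of_locally_null _ fun x hx => ?_
  let f' : E ≃L[ℝ] E := ContinuousLinearMap.toContinuousLinearEquivOfDetNeZero (fderiv ℝ g x) hx.1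
  have hf' : HasFDerivAt g (f' : E →L[ℝ] E) x := (hg.differentiable one_ne_zero x).hasFDerivAt
  have hst := hg.contDiffAt.hasStrictFDerivAt' (x := x) hf' one_ne_zero
  have h1 := hg.contDiffAt.to_localInverse (n := 1) hf' one_ne_zero
  have h2 := hst.eventually_left_inverse
  set h : E → E := hst.localInverse g f' x with hh
  have h3 : ∀ᶠ y in nhds (g x), DifferentiableAt ℝ h y := by
    have h4 := h1.eventually (by simp)
    filter_upwards [h4] with y hy using hy.differentiableAt one_ne_zero
  have h5 : ∀ᶠ y in nhds x, h (g y) = y ∧ DifferentiableAt ℝ h (g y) :=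
    h2.and (hg.continuous.continuousAt.eventually h3)
  refine ⟨{y | h (g y) = y ∧ DifferentiableAt ℝ h (g y)} ∩ {v | (fderiv ℝ g v).det ≠ 0 ∧ g v ∈ N},
    inter_mem (mem_nhdsWithin_of_mem_nhds h5) self_mem_nhdsWithin, ?_⟩
  refine measure_mono_null (t := h '' (N ∩ {y | DifferentiableAt ℝ h y})) ?_ ?_
  · rintro y ⟨⟨hy1, hy2⟩, _, hy3⟩
    exact ⟨g y, ⟨hy3, hy2⟩, hy1⟩
  · refine addHaar_image_eq_zero_of_differentiableOn_of_addHaar_eq_zero _ (fun y hy => hy.2.differentiableWithinAt) ?_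
    exact measure_mono_null Set.inter_subset_left hN

lemma gradient_symm (φ : E → ℝ) (hφ : ContDiff ℝ 2 φ) (v x y : E) :
    ⟪fderiv ℝ (gradient φ) v x, y⟫ = ⟪x, fderiv ℝ (gradient φ) v y⟫ := by
  have hs := (hφ.contDiffAt (x := v)).isSymmSndFDerivAt (by simp)
  have hg : DifferentiableAt ℝ (gradient φ) v := (contDiff_gradient hφ).differentiable (by norm_num) v
  have h1 : ∀ w, fderiv ℝ φ w = (InnerProductSpace.toDual ℝ E) (gradient φ w) := by
    intro w; simp [gradient]
  have h2 : ∀ a b, fderiv ℝ (fderiv ℝ φ) v a b = ⟪fderiv ℝ (gradient φ) v a, b⟫ := by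
    intro a b
    have h3 : fderiv ℝ φ = fun w => innerSL ℝ (gradient φ w) := by
      funext w; rw [h1 w]; rfl
    have h4 : HasFDerivAt (fun w => innerSL ℝ (gradient φ w)) ((innerSL ℝ).comp (fderiv ℝ (gradient φ) v)) v :=
      (innerSL ℝ (E := E)).hasFDerivAt.comp v hg.hasFDerivAt
    rw [h3, h4.fderiv]
    rfl
  have := hs x y
  rw [h2, h2] at this
  rw [this, real_inner_comm]

end generic

section polytope
variable {E : Type*} [NormedAddCommGroup E] [InnerProductSpace ℝ E] [FiniteDimensional ℝ E]

lemma lse_lower (S A : Finset E) (hSA : S ⊆ A) (p : E) (hp : p ∈ convexHull ℝ (S : Set E)) (w : E) :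
    ⟪p, w⟫ ≤ Real.log (∑ α ∈ A, Real.exp ⟪α, w⟫) := by
  have h1 : convexHull ℝ (S : Set E) ⊆ {x | ⟪x, w⟫ ≤ Real.log (∑ α ∈ A, Real.exp ⟪α, w⟫)} := by
    refine convexHull_min (fun α hα => ?_) (convex_halfSpace_le ⟨fun x y => inner_add_left _ _ _, fun c x => by simp [inner_smul_left]⟩ _)
    have h2 : Real.exp ⟪α, w⟫ ≤ ∑ α ∈ A, Real.exp ⟪α, w⟫ :=
      Finset.single_le_sum (f := fun α => Real.exp ⟪α, w⟫) (fun i _ => (Real.exp_pos _).le) (hSA hα)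
    have := Real.log_le_log (Real.exp_pos _) h2
    rwa [Real.log_exp] at this
  exact h1 hp

lemma lse_upper (A : Finset E) (hA : A.Nonempty) (w : E) (c : ℝ) (h : ∀ α ∈ A, ⟪α, w⟫ ≤ c) :
    Real.log (∑ α ∈ A, Real.exp ⟪α, w⟫) ≤ c + Real.log A.card := by
  have hpos : 0 < ∑ α ∈ A, Real.exp ⟪α, w⟫ := Finset.sum_pos (fun i _ => Real.exp_pos _) hA
  have hc : 0 < A.card := hA.card_pos
  have h1 : ∑ α ∈ A, Real.exp ⟪α, w⟫ ≤ Real.exp c * A.card := by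
    calc _ ≤ ∑ α ∈ A, Real.exp c := Finset.sum_le_sum fun α hα => Real.exp_le_exp.2 (h α hα)
      _ = _ := by simp [mul_comm]
  have := Real.log_le_log hpos h1
  rwa [Real.log_mul (Real.exp_pos _).ne' (by positivity), Real.log_exp] at this

lemma hspan_of_interior (S A : Finset E) (hSA : S ⊆ A) (hinterior : (interior (convexHull ℝ (S : Set E))).Nonempty) :
    ∀ u ≠ (0:E), ∀ c : ℝ, ∃ α ∈ A, ⟪α, u⟫ ≠ c := by
  intro u hu c
  by_contra hcon
  push Not at hcon
  have h1 : convexHull ℝ (S : Set E) ⊆ {x | ⟪x, u⟫ = c} := by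
    refine convexHull_min (fun α hα => hcon α (hSA hα)) (convex_hyperplane ⟨fun x y => inner_add_left _ _ _, fun c x => by simp [inner_smul_left]⟩ _)
  obtain ⟨x, hx⟩ := hinterior
  have h2 : ∀ᶠ t : ℝ in nhds 0, x + t • u ∈ convexHull ℝ (S : Set E) := by
    have hc : ContinuousAt (fun t : ℝ => x + t • u) 0 := by fun_prop
    refine hc.eventually_mem ?_
    simpa using mem_interior_iff_mem_nhds.1 hx
  obtain ⟨ε, hε, h3⟩ := Metric.eventually_nhds_iff_ball.1 h2
  have h4 := h1 (h3 (ε / 2) (by simp [abs_of_pos hε]; linarith))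
  have h5 := h1 (interior_subset hx)
  simp only [Set.mem_setOf_eq, inner_add_left, inner_smul_left, conj_trivial] at h4 h5
  have h6 : 0 < ⟪u, u⟫ := real_inner_self_pos.2 hu
  have : 0 < ε / 2 * ⟪u, u⟫ := by positivity
  linarith

lemma grad_mem (φ : E → ℝ) (Δ : Set E) (hconv : Convex ℝ Δ) (hclosed : IsClosed Δ) (L : ℝ)
    (hup : ∀ w c, (∀ a ∈ Δ, ⟪a, w⟫ ≤ c) → φ w ≤ c + L) (v : E) (hv : ∀ w, 0 ≤ psi φ v w) :
    gradient φ v ∈ Δ := by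
  by_contra hcon
  obtain ⟨f, c, h1, h2⟩ := geometric_hahn_banach_closed_point hconv hclosed hcon
  obtain ⟨u, rfl⟩ := (InnerProductSpace.toDual ℝ E).surjective f
  simp only [InnerProductSpace.toDual_apply_apply] at h1 h2
  have h3 : ∀ t : ℝ, 0 ≤ t → t * (⟪u, gradient φ v⟫ - c) ≤ L - φ v + ⟪gradient φ v, v⟫ := by
    intro t ht
    have h4 := hup (t • u) (t * c) (fun a ha => by
      rw [inner_smul_right, real_inner_comm]
      exact mul_le_mul_of_nonneg_left (h1 a ha).le ht)
    have h5 := hv (t • u)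
    simp only [psi, inner_sub_right, inner_smul_right] at h5
    rw [real_inner_comm] at h5
    rw [real_inner_comm] at h5
    have h6 := real_inner_comm u (gradient φ v)
    rw [h6] at h5
    linarith
  set g := ⟪u, gradient φ v⟫ - c
  have hg : 0 < g := by simp only [g]; linarith
  have h7 := h3 ((|L - φ v + ⟪gradient φ v, v⟫| + 1) / g) (by positivity)
  rw [div_mul_cancel₀ _ hg.ne'] at h7
  linarith [le_abs_self (L - φ v + ⟪gradient φ v, v⟫)]

lemma coercive (φ : E → ℝ) (Δ : Set E) (M : ℝ) (hlow : ∀ p ∈ Δ, ∀ w, ⟪p, w⟫ - M ≤ φ w) (v : E)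
    (hv : gradient φ v ∈ interior Δ) : ∃ r C : ℝ, 0 < r ∧ ∀ u, r * ‖u‖ - C ≤ psi φ v (v + u) := by
  obtain ⟨ε, hε, hb⟩ := Metric.mem_nhds_iff.1 (mem_interior_iff_mem_nhds.1 hv)
  set p := gradient φ v with hp
  refine ⟨ε / 2, ε / 2 * ‖v‖ + M + φ v - ⟪p, v⟫, by positivity, fun u => ?_⟩
  have h1 : ⟪p, v + u⟫ + ε / 2 * ‖v + u‖ - M ≤ φ (v + u) := by
    by_cases h0 : v + u = 0
    · have := hlow p (hb (by simpa using hε)) (v + u)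
      rw [h0] at this ⊢
      simpa using this
    have hn : 0 < ‖v + u‖ := norm_pos_iff.2 h0
    have := hlow (p + (ε / 2 / ‖v + u‖) • (v + u)) (hb (by
      simp only [Metric.mem_ball, dist_self_add_left, norm_smul]
      rw [Real.norm_of_nonneg (by positivity), div_mul_cancel₀ _ hn.ne']; linarith)) (v + u)
    rw [inner_add_left, inner_smul_left, real_inner_self_eq_norm_sq] at this
    simp only [conj_trivial] at this
    rw [show ε / 2 / ‖v + u‖ * ‖v + u‖ ^ 2 = ε / 2 * ‖v + u‖ by field_simp] at this
    exact this
  have h2 : ‖u‖ ≤ ‖v + u‖ + ‖v‖ := by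
    have := norm_sub_le (v + u) v
    rwa [add_sub_cancel_left] at this
  have h3 := mul_le_mul_of_nonneg_left h2 (show 0 ≤ ε / 2 by positivity)
  simp only [psi, ← hp, add_sub_cancel_left]
  rw [inner_add_right] at h1
  linarith

end polytope

section core
variable {n : ℕ}

lemma core_limit (φ d : EuclideanSpace ℝ (Fin n) → ℝ) (hφ : ContDiff ℝ 2 φ) (hd : Continuous d) (hd0 : ∀ w, 0 < d w)
    (Δ : Set (EuclideanSpace ℝ (Fin n))) (hΔ : Bornology.IsBounded Δ)
    (Λ : ℕ → Finset (EuclideanSpace ℝ (Fin n)))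
    (hΛ : ∀ k : ℕ, 1 ≤ k → ((Λ k : Set (EuclideanSpace ℝ (Fin n)))
      = Δ ∩ {p | ∀ i, ∃ m : ℤ, p i = (m : ℝ) / (k : ℝ)}))
    (v : EuclideanSpace ℝ (Fin n)) (X : EuclideanSpace ℝ (Fin n) → ENNReal) (hX0 : ∀ q, X q ≠ 0)
    (hX : ∀ q, Tendsto (fun k : ℕ => ENNReal.ofReal (Real.sqrt k ^ (Module.finrank ℝ (EuclideanSpace ℝ (Fin n)))) *
      JJ φ d v k (grid k (gradient φ v + (Real.sqrt k)⁻¹ • q))) atTop (nhds (X q)))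
    (hcase : (∀ q, X q = ⊤) ∨ gradient φ v ∈ interior Δ) :
    Tendsto (fun k : ℕ => (∑ p ∈ Λ k, ((JJ φ d v k p)⁻¹).toReal) / (k:ℝ) ^ n) atTop
      (nhds (∫ q, ((X q)⁻¹).toReal)) := by
  obtain ⟨C, c, hC, hc, hbd⟩ := gaussian_bound φ d hφ hd hd0 v Δ hΔ
  rw [finrank_euclideanSpace_fin] at hbd
  refine riemann_tendsto Δ Λ hΛ (fun k p => ((JJ φ d v k p)⁻¹).toReal) (gradient φ v) _ C c hc hC
    (fun k p => ENNReal.toReal_nonneg) hbd fun q => ?_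
  have h1 : Tendsto (fun k : ℕ => (Real.sqrt k ^ n)⁻¹ *
      ((JJ φ d v k (grid k (gradient φ v + (Real.sqrt k)⁻¹ • q)))⁻¹).toReal) atTop (nhds ((X q)⁻¹).toReal) := by
    have h2 := (ENNReal.tendsto_toReal (a := (X q)⁻¹) (by simpa using hX0 q)).comp (hX q).inv
    refine h2.congr fun k => ?_
    simp only [Function.comp, finrank_euclideanSpace_fin]
    rw [ENNReal.toReal_inv, ENNReal.toReal_inv, ENNReal.toReal_mul, ENNReal.toReal_ofReal (by positivity), mul_inv]
  rcases hcase with htop | hinterior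
  · rw [htop q] at h1 ⊢
    simp only [ENNReal.inv_top, ENNReal.toReal_zero] at h1 ⊢
    refine squeeze_zero (fun k => ?_) (fun k => ?_) h1
    · exact mul_nonneg (by positivity) (Set.indicator_nonneg (fun _ _ => ENNReal.toReal_nonneg) _)
    · refine mul_le_mul_of_nonneg_left ?_ (by positivity)
      exact Set.indicator_le_self' (fun _ _ => ENNReal.toReal_nonneg) _
  · refine h1.congr' ?_
    have h2 : ∀ᶠ k : ℕ in atTop, grid k (gradient φ v + (Real.sqrt k)⁻¹ • q) ∈ Δ :=
      (tendsto_grid _ _).eventually_mem (mem_interior_iff_mem_nhds.1 hinterior)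
    filter_upwards [h2] with k hk
    rw [Set.indicator_of_mem hk]

lemma pd_of_psd {E : Type*} [NormedAddCommGroup E] [InnerProductSpace ℝ E] [FiniteDimensional ℝ E] (H : E →L[ℝ] E) (hsym : ∀ x y, ⟪H x, y⟫ = ⟪x, H y⟫)
    (hpsd : ∀ u, 0 ≤ ⟪H u, u⟫) (hdet : H.det ≠ 0) (u : E) (hu : u ≠ 0) : 0 < ⟪H u, u⟫ := by
  rcases (hpsd u).lt_or_eq with h | h
  · exact h
  exfalso
  have hHu : H u ≠ 0 := by
    intro h0
    have : u = 0 := by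
      let e := ContinuousLinearMap.toContinuousLinearEquivOfDetNeZero H hdet
      have : e u = 0 := h0
      simpa using this
    exact hu this
  have ha : 0 < ⟪H u, H u⟫ := real_inner_self_pos.2 hHu
  set a := ⟪H u, H u⟫
  set b := ⟪H (H u), H u⟫ with hb
  have hb0 : 0 ≤ b := hpsd _
  have h1 : ∀ t : ℝ, 0 ≤ 2 * t * a + t ^ 2 * b := by
    intro t
    have h2 := hpsd (u + t • H u)
    simp only [map_add, map_smul, inner_add_left, inner_add_right, inner_smul_left, inner_smul_right, conj_trivial] at h2
    rw [← h, hsym (H u) u, ← hb] at h2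
    change 0 ≤ 0 + t * a + t * (a + t * b) at h2
    linarith
  have h3 := h1 (-a / (b + 1))
  have h4 : 2 * (-a / (b + 1)) * a + (-a / (b + 1)) ^ 2 * b = - (a ^ 2 * (b + 2) / (b + 1) ^ 2) := by
    field_simp; ring
  have : 0 < a ^ 2 * (b + 2) / (b + 1) ^ 2 := by positivity
  linarith

lemma core_main (φ d : EuclideanSpace ℝ (Fin n) → ℝ) (hφ : ContDiff ℝ 2 φ) (hd : Continuous d) (hd0 : ∀ w, 0 < d w)
    (Dm : ℝ) (hDm : ∀ w, d w ≤ Dm)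
    (Δ : Set (EuclideanSpace ℝ (Fin n))) (hΔ : Bornology.IsBounded Δ) (hconv : Convex ℝ Δ) (hclosed : IsClosed Δ)
    (M L : ℝ) (hlow : ∀ p ∈ Δ, ∀ w, ⟪p, w⟫ - M ≤ φ w)
    (hup : ∀ w c, (∀ a ∈ Δ, ⟪a, w⟫ ≤ c) → φ w ≤ c + L)
    (Λ : ℕ → Finset (EuclideanSpace ℝ (Fin n)))
    (hΛ : ∀ k : ℕ, 1 ≤ k → ((Λ k : Set (EuclideanSpace ℝ (Fin n)))
      = Δ ∩ {p | ∀ i, ∃ m : ℤ, p i = (m : ℝ) / (k : ℝ)}))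
    (v : EuclideanSpace ℝ (Fin n))
    (hgood : (fderiv ℝ (gradient φ) v).det ≠ 0 → gradient φ v ∉ frontier Δ ∧
      ∀ R : ℕ, DifferentiableAt ℝ (fR φ R) (gradient φ v)) :
    ((∀ w, 0 ≤ psi φ v w) → Tendsto (fun k : ℕ => (∑ p ∈ Λ k, ((JJ φ d v k p)⁻¹).toReal) / (k:ℝ) ^ n) atTop
      (nhds ((fderiv ℝ (gradient φ) v).det / d v))) ∧
    ((¬ ∀ w, 0 ≤ psi φ v w) → Tendsto (fun k : ℕ => (∑ p ∈ Λ k, ((JJ φ d v k p)⁻¹).toReal) / (k:ℝ) ^ n) atTop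
      (nhds 0)) := by
  set H := fderiv ℝ (gradient φ) v with hH
  have hsym := gradient_symm φ hφ v
  constructor
  · intro hpsi
    by_cases hdet : H.det = 0
    · obtain ⟨u, hu, hu0⟩ := (Submodule.ne_bot_iff _).1 (LinearMap.bot_lt_ker_of_det_eq_zero (f := (H : EuclideanSpace ℝ (Fin n) →ₗ[ℝ] EuclideanSpace ℝ (Fin n))) hdet).ne'
      have := core_limit φ d hφ hd hd0 Δ hΔ Λ hΛ v (fun _ => ⊤) (by simp) (fun q => 
        fatou_top φ d hφ hd v _ q (tendsto_grid_scaled _ q) 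
          (gaussI_eq_top H hsym u hu0 hu (d v) (hd0 v) q)) (Or.inl fun _ => rfl)
      simpa [hdet] using this
    · obtain ⟨hfr, hdiff⟩ := hgood hdet
      have hmem := grad_mem φ Δ hconv hclosed L hup v hpsi
      have hinterior : gradient φ v ∈ interior Δ := by
        by_contra h
        exact hfr ⟨subset_closure hmem, h⟩
      have hpsd : ∀ u, 0 ≤ ⟪H u, u⟫ := by
        intro u
        have := ge_of_tendsto' (tendsto_scaled_psi φ hφ v u) (b := 0) (fun k => mul_nonneg (by positivity) (hpsi _))
        linarith
      have hpd := pd_of_psd H hsym hpsd hdet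
      have hmaxv : ∀ x, ⟪gradient φ v, x⟫ - φ x ≤ ⟪gradient φ v, v⟫ - φ v := by
        intro x
        have := hpsi x
        simp only [psi, inner_sub_right] at this
        linarith
      have hpos : ∀ w, w ≠ v → 0 < psi φ v w := by
        intro w hw
        rcases (hpsi w).lt_or_eq with h | h
        · exact h
        exfalso
        refine hw (unique_max φ hφ.continuous (gradient φ v) w v hdiff (fun x => ?_) hmaxv)
        have := hmaxv x
        simp only [psi, inner_sub_right] at h
        linarith
      obtain ⟨r, C, hr, hco⟩ := coercive φ Δ M hlow v hinterior
      obtain ⟨c, δ, hc, hδ, hg1, hg2⟩ := growth φ hφ v hpd hpos r C hr hco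
      obtain ⟨hne, hintg⟩ := gaussI_facts H hsym hpd (d v) (hd0 v)
      have := core_limit φ d hφ hd hd0 Δ hΔ Λ hΛ v (fun q => gaussI H (d v) q) hne (fun q => 
        dct_case φ d hφ hd hd0 Dm hDm v c δ hc hg1 hg2 _ q (tendsto_grid_scaled _ q)) (Or.inr hinterior)
      rwa [hintg] at this
  · intro h
    push Not at h
    obtain ⟨w₀, hw₀⟩ := h
    have := core_limit φ d hφ hd hd0 Δ hΔ Λ hΛ v (fun _ => ⊤) (by simp) (fun q => 
        neg_top φ d hφ.continuous hd hd0 v w₀ hw₀ _ (tendsto_grid _ q)) (Or.inl fun _ => rfl)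
    simpa using this

end core

/-- toric model of the convergence `k^{−n}B_k → 1_{D∩X(0)} det(dd^cφ)`.
With `φ = φ_Δ + χ` as in the toric setup, `Λ_k = Δ ∩ (k^{−1}ℤ)ⁿ`,
`N_{k,p} = ∫ e^{k(⟨p,w⟩−φ(w))} det(D²φ_Δ(w)) dw`, and toric Bergman function
`B_k(v) = ∑_{p ∈ Λ_k} e^{k(⟨p,v⟩−φ(v))}/N_{k,p}`, for almost every `v`,
`k^{−n}B_k(v) → 1_D(v) · det(D²φ(v))/det(D²φ_Δ(v))`, where `D = {φ_e = φ}` is the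
contact set of the convex envelope and `D²` is realized as the derivative of the
gradient map. -/
theorem bergman_function_ae_convergence_toric (n : ℕ) (hn : 1 ≤ n)
    (S : Finset (EuclideanSpace ℝ (Fin n)))
    (hS : ∀ α ∈ S, ∀ i, ∃ m : ℤ, α i = (m : ℝ))
    (Δ : Set (EuclideanSpace ℝ (Fin n)))
    (hΔ : Δ = convexHull ℝ (S : Set (EuclideanSpace ℝ (Fin n))))
    (hΔint : (interior Δ).Nonempty)
    (A : Finset (EuclideanSpace ℝ (Fin n)))
    (hA : (A : Set (EuclideanSpace ℝ (Fin n))) = Δ ∩ {v | ∀ i, ∃ m : ℤ, v i = (m : ℝ)})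
    (φΔ χ φ : EuclideanSpace ℝ (Fin n) → ℝ)
    (hφΔ : ∀ v, φΔ v = Real.log (∑ α ∈ A, Real.exp ⟪α, v⟫))
    (hχ : ContDiff ℝ (⊤ : ℕ∞) χ) (hχc : HasCompactSupport χ)
    (hφ : φ = φΔ + χ)
    (Λ : ℕ → Finset (EuclideanSpace ℝ (Fin n)))
    (hΛ : ∀ k : ℕ, 1 ≤ k → ((Λ k : Set (EuclideanSpace ℝ (Fin n)))
      = Δ ∩ {p | ∀ i, ∃ m : ℤ, p i = (m : ℝ) / (k : ℝ)}))
    (N : ℕ → EuclideanSpace ℝ (Fin n) → ℝ)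
    (hN : ∀ k p, N k p
      = ∫ w, Real.exp ((k : ℝ) * (⟪p, w⟫ - φ w)) * (fderiv ℝ (gradient φΔ) w).det)
    (B : ℕ → EuclideanSpace ℝ (Fin n) → ℝ)
    (hB : ∀ k v, B k v = ∑ p ∈ Λ k, Real.exp ((k : ℝ) * (⟪p, v⟫ - φ v)) / N k p) :
    ∀ᵐ v ∂volume, Tendsto (fun k : ℕ => B k v / (k : ℝ) ^ n) atTop
      (nhds (if convEnv φ v = φ v then
        (fderiv ℝ (gradient φ) v).det / (fderiv ℝ (gradient φΔ) v).det else 0)) := by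
  classical
  have hSA : S ⊆ A := by
    intro α hα
    have : α ∈ (A : Set (EuclideanSpace ℝ (Fin n))) := by
      rw [hA, hΔ]; exact ⟨subset_convexHull ℝ _ hα, hS α hα⟩
    exact this
  have hAΔ : ∀ α ∈ A, α ∈ Δ := fun α hα => by
    have : α ∈ (A : Set (EuclideanSpace ℝ (Fin n))) := hα
    rw [hA] at this; exact this.1
  have hSne : S.Nonempty := by
    obtain ⟨x, hx⟩ := hΔint
    have := interior_subset hx
    rw [hΔ] at this
    exact Finset.coe_nonempty.1 (convexHull_nonempty_iff.1 ⟨x, this⟩)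
  have hAne : A.Nonempty := hSne.mono hSA
  have hspan := hspan_of_interior S A hSA (hΔ ▸ hΔint)
  obtain ⟨hdc, hd0, Dm, hDm0, hDm⟩ := lse_det_facts hAne hspan φΔ hφΔ
  have hφΔc : ContDiff ℝ 2 φΔ := by
    have : φΔ = fun v => Real.log (lseZ A v) := by
      funext v; rw [hφΔ v]; rfl
    rw [this]; exact contDiff_lse hAne
  have hφc : ContDiff ℝ 2 φ := by
    rw [hφ]; exact hφΔc.add (hχ.of_le (show ((2 : ℕ∞) : WithTop ℕ∞) ≤ ((⊤ : ℕ∞) : WithTop ℕ∞) from WithTop.coe_le_coe.2 le_top))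
  obtain ⟨M, hM⟩ := hχc.exists_bound_of_continuous hχ.continuous
  have hcomp : IsCompact Δ := by
    rw [hΔ]; exact Set.Finite.isCompact_convexHull (𝕜 := ℝ) S.finite_toSet
  have hconv : Convex ℝ Δ := by rw [hΔ]; exact convex_convexHull ℝ _
  have hlow : ∀ p ∈ Δ, ∀ w, ⟪p, w⟫ - M ≤ φ w := by
    intro p hp w
    have h1 := lse_lower S A hSA p (hΔ ▸ hp) w
    have h2 := (abs_le.1 (hM w)).1
    rw [← hφΔ] at h1
    rw [hφ, Pi.add_apply]; linarith
  have hup : ∀ w c, (∀ a ∈ Δ, ⟪a, w⟫ ≤ c) → φ w ≤ c + (Real.log A.card + M) := by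
    intro w c h
    have h1 := lse_upper A hAne w c fun α hα => h α (hAΔ α hα)
    have h2 := (abs_le.1 (hM w)).2
    rw [← hφΔ] at h1
    rw [hφ, Pi.add_apply]; linarith
  obtain ⟨α₀, hα₀⟩ := hAne
  let NP : Set (EuclideanSpace ℝ (Fin n)) := frontier Δ ∪ ⋃ R : ℕ, {p | ¬ DifferentiableAt ℝ (fR φ R) p}
  have hNP : volume NP = 0 := by
    refine measure_union_null (hconv.addHaar_frontier _) (measure_iUnion_null fun R => ?_)
    exact (lipschitz_fR φ hφc.continuous R).ae_differentiableAt
  have hnull := null_preimage (gradient φ) (contDiff_gradient hφc) NP hNP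
  have hae : ∀ᵐ v ∂(volume : Measure (EuclideanSpace ℝ (Fin n))),
      ¬ ((fderiv ℝ (gradient φ) v).det ≠ 0 ∧ gradient φ v ∈ NP) := by
    rw [ae_iff]; simpa using hnull
  filter_upwards [hae] with v hv
  have hgood : (fderiv ℝ (gradient φ) v).det ≠ 0 → gradient φ v ∉ frontier Δ ∧
      ∀ R : ℕ, DifferentiableAt ℝ (fR φ R) (gradient φ v) := by
    intro hdet
    have h1 : gradient φ v ∉ NP := fun h => hv ⟨hdet, h⟩
    refine ⟨fun h => h1 (Or.inl h), fun R => ?_⟩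
    by_contra h
    exact h1 (Or.inr (Set.mem_iUnion.2 ⟨R, h⟩))
  obtain ⟨hc1, hc2⟩ := core_main φ (fun w => (fderiv ℝ (gradient φΔ) w).det) hφc hdc hd0 Dm hDm Δ
    hcomp.isBounded hconv hcomp.isClosed M _ hlow hup Λ hΛ v hgood
  have hBeq : ∀ k, B k v = ∑ p ∈ Λ k, ((JJ φ (fun w => (fderiv ℝ (gradient φΔ) w).det) v k p)⁻¹).toReal := by
    intro k
    rw [hB]
    refine Finset.sum_congr rfl fun p _ => ?_
    rw [hN]
    exact term_eq φ _ hφc.continuous hdc hd0 v k p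
  simp only [hBeq]
  have hiff := contact_iff φ hφc α₀ (-M) (fun w => by
    have := hlow α₀ (hAΔ _ hα₀) w
    linarith) v
  split_ifs with h
  · exact hc1 (hiff.1 h)
  · exact hc2 (fun h' => h (hiff.2 h'))
end
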